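/- arXiv:2301.00186 — 3 statements merged into one kernel-verified Lean document; each statement's English description precedes it below -/
import Mathlib

section
/- Let (X, μ) be a σ-finite measure space and 1 < p < 2. Suppose T : L^p(X, μ) → L^p(X, μ) is positive (it maps μ-a.e. nonnegative functions to μ-a.e. nonnegative functions) and belongs to the closure, with respect to the strong operator topology, of the convex hull of the set of all Lamperti contractions on L^p(X, μ). Then there exists a constant C depending only on p such that for every N ∈ ℕ, every strictly increasing finite sequence n_0 < n_1 < ⋯ < n_N of positive integers, and every x ∈ L^p(X, μ), one has ‖ ( ∑_{i=0}^{N-1} |M_{n_i}(T)x − M_{n_{i+1}}(T)x|^2 )^{1/2} ‖_{L^p(X,μ)} ≤ C ‖x‖_{L^p(X,μ)}. (This is the commutative case of Theorem 1.3 for 1 < p < 2.) -/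
open MeasureTheory Finset ENNReal
open scoped ComplexOrder

/-- One-sided ergodic average `M_n(T) = (1/(n+1)) ∑_{k=0}^{n} T^k`. -/
noncomputable def ergAvg {X : Type*} [MeasurableSpace X] {μ : MeasureTheory.Measure X}
    {p : ℝ≥0∞} [Fact (1 ≤ p)]
    (T : Lp ℂ p μ →L[ℂ] Lp ℂ p μ) (n : ℕ) : Lp ℂ p μ →L[ℂ] Lp ℂ p μ :=
  ((n : ℂ) + 1)⁻¹ • ∑ k ∈ Finset.range (n + 1), T ^ k

/-- A bounded operator on `L^p(X, μ)` is Lamperti (disjointness preserving) if it maps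
μ-a.e. disjointly supported pairs of functions to μ-a.e. disjointly supported pairs. -/
def IsLamperti {X : Type*} [MeasurableSpace X] {μ : MeasureTheory.Measure X}
    {p : ℝ≥0∞} [Fact (1 ≤ p)]
    (S : Lp ℂ p μ →L[ℂ] Lp ℂ p μ) : Prop :=
  ∀ f g : Lp ℂ p μ, (∀ᵐ ω ∂μ, (f : X → ℂ) ω * (g : X → ℂ) ω = 0) →
    (∀ᵐ ω ∂μ, (S f : X → ℂ) ω * (S g : X → ℂ) ω = 0)

/-- A bounded operator on `L^p(X, μ)` is positive if it maps a.e. nonnegative functions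
to a.e. nonnegative functions (for the order on `ℂ` where `0 ≤ z` iff `z` is a
nonnegative real). -/
def IsPositiveOp {X : Type*} [MeasurableSpace X] {μ : MeasureTheory.Measure X}
    {p : ℝ≥0∞} [Fact (1 ≤ p)]
    (S : Lp ℂ p μ →L[ℂ] Lp ℂ p μ) : Prop :=
  ∀ f : Lp ℂ p μ, (∀ᵐ ω ∂μ, 0 ≤ (f : X → ℂ) ω) → (∀ᵐ ω ∂μ, 0 ≤ (S f : X → ℂ) ω)

namespace QME

/-- Cesàro mean of the first `n+1` terms. -/
noncomputable def cav (n : ℕ) (c : ℕ → ℂ) : ℂ := ((n : ℂ) + 1)⁻¹ * ∑ k ∈ range (n + 1), c k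

noncomputable def av (n : ℕ) (a : ℕ → ℂ) (j : ℕ) : ℂ := cav n (fun k => a (j + k))

noncomputable def Sq (N : ℕ) (n : ℕ → ℕ) (a : ℕ → ℂ) (j : ℕ) : ℝ :=
  ∑ i ∈ range N, ‖av (n i) a j - av (n (i + 1)) a j‖ ^ 2

lemma ncast_ne (n : ℕ) : ((n : ℂ) + 1) ≠ 0 := by exact_mod_cast Nat.succ_ne_zero n

lemma norm_ncast (n : ℕ) : ‖((n : ℂ) + 1)‖ = (n : ℝ) + 1 := by
  have : ((n : ℂ) + 1) = ((n + 1 : ℕ) : ℂ) := by push_cast; ring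
  rw [this, Complex.norm_natCast]; push_cast; ring

lemma mul_cav (n : ℕ) (c : ℕ → ℂ) : ((n : ℂ) + 1) * cav n c = ∑ k ∈ range (n + 1), c k := by
  unfold cav
  rw [← mul_assoc, mul_inv_cancel₀ (ncast_ne n), one_mul]

lemma cav_diff (c : ℕ → ℂ) {m n : ℕ} (h : m ≤ n) :
    ((n : ℂ) + 1) * (cav n c - cav m c) = ∑ k ∈ Ico (m + 1) (n + 1), (c k - cav m c) := by
  rw [mul_sub, mul_cav, Finset.sum_sub_distrib, Finset.sum_const, Nat.card_Ico,
    Finset.sum_Ico_eq_sub _ (by omega : m + 1 ≤ n + 1), ← mul_cav m]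
  have : (n + 1 - (m + 1) : ℕ) = n - m := by omega
  rw [this, nsmul_eq_mul, Nat.cast_sub h]
  ring

lemma cav_diff_norm (c : ℕ → ℂ) {m n : ℕ} (h : m ≤ n) :
    ‖cav n c - cav m c‖ ≤ ((n : ℝ) + 1)⁻¹ * ∑ k ∈ Ico (m + 1) (n + 1), ‖c k - cav m c‖ := by
  have h1 := congrArg norm (cav_diff c h)
  rw [norm_mul, norm_ncast] at h1
  have h2 := norm_sum_le (Ico (m + 1) (n + 1)) (fun k => c k - cav m c)
  rw [← h1] at h2
  have h3 : (0 : ℝ) < (n : ℝ) + 1 := by positivity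
  rw [inv_mul_eq_div, le_div_iff₀ h3]
  linarith

lemma cav_norm_le (c : ℕ → ℂ) (n : ℕ) :
    ‖cav n c‖ ≤ ((n : ℝ) + 1)⁻¹ * ∑ k ∈ range (n + 1), ‖c k‖ := by
  unfold cav
  rw [norm_mul, norm_inv, norm_ncast]
  gcongr
  exact norm_sum_le _ _

lemma cav_sub_const (c : ℕ → ℂ) (n : ℕ) (w : ℂ) :
    cav n (fun k => c k - w) = cav n c - w := by
  unfold cav
  rw [Finset.sum_sub_distrib, mul_sub]
  congr 1
  rw [Finset.sum_const, card_range, nsmul_eq_mul]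
  push_cast
  rw [← mul_assoc, inv_mul_cancel₀ (ncast_ne n), one_mul]

lemma pow_sub_norm (z : ℂ) (hz : ‖z‖ = 1) {k l : ℕ} (h : k ≤ l) :
    ‖z ^ l - z ^ k‖ ≤ l * ‖1 - z‖ := by
  obtain ⟨d, rfl⟩ := Nat.exists_eq_add_of_le h
  have : z ^ (k + d) - z ^ k = z ^ k * (z ^ d - 1) := by ring
  rw [this, norm_mul, norm_pow, hz, one_pow, one_mul]
  have h2 : ‖z ^ d - 1‖ ≤ d * ‖1 - z‖ := by
    rw [← mul_geom_sum, norm_mul, ← norm_neg (z - 1), neg_sub, mul_comm]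
    gcongr
    refine (norm_sum_le _ _).trans ?_
    simp [hz]
  refine h2.trans ?_
  gcongr
  linarith [(Nat.cast_nonneg k : (0 : ℝ) ≤ k)]

lemma D_norm (z : ℂ) (hz : ‖z‖ = 1) (n : ℕ) : ‖cav n (fun k => z ^ k)‖ ≤ 1 := by
  refine (cav_norm_le _ _).trans ?_
  simp only [norm_pow, hz, one_pow, sum_const, card_range, nsmul_eq_mul, mul_one]
  push_cast
  rw [inv_mul_cancel₀ (by positivity)]

lemma D_small (z : ℂ) (hz : ‖z‖ = 1) {m n : ℕ} (h : m ≤ n) :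
    ‖cav n (fun k => z ^ k) - cav m (fun k => z ^ k)‖ ≤ ((n : ℝ) - m) * ‖1 - z‖ := by
  refine (cav_diff_norm _ h).trans ?_
  have key : ∀ k ∈ Ico (m + 1) (n + 1), ‖z ^ k - cav m (fun k => z ^ k)‖ ≤ (n + 1) * ‖1 - z‖ := by
    intro k hk
    rw [mem_Ico] at hk
    rw [norm_sub_rev, ← cav_sub_const]
    refine (cav_norm_le _ _).trans ?_
    have : ∑ l ∈ range (m + 1), ‖z ^ l - z ^ k‖ ≤ ∑ l ∈ range (m + 1), (n + 1) * ‖1 - z‖ := by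
      refine sum_le_sum fun l hl => ?_
      rw [mem_range] at hl
      rw [norm_sub_rev]
      refine (pow_sub_norm z hz (by omega : l ≤ k)).trans ?_
      gcongr
      have : k ≤ n + 1 := by omega
      exact_mod_cast this
    refine (mul_le_mul_of_nonneg_left this (by positivity)).trans ?_
    rw [sum_const, card_range, nsmul_eq_mul]
    push_cast
    rw [← mul_assoc, inv_mul_cancel₀ (by positivity), one_mul]
  refine (mul_le_mul_of_nonneg_left (sum_le_sum key) (by positivity)).trans ?_
  rw [sum_const, Nat.card_Ico, nsmul_eq_mul]
  have : ((n + 1 - (m + 1) : ℕ) : ℝ) = (n : ℝ) - m := by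
    rw [Nat.add_sub_add_right, Nat.cast_sub h]
  rw [this]
  have h3 : ((n : ℝ) + 1) ≠ 0 := by positivity
  apply le_of_eq
  field_simp

lemma D_big (z : ℂ) (hz : ‖z‖ = 1) (n : ℕ) :
    ‖cav n (fun k => z ^ k)‖ * ‖1 - z‖ ≤ 2 / ((n : ℝ) + 1) := by
  rw [← norm_mul]
  unfold cav
  rw [mul_assoc, geom_sum_mul_neg, norm_mul, norm_inv, norm_ncast, div_eq_inv_mul]
  gcongr
  refine (norm_sub_le _ _).trans ?_
  simp [hz]; norm_num

lemma D_diff2 (z : ℂ) (hz : ‖z‖ = 1) {m n : ℕ} (h : m ≤ n) :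
    ‖cav n (fun k => z ^ k) - cav m (fun k => z ^ k)‖ ≤ 2 * ((n : ℝ) - m) / ((n : ℝ) + 1) := by
  refine (cav_diff_norm _ h).trans ?_
  have key : ∀ k ∈ Ico (m + 1) (n + 1), ‖z ^ k - cav m (fun k => z ^ k)‖ ≤ 2 := by
    intro k hk
    refine (norm_sub_le _ _).trans ?_
    have := D_norm z hz m
    rw [norm_pow, hz, one_pow]; linarith
  refine (mul_le_mul_of_nonneg_left (sum_le_sum key) (by positivity)).trans ?_
  rw [sum_const, Nat.card_Ico, nsmul_eq_mul, Nat.add_sub_add_right, Nat.cast_sub h]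
  apply le_of_eq
  field_simp

lemma D_sq (z : ℂ) (hz : ‖z‖ = 1) {m n : ℕ} (h : m ≤ n) :
    ‖1 - z‖ * ‖cav n (fun k => z ^ k) - cav m (fun k => z ^ k)‖ ^ 2
      ≤ 8 * (((m : ℝ) + 1)⁻¹ - ((n : ℝ) + 1)⁻¹) := by
  have h1 := D_diff2 z hz h
  have h2 : ‖1 - z‖ * ‖cav n (fun k => z ^ k) - cav m (fun k => z ^ k)‖ ≤ 4 / ((m : ℝ) + 1) := by
    have a := D_big z hz n
    have b := D_big z hz m
    have c := norm_sub_le (cav n (fun k => z ^ k)) (cav m (fun k => z ^ k))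
    have d : 2 / ((n : ℝ) + 1) ≤ 2 / ((m : ℝ) + 1) := by gcongr
    have e : 4 / ((m : ℝ) + 1) = 2 / ((m : ℝ) + 1) + 2 / ((m : ℝ) + 1) := by ring
    nlinarith [norm_nonneg (1 - z)]
  rw [pow_two, ← mul_assoc]
  refine (mul_le_mul h2 h1 (norm_nonneg _) (by positivity)).trans ?_
  apply le_of_eq
  have h3 : ((n : ℝ) + 1) ≠ 0 := by positivity
  have h4 : ((m : ℝ) + 1) ≠ 0 := by positivity
  field_simp
  ring

lemma mult_bound (z : ℂ) (hz : ‖z‖ = 1) (N : ℕ) (n : ℕ → ℕ) (hn : Monotone n) :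
    ∑ i ∈ range N, ‖cav (n i) (fun k => z ^ k) - cav (n (i + 1)) (fun k => z ^ k)‖ ^ 2 ≤ 18 := by
  set δ := ‖1 - z‖ with hδ
  set D : ℕ → ℂ := fun m => cav m (fun k => z ^ k) with hD
  change ∑ i ∈ range N, ‖D (n i) - D (n (i + 1))‖ ^ 2 ≤ 18
  rcases eq_or_lt_of_le (norm_nonneg (1 - z)) with h0 | h0
  · have : ∀ i ∈ range N, ‖D (n i) - D (n (i + 1))‖ ^ 2 ≤ 0 := by
      intro i _
      have := D_small z hz (hn (Nat.le_succ i))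
      rw [← h0, mul_zero] at this
      rw [norm_sub_rev]
      change ‖D (n (i+1)) - D (n i)‖ ≤ 0 at this
      have h2 := norm_nonneg (D (n (i+1)) - D (n i))
      have : ‖D (n (i+1)) - D (n i)‖ = 0 := le_antisymm this h2
      rw [this]; norm_num
    have := sum_le_sum this
    simp only [sum_const_zero] at this
    linarith
  · rw [← hδ] at h0
    set q := ⌊δ⁻¹⌋₊ with hq
    have hq1 : (q : ℝ) * δ ≤ 1 := by
      have := Nat.floor_le (inv_nonneg.2 h0.le)
      calc (q : ℝ) * δ ≤ δ⁻¹ * δ := by gcongr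
        _ = 1 := inv_mul_cancel₀ h0.ne'
    have hq2 : 1 ≤ ((q : ℝ) + 1) * δ := by
      have := (Nat.lt_floor_add_one δ⁻¹).le
      calc 1 = δ⁻¹ * δ := (inv_mul_cancel₀ h0.ne').symm
        _ ≤ _ := by gcongr
    have split : ∀ a b : ℕ, a ≤ b → ‖D a - D b‖ ^ 2 ≤
        2 * ‖D (min b q) - D (min a q)‖ ^ 2 + 2 * ‖D (max b q) - D (max a q)‖ ^ 2 := by
      intro a b hab
      have e : D a - D b = -((D (min b q) - D (min a q)) + (D (max b q) - D (max a q))) := by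
        rcases le_total a q with h1 | h1 <;> rcases le_total b q with h2 | h2 <;> simp [h1, h2]
      rw [e, norm_neg]
      have := norm_add_le (D (min b q) - D (min a q)) (D (max b q) - D (max a q))
      nlinarith [norm_nonneg (D (min b q) - D (min a q) + (D (max b q) - D (max a q))),
        sq_nonneg (‖D (min b q) - D (min a q)‖ - ‖D (max b q) - D (max a q)‖)]
    have b1 : ∀ a b : ℕ, a ≤ b → ‖D (min b q) - D (min a q)‖ ^ 2 ≤
        ((min b q : ℕ) : ℝ) * δ - ((min a q : ℕ) : ℝ) * δ := by
      intro a b hab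
      have hm : min a q ≤ min b q := by omega
      have h1 := D_small z hz hm
      have h2 : (((min b q : ℕ) : ℝ) - ((min a q : ℕ) : ℝ)) * δ ≤ 1 := by
        refine le_trans ?_ hq1
        gcongr
        have : ((min b q : ℕ) : ℝ) ≤ q := by exact_mod_cast min_le_right b q
        have : (0 : ℝ) ≤ ((min a q : ℕ) : ℝ) := Nat.cast_nonneg _
        linarith
      change ‖D (min b q) - D (min a q)‖ ≤ _ at h1
      rw [← hδ] at h1
      nlinarith [norm_nonneg (D (min b q) - D (min a q))]
    have b2 : ∀ a b : ℕ, a ≤ b → ‖D (max b q) - D (max a q)‖ ^ 2 ≤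
        8 * δ⁻¹ * ((((max a q : ℕ) : ℝ) + 1)⁻¹) - 8 * δ⁻¹ * (((max b q : ℕ) : ℝ) + 1)⁻¹ := by
      intro a b hab
      have hm : max a q ≤ max b q := by omega
      have h1 := D_sq z hz hm
      rw [← hδ] at h1
      change δ * ‖D (max b q) - D (max a q)‖ ^ 2 ≤ _ at h1
      have : ‖D (max b q) - D (max a q)‖ ^ 2 = δ⁻¹ * (δ * ‖D (max b q) - D (max a q)‖ ^ 2) := by
        rw [← mul_assoc, inv_mul_cancel₀ h0.ne', one_mul]
      rw [this]
      refine (mul_le_mul_of_nonneg_left h1 (inv_nonneg.2 h0.le)).trans (le_of_eq ?_)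
      ring
    have tot : ∀ i ∈ range N, ‖D (n i) - D (n (i + 1))‖ ^ 2 ≤
        2 * (((min (n (i+1)) q : ℕ) : ℝ) * δ - ((min (n i) q : ℕ) : ℝ) * δ) -
        2 * (8 * δ⁻¹ * (((max (n (i+1)) q : ℕ) : ℝ) + 1)⁻¹ -
          8 * δ⁻¹ * ((((max (n i) q : ℕ) : ℝ) + 1)⁻¹)) := by
      intro i _
      have h := hn (Nat.le_succ i)
      have := split _ _ h
      have := b1 _ _ h
      have := b2 _ _ h
      simp only [Nat.succ_eq_add_one] at *
      linarith
    refine (sum_le_sum tot).trans ?_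
    rw [sum_sub_distrib, ← mul_sum, ← mul_sum,
      sum_range_sub (fun i => ((min (n i) q : ℕ) : ℝ) * δ),
      sum_range_sub (fun i => 8 * δ⁻¹ * ((((max (n i) q : ℕ) : ℝ) + 1)⁻¹))]
    have e1 : ((min (n N) q : ℕ) : ℝ) * δ ≤ 1 := by
      refine le_trans ?_ hq1
      gcongr
      exact min_le_right _ _
    have e2 : (0 : ℝ) ≤ ((min (n 0) q : ℕ) : ℝ) * δ := by positivity
    have e3 : 0 ≤ 8 * δ⁻¹ * (((max (n N) q : ℕ) : ℝ) + 1)⁻¹ := by positivity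
    have e4 : 8 * δ⁻¹ * (((max (n 0) q : ℕ) : ℝ) + 1)⁻¹ ≤ 8 := by
      rw [mul_assoc, ← mul_inv]
      have : 1 ≤ δ * (((max (n 0) q : ℕ) : ℝ) + 1) := by
        rw [mul_comm]
        refine hq2.trans ?_
        gcongr
        exact le_max_right _ _
      have := inv_le_one_of_one_le₀ this
      linarith
    linarith

end QME

namespace QME

local instance : Fact ((0:ℝ) < 1) := ⟨one_pos⟩

noncomputable def toL (f : C(AddCircle (1:ℝ), ℂ)) : Lp ℂ 2 (AddCircle.haarAddCircle (T := (1:ℝ))) :=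
  ContinuousMap.toLp (E := ℂ) 2 AddCircle.haarAddCircle ℂ f

lemma toL_norm_sq (f : C(AddCircle (1:ℝ), ℂ)) :
    ‖toL f‖ ^ 2 = ∫ t, ‖f t‖ ^ 2 ∂(AddCircle.haarAddCircle (T := (1:ℝ))) := by
  have h := ContinuousMap.inner_toLp (𝕜 := ℂ) (AddCircle.haarAddCircle (T := (1:ℝ))) f f
  have h2 := inner_self_eq_norm_sq_to_K (𝕜 := ℂ) (toL f)
  unfold toL at *
  rw [h] at h2
  have h3 : ∀ x, f x * (starRingEnd ℂ) (f x) = ((‖f x‖ ^ 2 : ℝ) : ℂ) := by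
    intro x
    rw [Complex.mul_conj, Complex.normSq_eq_norm_sq]
  simp_rw [h3] at h2
  rw [integral_complex_ofReal] at h2
  apply Complex.ofReal_injective
  rw [h2, Complex.ofReal_pow]
  rfl

lemma toL_fourier_inner (j k : ℤ) : inner ℂ (toL (fourier j)) (toL (fourier k)) =
    if j = k then (1 : ℂ) else 0 := by
  have := (orthonormal_iff_ite.1 (orthonormal_fourier (T := (1:ℝ)))) j k
  exact this

/-- Product of the conjugate kernel with the polynomial. -/
noncomputable def W (m R : ℕ) (a : ℕ → ℂ) : C(AddCircle (1:ℝ), ℂ) :=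
  ∑ k ∈ range R, ∑ l ∈ range (m + 1), (((m : ℂ) + 1)⁻¹ * a k) • fourier ((k : ℤ) - l)

noncomputable def P (R : ℕ) (a : ℕ → ℂ) : C(AddCircle (1:ℝ), ℂ) :=
  ∑ k ∈ range R, a k • fourier (k : ℤ)

lemma toL_sum {ι : Type*} (s : Finset ι) (f : ι → C(AddCircle (1:ℝ), ℂ)) :
    toL (∑ i ∈ s, f i) = ∑ i ∈ s, toL (f i) := map_sum _ _ _

lemma toL_smul (c : ℂ) (f : C(AddCircle (1:ℝ), ℂ)) : toL (c • f) = c • toL f := map_smul _ _ _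

lemma toL_sub (f g : C(AddCircle (1:ℝ), ℂ)) : toL (f - g) = toL f - toL g := map_sub _ _ _

lemma W_inner (m R : ℕ) (a : ℕ → ℂ) (ha : ∀ k, R ≤ k → a k = 0) (j : ℕ) :
    inner ℂ (toL (fourier (j : ℤ))) (toL (W m R a)) = av m a j := by
  unfold W av cav
  rw [toL_sum, inner_sum]
  simp_rw [toL_sum, inner_sum, toL_smul, inner_smul_right, toL_fourier_inner]
  rw [sum_comm, mul_sum]
  refine sum_congr rfl fun l _ => ?_
  by_cases h : j + l < R
  · rw [sum_eq_single_of_mem (j + l) (mem_range.2 h)]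
    · simp
    · intro b _ hb
      rw [if_neg]; · simp
      omega
  · rw [ha _ (by omega), mul_zero]
    refine sum_eq_zero fun k hk => ?_
    rw [mem_range] at hk
    rw [if_neg]; · simp
    omega

lemma W_apply (m R : ℕ) (a : ℕ → ℂ) (t : AddCircle (1:ℝ)) :
    W m R a t = cav m (fun k => (fourier (-1) t) ^ k) * P R a t := by
  have hp : ∀ l : ℕ, (fourier (-1) t : ℂ) ^ l = fourier (-(l : ℤ)) t := by
    intro l
    induction l with
    | zero => simp
    | succ l ih =>
      rw [pow_succ, ih, ← fourier_add]; congr 2; push_cast; ring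
  unfold W P cav
  simp only [ContinuousMap.sum_apply, ContinuousMap.smul_apply, smul_eq_mul, hp]
  rw [mul_sum]
  refine sum_congr rfl fun k _ => ?_
  rw [mul_sum, sum_mul]
  refine sum_congr rfl fun l _ => ?_
  rw [sub_eq_add_neg, fourier_add]
  ring

lemma P_norm (R : ℕ) (a : ℕ → ℂ) : ‖toL (P R a)‖ ^ 2 = ∑ k ∈ range R, ‖a k‖ ^ 2 := by
  have h2 := inner_self_eq_norm_sq_to_K (𝕜 := ℂ) (toL (P R a))
  have : inner ℂ (toL (P R a)) (toL (P R a)) = ((∑ k ∈ range R, ‖a k‖ ^ 2 : ℝ) : ℂ) := by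
    conv_lhs => unfold P
    rw [toL_sum, sum_inner]
    simp_rw [inner_sum, toL_smul, inner_smul_right, inner_smul_left, toL_fourier_inner]
    push_cast
    refine sum_congr rfl fun k hk => ?_
    rw [sum_eq_single_of_mem k hk]
    · simp only [if_true, mul_one]
      rw [Complex.mul_conj, Complex.normSq_eq_norm_sq]; push_cast; rfl
    · intro b _ hb
      rw [if_neg]; · simp
      omega
  rw [this] at h2
  apply Complex.ofReal_injective
  rw [h2, Complex.ofReal_pow]
  rfl

lemma L2_bound (N L R : ℕ) (n : ℕ → ℕ) (hn : Monotone n) (a : ℕ → ℂ)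
    (ha : ∀ k, R ≤ k → a k = 0) :
    ∑ j ∈ range L, Sq N n a j ≤ 18 * ∑ k ∈ range R, ‖a k‖ ^ 2 := by
  unfold Sq
  rw [sum_comm]
  have bessel : ∀ i ∈ range N, ∑ j ∈ range L, ‖av (n i) a j - av (n (i + 1)) a j‖ ^ 2 ≤
      ∫ t, ‖W (n i) R a t - W (n (i+1)) R a t‖ ^ 2 ∂(AddCircle.haarAddCircle (T := (1:ℝ))) := by
    intro i _
    have h1 := toL_norm_sq (W (n i) R a - W (n (i+1)) R a)
    simp only [ContinuousMap.sub_apply] at h1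
    rw [← h1]
    have ho : Orthonormal ℂ (fun j : ℕ => toL (fourier (j : ℤ))) := by
      rw [orthonormal_iff_ite]
      intro i j
      rw [toL_fourier_inner]
      simp
    refine le_trans (le_of_eq ?_) (ho.sum_inner_products_le (s := range L) _)
    refine sum_congr rfl fun j _ => ?_
    rw [toL_sub, inner_sub_right, W_inner _ _ _ ha, W_inner _ _ _ ha]
  refine (sum_le_sum bessel).trans ?_
  have hInt : ∀ f : C(AddCircle (1:ℝ), ℝ), Integrable f (AddCircle.haarAddCircle (T := (1:ℝ))) := by
    intro f
    exact f.continuous.integrable_of_hasCompactSupport (HasCompactSupport.of_compactSpace _)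
  have hInt' : ∀ f : AddCircle (1:ℝ) → ℝ, Continuous f →
      Integrable f (AddCircle.haarAddCircle (T := (1:ℝ))) := fun f hf => hInt ⟨f, hf⟩
  rw [← integral_finsetSum]
  · rw [← P_norm, toL_norm_sq, ← integral_const_mul]
    refine integral_mono (hInt' _ ?_) (hInt' _ ?_) ?_
    · fun_prop
    · fun_prop
    · intro t
      simp only
      have : ∀ i ∈ range N, ‖W (n i) R a t - W (n (i+1)) R a t‖ ^ 2 =
        ‖cav (n i) (fun k => (fourier (-1) t : ℂ) ^ k) - cav (n (i+1)) (fun k => (fourier (-1) t : ℂ) ^ k)‖ ^ 2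
          * ‖P R a t‖ ^ 2 := by
        intro i _
        rw [W_apply, W_apply, ← sub_mul, norm_mul, mul_pow]
      rw [sum_congr rfl this, ← sum_mul]
      gcongr
      apply mult_bound _ _ _ _ hn
      rw [fourier_apply]
      exact Circle.norm_coe _
  · intro i _
    apply hInt'
    fun_prop

end QME

namespace QME

lemma cz_exists (f : ℕ → ℝ) (hf : ∀ y, 0 ≤ f y) (lam : ℝ) (hl : 0 < lam) : ∀ k s : ℕ,
    ∑ y ∈ Ico s (s + 2 ^ k), f y ≤ lam * 2 ^ k → ∃ Qs : Finset (ℕ × ℕ),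
      (∀ Q ∈ Qs, s ≤ Q.1 ∧ Q.1 + Q.2 ≤ s + 2 ^ k ∧ 0 < Q.2 ∧
        ∑ y ∈ Ico Q.1 (Q.1 + Q.2), f y ≤ 2 * lam * Q.2) ∧
      (∀ Q ∈ Qs, ∀ Q' ∈ Qs, Q ≠ Q' → Q.1 + Q.2 ≤ Q'.1 ∨ Q'.1 + Q'.2 ≤ Q.1) ∧
      (∀ y ∈ Ico s (s + 2 ^ k), (∀ Q ∈ Qs, y ∉ Ico Q.1 (Q.1 + Q.2)) → f y ≤ lam) ∧
      lam * ∑ Q ∈ Qs, (Q.2 : ℝ) ≤ ∑ y ∈ Ico s (s + 2 ^ k), f y := by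
  classical
  intro k
  induction k with
  | zero =>
    intro s hs
    refine ⟨∅, by simp, by simp, ?_, ?_⟩
    · intro y hy _
      simp only [pow_zero, mem_Ico] at hy
      have : y = s := by omega
      subst this
      simpa using hs
    · simp [hf]
  | succ k ih =>
    have half : ∀ s : ℕ, ∑ y ∈ Ico s (s + 2 ^ k), f y ≤ 2 * lam * 2 ^ k → ∃ Qs : Finset (ℕ × ℕ),
      (∀ Q ∈ Qs, s ≤ Q.1 ∧ Q.1 + Q.2 ≤ s + 2 ^ k ∧ 0 < Q.2 ∧
        ∑ y ∈ Ico Q.1 (Q.1 + Q.2), f y ≤ 2 * lam * Q.2) ∧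
      (∀ Q ∈ Qs, ∀ Q' ∈ Qs, Q ≠ Q' → Q.1 + Q.2 ≤ Q'.1 ∨ Q'.1 + Q'.2 ≤ Q.1) ∧
      (∀ y ∈ Ico s (s + 2 ^ k), (∀ Q ∈ Qs, y ∉ Ico Q.1 (Q.1 + Q.2)) → f y ≤ lam) ∧
      lam * ∑ Q ∈ Qs, (Q.2 : ℝ) ≤ ∑ y ∈ Ico s (s + 2 ^ k), f y := by
      intro s hs
      by_cases h : ∑ y ∈ Ico s (s + 2 ^ k), f y ≤ lam * 2 ^ k
      · exact ih s h
      · refine ⟨{(s, 2 ^ k)}, ?_, ?_, ?_, ?_⟩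
        · intro Q hQ
          rw [mem_singleton] at hQ
          subst hQ
          refine ⟨le_rfl, le_rfl, by positivity, ?_⟩
          push_cast
          exact hs
        · intro Q hQ Q' hQ' hne
          rw [mem_singleton] at hQ hQ'
          exact absurd (hQ.trans hQ'.symm) hne
        · intro y hy h2
          exact absurd hy (h2 _ (mem_singleton_self _))
        · simp only [sum_singleton]
          push_cast
          linarith
    intro s hs
    have e2 : s + 2 ^ (k + 1) = (s + 2 ^ k) + 2 ^ k := by rw [pow_succ]; ring
    rw [e2] at hs ⊢
    have hsplit : ∑ y ∈ Ico s (s + 2 ^ k + 2 ^ k), f y =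
        ∑ y ∈ Ico s (s + 2 ^ k), f y + ∑ y ∈ Ico (s + 2 ^ k) (s + 2 ^ k + 2 ^ k), f y :=
      (sum_Ico_consecutive f (Nat.le_add_right _ _) (Nat.le_add_right _ _)).symm
    have n1 : 0 ≤ ∑ y ∈ Ico s (s + 2 ^ k), f y := sum_nonneg fun y _ => hf y
    have n2 : 0 ≤ ∑ y ∈ Ico (s + 2 ^ k) (s + 2 ^ k + 2 ^ k), f y := sum_nonneg fun y _ => hf y
    have hp : lam * 2 ^ (k + 1) = 2 * lam * 2 ^ k := by ring
    rw [hp, hsplit] at hs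
    obtain ⟨A, a1, a2, a3, a4⟩ := half s (by linarith)
    obtain ⟨B, b1, b2, b3, b4⟩ := half (s + 2 ^ k) (by linarith)
    refine ⟨A ∪ B, ?_, ?_, ?_, ?_⟩
    · intro Q hQ
      rcases mem_union.1 hQ with h | h
      · obtain ⟨h1, h2, h3, h4⟩ := a1 Q h
        exact ⟨h1, by omega, h3, h4⟩
      · obtain ⟨h1, h2, h3, h4⟩ := b1 Q h
        exact ⟨by omega, by omega, h3, h4⟩
    · intro Q hQ Q' hQ' hne
      rcases mem_union.1 hQ with h | h <;> rcases mem_union.1 hQ' with h' | h'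
      · exact a2 Q h Q' h' hne
      · have := (a1 Q h).2.1
        have := (b1 Q' h').1
        omega
      · have := (a1 Q' h').2.1
        have := (b1 Q h).1
        omega
      · exact b2 Q h Q' h' hne
    · intro y hy hQ
      rw [mem_Ico] at hy
      by_cases h : y < s + 2 ^ k
      · exact a3 y (mem_Ico.2 ⟨hy.1, h⟩) fun Q hq => hQ Q (mem_union_left _ hq)
      · exact b3 y (mem_Ico.2 ⟨by omega, hy.2⟩) fun Q hq => hQ Q (mem_union_right _ hq)
    · rw [hsplit]
      have : ∑ Q ∈ A ∪ B, (Q.2 : ℝ) ≤ ∑ Q ∈ A, (Q.2 : ℝ) + ∑ Q ∈ B, (Q.2 : ℝ) := by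
        rw [← sum_union_inter]
        have : 0 ≤ ∑ Q ∈ A ∩ B, (Q.2 : ℝ) := sum_nonneg fun _ _ => Nat.cast_nonneg _
        linarith
      nlinarith

lemma two_disjoint {ι : Type*} [DecidableEq ι] (s : Finset ι) (v w : ι → ℂ)
    (hv : ∀ q ∈ s, ∀ q' ∈ s, v q ≠ 0 → v q' ≠ 0 → q = q')
    (hw : ∀ q ∈ s, ∀ q' ∈ s, w q ≠ 0 → w q' ≠ 0 → q = q') :
    ‖∑ q ∈ s, v q - ∑ q ∈ s, w q‖ ^ 2 ≤ 2 * ∑ q ∈ s, ‖v q - w q‖ ^ 2 := by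
  classical
  set T := s.filter (fun q => v q ≠ 0) ∪ s.filter (fun q => w q ≠ 0) with hT
  have c1 : (s.filter (fun q => v q ≠ 0)).card ≤ 1 := by
    rw [card_le_one]
    intro a ha b hb
    rw [mem_filter] at ha hb
    exact hv a ha.1 b hb.1 ha.2 hb.2
  have c2 : (s.filter (fun q => w q ≠ 0)).card ≤ 1 := by
    rw [card_le_one]
    intro a ha b hb
    rw [mem_filter] at ha hb
    exact hw a ha.1 b hb.1 ha.2 hb.2
  have cT : T.card ≤ 2 := (card_union_le _ _).trans (by omega)
  have hTs : T ⊆ s := union_subset (filter_subset _ _) (filter_subset _ _)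
  have e : ∑ q ∈ s, v q - ∑ q ∈ s, w q = ∑ q ∈ T, (v q - w q) := by
    rw [← sum_sub_distrib]
    symm
    apply sum_subset hTs
    intro q hq hqT
    rw [hT, mem_union, mem_filter, mem_filter] at hqT
    push Not at hqT
    rw [hqT.1 hq, hqT.2 hq, sub_zero]
  rw [e]
  have h1 : ‖∑ q ∈ T, (v q - w q)‖ ≤ ∑ q ∈ T, ‖v q - w q‖ := norm_sum_le _ _
  have h2 : (∑ q ∈ T, ‖v q - w q‖) ^ 2 ≤ T.card * ∑ q ∈ T, ‖v q - w q‖ ^ 2 :=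
    sq_sum_le_card_mul_sum_sq
  have h3 : ∑ q ∈ T, ‖v q - w q‖ ^ 2 ≤ ∑ q ∈ s, ‖v q - w q‖ ^ 2 :=
    sum_le_sum_of_subset_of_nonneg hTs fun _ _ _ => by positivity
  have h4 : (T.card : ℝ) ≤ 2 := by exact_mod_cast cT
  have h5 : 0 ≤ ∑ q ∈ T, ‖v q - w q‖ ^ 2 := sum_nonneg fun _ _ => by positivity
  calc ‖∑ q ∈ T, (v q - w q)‖ ^ 2 ≤ (∑ q ∈ T, ‖v q - w q‖) ^ 2 := by gcongr
    _ ≤ T.card * ∑ q ∈ T, ‖v q - w q‖ ^ 2 := h2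
    _ ≤ 2 * ∑ q ∈ s, ‖v q - w q‖ ^ 2 := by nlinarith

lemma window_sum {M : Type*} [AddCommMonoid M] (b : ℕ → M) (x m : ℕ) :
    ∑ k ∈ range m, b (x + k) = ∑ y ∈ Ico x (x + m), b y := by
  rw [sum_Ico_eq_sum_range]; simp

lemma window_le (b : ℕ → ℂ) (t l : ℕ) (hb : ∀ y, y ∉ Ico t (t + l) → b y = 0) (x m : ℕ) :
    ∑ k ∈ range m, ‖b (x + k)‖ ≤ ∑ y ∈ Ico t (t + l), ‖b y‖ := by
  classical
  rw [window_sum (fun y => ‖b y‖)]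
  calc ∑ y ∈ Ico x (x + m), ‖b y‖ = ∑ y ∈ (Ico x (x + m)).filter (fun y => y ∈ Ico t (t + l)), ‖b y‖ := by
        rw [sum_filter]
        refine sum_congr rfl fun y _ => ?_
        split_ifs with h
        · rfl
        · rw [hb y h, norm_zero]
    _ ≤ _ := sum_le_sum_of_subset_of_nonneg
        (fun y hy => (mem_filter.1 hy).2) (fun _ _ _ => norm_nonneg _)

lemma atom_zero (b : ℕ → ℂ) (t l : ℕ) (hb : ∀ y, y ∉ Ico t (t + l) → b y = 0)
    (h0 : ∑ y ∈ Ico t (t + l), b y = 0) (x m : ℕ) (hx : x ∉ Ico t (t + l))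
    (h : x + m ∉ Ico t (t + l)) : av m b x = 0 := by
  unfold av cav
  rw [window_sum]
  suffices ∑ y ∈ Ico x (x + (m + 1)), b y = 0 by rw [this, mul_zero]
  rw [mem_Ico] at hx h
  by_cases h1 : x < t ∧ t + l ≤ x + m
  · rw [← h0]
    symm
    apply sum_subset
    · apply Ico_subset_Ico <;> omega
    · intro y _ hy; exact hb y hy
  · apply sum_eq_zero
    intro y hy
    apply hb
    rw [mem_Ico] at hy ⊢
    omega

lemma atom_var (b : ℕ → ℂ) (t l : ℕ) (hb : ∀ y, y ∉ Ico t (t + l) → b y = 0)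
    (x : ℕ) (hx : x < t) (N : ℕ) (n : ℕ → ℕ) (hn : Monotone n) :
    ∑ i ∈ range N, ‖av (n i) b x - av (n (i + 1)) b x‖ ≤
      2 * (∑ y ∈ Ico t (t + l), ‖b y‖) / ((t : ℝ) - x) := by
  obtain ⟨d, rfl⟩ := Nat.exists_eq_add_of_lt hx
  set e : ℕ := d + 1 with he
  have hte : x + d + 1 = x + e := by omega
  rw [hte] at *
  have hcast : (((x + e : ℕ) : ℝ) - x) = e := by push_cast; ring
  rw [hcast]
  have he0 : (0 : ℝ) < e := by exact_mod_cast Nat.succ_pos d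
  set B := ∑ y ∈ Ico (x + e) (x + e + l), ‖b y‖ with hB
  have hB0 : 0 ≤ B := sum_nonneg fun _ _ => norm_nonneg _
  set c : ℕ → ℂ := fun k => b (x + k) with hc
  have hc0 : ∀ k, k < e → c k = 0 := fun k hk => hb _ (by rw [mem_Ico]; omega)
  set Bp : ℕ → ℝ := fun m => ∑ k ∈ range m, ‖c k‖ with hBp
  have hBpB : ∀ m, Bp m ≤ B := fun m => window_le b _ _ hb x m
  have hu0 : ∀ m, m < e → cav m c = 0 := by
    intro m hm
    unfold cav
    rw [sum_eq_zero, mul_zero]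
    intro k hk
    rw [mem_range] at hk
    exact hc0 k (by omega)
  have step : ∀ m k : ℕ, m ≤ k → ‖cav m c - cav k c‖ ≤
      (Bp (k + 1) / e - B * ((max (k + 1) e : ℕ) : ℝ)⁻¹)
        - (Bp (m + 1) / e - B * ((max (m + 1) e : ℕ) : ℝ)⁻¹) := by
    intro m k hmk
    have hmono : Bp (m + 1) ≤ Bp (k + 1) := by
      apply sum_le_sum_of_subset_of_nonneg
      · exact range_subset_range.2 (by omega)
      · intros; positivity
    have hinv : ((max (k + 1) e : ℕ) : ℝ)⁻¹ ≤ ((max (m + 1) e : ℕ) : ℝ)⁻¹ := by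
      apply inv_anti₀
      · exact_mod_cast (by omega : 0 < max (m + 1) e)
      · exact_mod_cast (by omega : max (m + 1) e ≤ max (k + 1) e)
    have hA : 0 ≤ (Bp (k + 1) - Bp (m + 1)) / e := div_nonneg (by linarith) he0.le
    have hA2 : 0 ≤ B * (((max (m + 1) e : ℕ) : ℝ)⁻¹ - ((max (k + 1) e : ℕ) : ℝ)⁻¹) :=
      mul_nonneg hB0 (by linarith)
    have hR : (Bp (k + 1) / e - B * ((max (k + 1) e : ℕ) : ℝ)⁻¹)
        - (Bp (m + 1) / e - B * ((max (m + 1) e : ℕ) : ℝ)⁻¹) = (Bp (k + 1) - Bp (m + 1)) / e +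
        B * (((max (m + 1) e : ℕ) : ℝ)⁻¹ - ((max (k + 1) e : ℕ) : ℝ)⁻¹) := by ring
    rw [hR]
    by_cases hk : k < e
    · rw [hu0 m (by omega), hu0 k hk, sub_zero, norm_zero]
      linarith
    · push Not at hk
      rw [norm_sub_rev]
      refine (cav_diff_norm c hmk).trans ?_
      have h1 : ∑ j ∈ Ico (m + 1) (k + 1), ‖c j - cav m c‖ ≤
          (Bp (k + 1) - Bp (m + 1)) + ((k : ℝ) - m) * ‖cav m c‖ := by
        calc _ ≤ ∑ j ∈ Ico (m + 1) (k + 1), (‖c j‖ + ‖cav m c‖) :=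
              sum_le_sum fun j _ => norm_sub_le _ _
          _ = _ := by
              rw [sum_add_distrib, sum_const, Nat.card_Ico, nsmul_eq_mul,
                Nat.add_sub_add_right, Nat.cast_sub hmk,
                sum_Ico_eq_sub _ (by omega : m + 1 ≤ k + 1)]
      refine (mul_le_mul_of_nonneg_left h1 (by positivity)).trans ?_
      rw [mul_add]
      apply add_le_add
      · rw [div_eq_inv_mul]
        apply mul_le_mul_of_nonneg_right _ (by linarith)
        apply inv_anti₀ he0
        have : e ≤ k + 1 := by omega
        exact_mod_cast this
      · by_cases hm : m < e
        · rw [hu0 m hm, norm_zero, mul_zero, mul_zero]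
          exact hA2
        · push Not at hm
          have m1 : max (m + 1) e = m + 1 := by omega
          have m2 : max (k + 1) e = k + 1 := by omega
          rw [m1, m2]
          have h2 : ‖cav m c‖ ≤ ((m : ℝ) + 1)⁻¹ * B := by
            refine (cav_norm_le c m).trans ?_
            gcongr
            exact hBpB (m + 1)
          have hkm : (0 : ℝ) ≤ (k : ℝ) - m := by
            have : (m : ℝ) ≤ k := by exact_mod_cast hmk
            linarith
          calc ((k : ℝ) + 1)⁻¹ * (((k : ℝ) - m) * ‖cav m c‖)
              ≤ ((k : ℝ) + 1)⁻¹ * (((k : ℝ) - m) * (((m : ℝ) + 1)⁻¹ * B)) := by gcongr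
            _ = _ := by
              push_cast
              have h3 : ((k : ℝ) + 1) ≠ 0 := by positivity
              have h4 : ((m : ℝ) + 1) ≠ 0 := by positivity
              field_simp
              ring
  have tot : ∑ i ∈ range N, ‖av (n i) b x - av (n (i + 1)) b x‖ ≤ _ :=
    sum_le_sum fun i _ => step (n i) (n (i + 1)) (hn (Nat.le_succ i))
  refine tot.trans ?_
  rw [sum_range_sub (fun i => Bp (n i + 1) / e - B * ((max (n i + 1) e : ℕ) : ℝ)⁻¹)]
  have i1 : Bp (n N + 1) / e ≤ B / e := by gcongr; exact hBpB _
  have i2 : 0 ≤ Bp (n 0 + 1) / e := div_nonneg (sum_nonneg fun _ _ => norm_nonneg _) he0.le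
  have i3 : 0 ≤ B * ((max (n N + 1) e : ℕ) : ℝ)⁻¹ := by positivity
  have i4 : B * ((max (n 0 + 1) e : ℕ) : ℝ)⁻¹ ≤ B / e := by
    rw [div_eq_mul_inv]
    gcongr
    exact le_max_right _ _
  have : 2 * B / e = B / e + B / e := by ring
  linarith

lemma inv_sq_sum (t l : ℕ) (hl : 0 < l) (L : ℕ) :
    ∑ x ∈ (range L).filter (fun x => x + l < t), (((t : ℝ) - x) ^ 2)⁻¹ ≤ (l : ℝ)⁻¹ := by
  by_cases hlt : l ≤ t
  · calc _ ≤ ∑ x ∈ range (t - l), (((t : ℝ) - x) ^ 2)⁻¹ := by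
          apply sum_le_sum_of_subset_of_nonneg
          · intro x hx
            rw [mem_filter] at hx
            rw [mem_range]; omega
          · intros; positivity
      _ ≤ ∑ x ∈ range (t - l), (((t : ℝ) - ((x + 1 : ℕ) : ℝ))⁻¹ - ((t : ℝ) - x)⁻¹) := by
          refine sum_le_sum fun x hx => ?_
          rw [mem_range] at hx
          have h1 : (x : ℝ) + 1 + 1 ≤ t := by
            have : x + 1 + 1 ≤ t := by omega
            exact_mod_cast this
          push_cast
          set s : ℝ := (t : ℝ) - x - 1 with hs
          have e1 : (t : ℝ) - (x + 1) = s := by rw [hs]; ring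
          have e2 : (t : ℝ) - x = s + 1 := by rw [hs]; ring
          rw [e1, e2]
          have hs0 : 0 < s := by rw [hs]; linarith
          rw [inv_sub_inv hs0.ne' (by positivity), inv_eq_one_div]
          rw [div_le_div_iff₀ (by positivity) (by positivity)]
          nlinarith
      _ ≤ _ := by
          rw [sum_range_sub (fun x => ((t : ℝ) - (x : ℝ))⁻¹)]
          rw [Nat.cast_sub hlt]
          have : (0 : ℝ) ≤ ((t : ℝ) - ((0 : ℕ) : ℝ))⁻¹ := by simp
          have e : (t : ℝ) - ((t : ℝ) - l) = l := by ring
          rw [e]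
          linarith
  · rw [filter_eq_empty_iff.2, sum_empty]
    · positivity
    · intro x _; omega

end QME

namespace QME

lemma av_add (m : ℕ) (a b : ℕ → ℂ) (j : ℕ) : av m (fun k => a k + b k) j = av m a j + av m b j := by
  unfold av cav
  rw [sum_add_distrib, mul_add]

lemma av_sum {ι : Type*} (s : Finset ι) (m : ℕ) (b : ι → ℕ → ℂ) (j : ℕ) :
    av m (fun k => ∑ q ∈ s, b q k) j = ∑ q ∈ s, av m (b q) j := by
  unfold av cav
  rw [sum_comm, mul_sum]

lemma Sq_nonneg (N n a j) : 0 ≤ Sq N n a j := sum_nonneg fun _ _ => by positivity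

lemma Sq_add3 (N : ℕ) (n : ℕ → ℕ) (a b c : ℕ → ℂ) (j : ℕ) :
    Sq N n (fun k => a k + b k + c k) j ≤ 3 * (Sq N n a j + Sq N n b j + Sq N n c j) := by
  unfold Sq
  rw [← sum_add_distrib, ← sum_add_distrib, mul_sum]
  refine sum_le_sum fun i _ => ?_
  rw [av_add (n i) (fun k => a k + b k), av_add (n (i+1)) (fun k => a k + b k),
    av_add (n i) a, av_add (n (i+1)) a]
  set u := av (n i) a j - av (n (i+1)) a j
  set v := av (n i) b j - av (n (i+1)) b j
  set w := av (n i) c j - av (n (i+1)) c j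
  have e : av (n i) a j + av (n i) b j + av (n i) c j -
    (av (n (i+1)) a j + av (n (i+1)) b j + av (n (i+1)) c j) = u + v + w := by ring
  rw [e]
  have h := norm_add₃_le (a := u) (b := v) (c := w)
  have h2 : ‖u + v + w‖ ^ 2 ≤ (‖u‖ + ‖v‖ + ‖w‖) ^ 2 := by gcongr
  nlinarith [sq_nonneg (‖u‖ - ‖v‖), sq_nonneg (‖u‖ - ‖w‖), sq_nonneg (‖v‖ - ‖w‖)]

lemma bad_sum (N L : ℕ) (n : ℕ → ℕ) (hn : Monotone n) (Qs : Finset (ℕ × ℕ)) (lam : ℝ)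
    (hpos : ∀ Q ∈ Qs, 0 < Q.2)
    (hdis : ∀ Q ∈ Qs, ∀ Q' ∈ Qs, Q ≠ Q' → Q.1 + Q.2 ≤ Q'.1 ∨ Q'.1 + Q'.2 ≤ Q.1)
    (b : ℕ × ℕ → ℕ → ℂ) (hb : ∀ Q ∈ Qs, ∀ y, y ∉ Ico Q.1 (Q.1 + Q.2) → b Q y = 0)
    (h0 : ∀ Q ∈ Qs, ∑ y ∈ Ico Q.1 (Q.1 + Q.2), b Q y = 0)
    (hsz : ∀ Q ∈ Qs, ∑ y ∈ Ico Q.1 (Q.1 + Q.2), ‖b Q y‖ ≤ 4 * lam * Q.2) :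
    ∑ j ∈ range L, min (Sq N n (fun k => ∑ Q ∈ Qs, b Q k) j) (lam ^ 2) ≤
      130 * lam ^ 2 * ∑ Q ∈ Qs, (Q.2 : ℝ) := by
  classical
  set E := Qs.biUnion (fun Q => Ico (Q.1 - Q.2) (Q.1 + Q.2)) with hE
  have hEcard : (E.card : ℝ) ≤ 2 * ∑ Q ∈ Qs, (Q.2 : ℝ) := by
    have h1 : E.card ≤ ∑ Q ∈ Qs, (Ico (Q.1 - Q.2) (Q.1 + Q.2)).card := card_biUnion_le
    have h2 : ∑ Q ∈ Qs, (Ico (Q.1 - Q.2) (Q.1 + Q.2)).card ≤ ∑ Q ∈ Qs, 2 * Q.2 := by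
      refine sum_le_sum fun Q _ => ?_
      rw [Nat.card_Ico]; omega
    have h3 := h1.trans h2
    rw [← mul_sum] at h3
    exact_mod_cast h3
  rw [← sum_filter_add_sum_filter_not (range L) (fun j => j ∈ E)]
  have part1 : ∑ j ∈ (range L).filter (fun j => j ∈ E),
      min (Sq N n (fun k => ∑ Q ∈ Qs, b Q k) j) (lam ^ 2) ≤ 2 * lam ^ 2 * ∑ Q ∈ Qs, (Q.2 : ℝ) := by
    calc _ ≤ ∑ j ∈ (range L).filter (fun j => j ∈ E), lam ^ 2 :=
          sum_le_sum fun _ _ => min_le_right _ _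
      _ = ((range L).filter (fun j => j ∈ E)).card * lam ^ 2 := by rw [sum_const, nsmul_eq_mul]
      _ ≤ E.card * lam ^ 2 := by
          gcongr
          intro x hx
          exact (mem_filter.1 hx).2
      _ ≤ (2 * ∑ Q ∈ Qs, (Q.2 : ℝ)) * lam ^ 2 := by gcongr
      _ = _ := by ring
  have ptw : ∀ x, x ∉ E → Sq N n (fun k => ∑ Q ∈ Qs, b Q k) x ≤
      ∑ Q ∈ Qs, if x + Q.2 < Q.1 then
        128 * lam ^ 2 * (Q.2 : ℝ) ^ 2 * (((Q.1 : ℝ) - x) ^ 2)⁻¹ else 0 := by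
    intro x hx
    have hxQ : ∀ Q ∈ Qs, x + Q.2 < Q.1 ∨ Q.1 + Q.2 ≤ x := by
      intro Q hQ
      have : x ∉ Ico (Q.1 - Q.2) (Q.1 + Q.2) := fun h => hx (mem_biUnion.2 ⟨Q, hQ, h⟩)
      rw [mem_Ico] at this
      omega
    have hxQ2 : ∀ Q ∈ Qs, x ∉ Ico Q.1 (Q.1 + Q.2) := by
      intro Q hQ
      have := hxQ Q hQ
      have := hpos Q hQ
      rw [mem_Ico]; omega
    have huniq : ∀ m, ∀ Q ∈ Qs, ∀ Q' ∈ Qs, av m (b Q) x ≠ 0 → av m (b Q') x ≠ 0 → Q = Q' := by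
      intro m Q hQ Q' hQ' h h'
      by_contra hne
      have z1 : x + m ∈ Ico Q.1 (Q.1 + Q.2) := by
        by_contra hh
        exact h (atom_zero (b Q) _ _ (hb Q hQ) (h0 Q hQ) x m (hxQ2 Q hQ) hh)
      have z2 : x + m ∈ Ico Q'.1 (Q'.1 + Q'.2) := by
        by_contra hh
        exact h' (atom_zero (b Q') _ _ (hb Q' hQ') (h0 Q' hQ') x m (hxQ2 Q' hQ') hh)
      rw [mem_Ico] at z1 z2
      have := hdis Q hQ Q' hQ' hne
      omega
    have s1 : Sq N n (fun k => ∑ Q ∈ Qs, b Q k) x ≤ ∑ Q ∈ Qs, 2 * Sq N n (b Q) x := by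
      unfold Sq
      simp_rw [mul_sum]
      rw [sum_comm]
      refine sum_le_sum fun i _ => ?_
      rw [av_sum, av_sum, ← mul_sum]
      exact two_disjoint Qs _ _ (huniq (n i)) (huniq (n (i + 1)))
    refine s1.trans (sum_le_sum fun Q hQ => ?_)
    have hlam : 0 ≤ 4 * lam * Q.2 := le_trans (sum_nonneg fun _ _ => norm_nonneg _) (hsz Q hQ)
    split_ifs with hlt
    · have hxt : x < Q.1 := by omega
      have hd : (0 : ℝ) < (Q.1 : ℝ) - x := by
        have : (x : ℝ) < Q.1 := by exact_mod_cast hxt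
        linarith
      have v1 := atom_var (b Q) Q.1 Q.2 (hb Q hQ) x hxt N n hn
      have v2 : Sq N n (b Q) x ≤
          (∑ i ∈ range N, ‖av (n i) (b Q) x - av (n (i + 1)) (b Q) x‖) ^ 2 :=
        sum_sq_le_sq_sum_of_nonneg (fun _ _ => norm_nonneg _)
      have v3 : ∑ i ∈ range N, ‖av (n i) (b Q) x - av (n (i + 1)) (b Q) x‖ ≤
          2 * (4 * lam * Q.2) / ((Q.1 : ℝ) - x) := by
        refine v1.trans ?_
        gcongr
        exact hsz Q hQ
      have v4 : (∑ i ∈ range N, ‖av (n i) (b Q) x - av (n (i + 1)) (b Q) x‖) ^ 2 ≤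
          (2 * (4 * lam * Q.2) / ((Q.1 : ℝ) - x)) ^ 2 := by
        gcongr
      calc 2 * Sq N n (b Q) x ≤ 2 * (2 * (4 * lam * Q.2) / ((Q.1 : ℝ) - x)) ^ 2 := by linarith
        _ = _ := by rw [div_pow]; ring
    · have hge : Q.1 + Q.2 ≤ x := by
        have := hxQ Q hQ; omega
      have : Sq N n (b Q) x = 0 := by
        unfold Sq
        refine sum_eq_zero fun i _ => ?_
        rw [atom_zero (b Q) _ _ (hb Q hQ) (h0 Q hQ) x _ (hxQ2 Q hQ) (by rw [mem_Ico]; omega),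
          atom_zero (b Q) _ _ (hb Q hQ) (h0 Q hQ) x _ (hxQ2 Q hQ) (by rw [mem_Ico]; omega)]
        simp
      rw [this, mul_zero]
  have part2 : ∑ j ∈ (range L).filter (fun j => j ∉ E),
      min (Sq N n (fun k => ∑ Q ∈ Qs, b Q k) j) (lam ^ 2) ≤ 128 * lam ^ 2 * ∑ Q ∈ Qs, (Q.2 : ℝ) := by
    calc _ ≤ ∑ j ∈ (range L).filter (fun j => j ∉ E), ∑ Q ∈ Qs, (if j + Q.2 < Q.1 then
        128 * lam ^ 2 * (Q.2 : ℝ) ^ 2 * (((Q.1 : ℝ) - j) ^ 2)⁻¹ else 0) :=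
          sum_le_sum fun j hj => (min_le_left _ _).trans (ptw j (mem_filter.1 hj).2)
      _ ≤ ∑ j ∈ range L, ∑ Q ∈ Qs, (if j + Q.2 < Q.1 then
        128 * lam ^ 2 * (Q.2 : ℝ) ^ 2 * (((Q.1 : ℝ) - j) ^ 2)⁻¹ else 0) := by
          apply sum_le_sum_of_subset_of_nonneg (filter_subset _ _)
          intro j _ _
          refine sum_nonneg fun Q _ => ?_
          split_ifs
          · positivity
          · exact le_rfl
      _ = ∑ Q ∈ Qs, 128 * lam ^ 2 * (Q.2 : ℝ) ^ 2 *
          ∑ j ∈ (range L).filter (fun j => j + Q.2 < Q.1), (((Q.1 : ℝ) - j) ^ 2)⁻¹ := by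
          rw [sum_comm]
          refine sum_congr rfl fun Q _ => ?_
          rw [← sum_filter, mul_sum]
      _ ≤ ∑ Q ∈ Qs, 128 * lam ^ 2 * (Q.2 : ℝ) ^ 2 * (Q.2 : ℝ)⁻¹ := by
          refine sum_le_sum fun Q hQ => ?_
          apply mul_le_mul_of_nonneg_left _ (by positivity)
          exact inv_sq_sum Q.1 Q.2 (hpos Q hQ) L
      _ = _ := by
          rw [mul_sum]
          refine sum_congr rfl fun Q hQ => ?_
          have : (Q.2 : ℝ) ≠ 0 := by exact_mod_cast (hpos Q hQ).ne'
          field_simp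
  linarith

lemma K_bound (N L R : ℕ) (n : ℕ → ℕ) (hn : Monotone n) (a : ℕ → ℂ)
    (ha : ∀ k, R ≤ k → a k = 0) (lam : ℝ) (hl : 0 < lam) :
    ∑ j ∈ range L, min (Sq N n a j) (lam ^ 2) ≤
      660 * ∑ k ∈ range R, ‖a k‖ * min ‖a k‖ lam := by
  classical
  set a1 : ℕ → ℂ := fun k => if ‖a k‖ ≤ lam then a k else 0 with ha1
  set f : ℕ → ℂ := fun k => if ‖a k‖ ≤ lam then 0 else a k with hf
  have hfR : ∀ k, R ≤ k → f k = 0 := by intro k hk; simp [hf, ha k hk]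
  have ha1R : ∀ k, R ≤ k → a1 k = 0 := by intro k hk; simp [ha1, ha k hk]
  set F := ∑ k ∈ range R, ‖f k‖ with hF
  have hF0 : 0 ≤ F := sum_nonneg fun _ _ => norm_nonneg _
  obtain ⟨k0, hk0R, hk0F⟩ : ∃ k0 : ℕ, R ≤ 2 ^ k0 ∧ F ≤ lam * 2 ^ k0 := by
    obtain ⟨k1, h1⟩ := pow_unbounded_of_one_lt (F / lam) (by norm_num : (1 : ℝ) < 2)
    refine ⟨max R k1, ?_, ?_⟩
    · exact (Nat.lt_two_pow_self (n := R)).le.trans (Nat.pow_le_pow_right (by norm_num) (le_max_left _ _))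
    · rw [div_lt_iff₀ hl] at h1
      have : (2 : ℝ) ^ k1 ≤ 2 ^ (max R k1) := pow_le_pow_right₀ (by norm_num) (le_max_right _ _)
      nlinarith
  have hsumF : ∑ y ∈ Ico 0 (0 + 2 ^ k0), ‖f y‖ = F := by
    rw [zero_add, Nat.Ico_zero_eq_range, hF]
    symm
    apply sum_subset (range_subset_range.2 hk0R)
    intro y _ hy
    rw [hfR y (by simpa using hy), norm_zero]
  obtain ⟨Qs, q1, q2, q3, q4⟩ := cz_exists (fun y => ‖f y‖) (fun y => norm_nonneg _) lam hl k0 0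
    (by rw [hsumF]; exact hk0F)
  rw [hsumF] at q4
  set mean : ℕ × ℕ → ℂ := fun Q => (Q.2 : ℂ)⁻¹ * ∑ y ∈ Ico Q.1 (Q.1 + Q.2), f y with hmean
  set b : ℕ × ℕ → ℕ → ℂ := fun Q y => if y ∈ Ico Q.1 (Q.1 + Q.2) then f y - mean Q else 0 with hb
  have hmeanle : ∀ Q ∈ Qs, ‖mean Q‖ ≤ 2 * lam := by
    intro Q hQ
    obtain ⟨_, _, h3, h4⟩ := q1 Q hQ
    rw [hmean]
    simp only
    rw [norm_mul, norm_inv, Complex.norm_natCast]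
    have h5 : (0 : ℝ) < Q.2 := by exact_mod_cast h3
    rw [inv_mul_le_iff₀ h5]
    refine (norm_sum_le _ _).trans ?_
    linarith
  have hbs : ∀ Q ∈ Qs, ∀ y, y ∉ Ico Q.1 (Q.1 + Q.2) → b Q y = 0 := by
    intro Q _ y hy; simp only [hb]; rw [if_neg hy]
  have hb0 : ∀ Q ∈ Qs, ∑ y ∈ Ico Q.1 (Q.1 + Q.2), b Q y = 0 := by
    intro Q hQ
    have : ∑ y ∈ Ico Q.1 (Q.1 + Q.2), b Q y = ∑ y ∈ Ico Q.1 (Q.1 + Q.2), (f y - mean Q) :=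
      sum_congr rfl fun y hy => by simp only [hb]; rw [if_pos hy]
    rw [this, sum_sub_distrib, sum_const, Nat.card_Ico, nsmul_eq_mul, Nat.add_sub_cancel_left, hmean]
    simp only
    have h5 : (Q.2 : ℂ) ≠ 0 := by exact_mod_cast (q1 Q hQ).2.2.1.ne'
    rw [← mul_assoc, mul_inv_cancel₀ h5, one_mul, sub_self]
  have hbsz : ∀ Q ∈ Qs, ∑ y ∈ Ico Q.1 (Q.1 + Q.2), ‖b Q y‖ ≤ 4 * lam * Q.2 := by
    intro Q hQ
    obtain ⟨_, _, h3, h4⟩ := q1 Q hQ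
    calc ∑ y ∈ Ico Q.1 (Q.1 + Q.2), ‖b Q y‖ ≤ ∑ y ∈ Ico Q.1 (Q.1 + Q.2), (‖f y‖ + 2 * lam) := by
          refine sum_le_sum fun y hy => ?_
          simp only [hb]; rw [if_pos hy]
          exact (norm_sub_le _ _).trans (add_le_add le_rfl (hmeanle Q hQ))
      _ ≤ _ := by
          rw [sum_add_distrib, sum_const, Nat.card_Ico, nsmul_eq_mul, Nat.add_sub_cancel_left]
          linarith
  set B : ℕ → ℂ := fun k => ∑ Q ∈ Qs, b Q k with hB
  set g : ℕ → ℂ := fun k => f k - B k with hg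
  set ell := ∑ Q ∈ Qs, (Q.2 : ℝ) with hell
  have hbad := bad_sum N L n hn Qs lam (fun Q hQ => (q1 Q hQ).2.2.1) q2 b hbs hb0 hbsz
  have hgR : ∀ k, 2 ^ k0 ≤ k → g k = 0 := by
    intro k hk
    simp only [hg, hB]
    rw [hfR k (hk0R.trans hk), sum_eq_zero, sub_zero]
    intro Q hQ
    apply hbs Q hQ
    have := (q1 Q hQ).2.1
    rw [mem_Ico]; omega
  have hgsq : ∑ k ∈ range (2 ^ k0), ‖g k‖ ^ 2 ≤ 5 * lam * F := by
    have pt : ∀ k ∈ range (2 ^ k0), ‖g k‖ ^ 2 ≤ lam * ‖f k‖ +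
        ∑ Q ∈ Qs, (if k ∈ Ico Q.1 (Q.1 + Q.2) then 4 * lam ^ 2 else 0) := by
      intro k hk
      have hn0 : ∀ Q ∈ Qs, (0 : ℝ) ≤ (if k ∈ Ico Q.1 (Q.1 + Q.2) then 4 * lam ^ 2 else 0) := by
        intro Q _
        split_ifs
        · positivity
        · exact le_rfl
      by_cases h : ∃ Q ∈ Qs, k ∈ Ico Q.1 (Q.1 + Q.2)
      · obtain ⟨Q, hQ, hkQ⟩ := h
        have hBk : B k = f k - mean Q := by
          simp only [hB]
          rw [sum_eq_single_of_mem Q hQ]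
          · simp only [hb]; rw [if_pos hkQ]
          · intro Q' hQ' hne
            apply hbs Q' hQ'
            have := q2 Q' hQ' Q hQ hne
            rw [mem_Ico] at hkQ ⊢
            omega
        have hgk : g k = mean Q := by simp only [hg]; rw [hBk]; ring
        have h1 : ‖g k‖ ^ 2 ≤ 4 * lam ^ 2 := by
          rw [hgk]
          have := hmeanle Q hQ
          nlinarith [norm_nonneg (mean Q)]
        have h2 := single_le_sum hn0 hQ
        rw [if_pos hkQ] at h2
        have : 0 ≤ lam * ‖f k‖ := by positivity
        linarith
      · push Not at h
        have hBk : B k = 0 := sum_eq_zero fun Q hQ => hbs Q hQ k (h Q hQ)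
        have hgk : g k = f k := by simp only [hg]; rw [hBk]; ring
        have h1 := q3 k (by simpa using hk) h
        have h2 := sum_nonneg hn0
        rw [hgk]
        nlinarith [norm_nonneg (f k)]
    refine (sum_le_sum pt).trans ?_
    rw [sum_add_distrib, ← mul_sum, sum_comm]
    have e1 : ∑ k ∈ range (2 ^ k0), ‖f k‖ = F := by
      rw [← hsumF]; simp
    rw [e1]
    have e2 : ∑ Q ∈ Qs, ∑ k ∈ range (2 ^ k0), (if k ∈ Ico Q.1 (Q.1 + Q.2) then 4 * lam ^ 2 else 0)
        ≤ ∑ Q ∈ Qs, 4 * lam ^ 2 * (Q.2 : ℝ) := by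
      refine sum_le_sum fun Q hQ => ?_
      rw [← sum_filter, sum_const, nsmul_eq_mul, mul_comm]
      gcongr
      calc _ ≤ (Ico Q.1 (Q.1 + Q.2)).card := card_le_card fun y hy => (mem_filter.1 hy).2
        _ = Q.2 := by rw [Nat.card_Ico]; omega
    rw [← mul_sum] at e2
    nlinarith
  have hdec : a = fun k => a1 k + g k + B k := by
    funext k
    simp only [hg, ha1, hf]
    split_ifs <;> ring
  have l2a := L2_bound N L R n hn a1 ha1R
  have l2g := L2_bound N L (2 ^ k0) n hn g hgR
  have hmain : ∑ j ∈ range L, min (Sq N n a j) (lam ^ 2) ≤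
      3 * (∑ j ∈ range L, Sq N n a1 j) + 3 * (∑ j ∈ range L, Sq N n g j) +
      3 * ∑ j ∈ range L, min (Sq N n B j) (lam ^ 2) := by
    rw [mul_sum, mul_sum, mul_sum, ← sum_add_distrib, ← sum_add_distrib]
    refine sum_le_sum fun j _ => ?_
    have h1 : Sq N n a j ≤ 3 * (Sq N n a1 j + Sq N n g j + Sq N n B j) := by
      conv_lhs => rw [hdec]
      exact Sq_add3 N n a1 g B j
    have h2 := Sq_nonneg N n a1 j
    have h3 := Sq_nonneg N n g j
    rcases le_total (Sq N n B j) (lam ^ 2) with h | h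
    · rw [min_eq_left h]
      exact (min_le_left _ _).trans (by linarith)
    · rw [min_eq_right h]
      refine (min_le_right _ _).trans ?_
      nlinarith [sq_nonneg lam]
  have hfin : ∑ k ∈ range R, ‖a k‖ * min ‖a k‖ lam = ∑ k ∈ range R, ‖a1 k‖ ^ 2 + lam * F := by
    rw [hF, mul_sum, ← sum_add_distrib]
    refine sum_congr rfl fun k _ => ?_
    simp only [ha1, hf]
    split_ifs with h
    · rw [min_eq_left h]; simp; ring
    · push Not at h
      rw [min_eq_right h.le]; simp; ring
  rw [hfin]
  have hA : 0 ≤ ∑ k ∈ range R, ‖a1 k‖ ^ 2 := sum_nonneg fun _ _ => by positivity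
  have hq : lam ^ 2 * ell ≤ lam * F := by nlinarith
  nlinarith

end QME

namespace QME

lemma J_tail (r : ℝ) (hr : r < 2) (c : ℝ) (hc : 0 < c) (w : ℝ) (hw : 0 ≤ w) :
    ∫⁻ t in Set.Ioi c, ENNReal.ofReal (w * t ^ (r - 3)) =
      ENNReal.ofReal (w * (c ^ (r - 2) / (2 - r))) := by
  rw [← ofReal_integral_eq_lintegral_ofReal]
  · rw [integral_const_mul, integral_Ioi_rpow_of_lt (by linarith) hc]
    congr 2
    have : r - 3 + 1 = -(2 - r) := by ring
    rw [this, div_neg, neg_div, neg_neg, neg_sub]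
  · exact (integrableOn_Ioi_rpow_of_lt (by linarith) hc).const_mul w
  · refine (ae_restrict_iff' measurableSet_Ioi).2 (ae_of_all _ fun t ht => ?_)
    have : 0 < t := hc.trans ht
    simp only [Pi.zero_apply]
    positivity

lemma J1 (r : ℝ) (hr1 : 1 < r) (hr : r < 2) (s : ℝ) (hs : 0 ≤ s) :
    ENNReal.ofReal (s ^ (r / 2) / (2 - r)) ≤
      ∫⁻ t in Set.Ioi (0:ℝ), ENNReal.ofReal (min s (t ^ 2) * t ^ (r - 3)) := by
  rcases eq_or_lt_of_le hs with h | h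
  · rw [← h, Real.zero_rpow (by linarith)]; simp
  · have hsq : 0 < Real.sqrt s := Real.sqrt_pos.2 h
    calc ENNReal.ofReal (s ^ (r / 2) / (2 - r))
        = ENNReal.ofReal (s * ((Real.sqrt s) ^ (r - 2) / (2 - r))) := by
          congr 1
          rw [Real.sqrt_eq_rpow, ← Real.rpow_mul hs, mul_div_assoc']
          congr 1
          nth_rewrite 2 [← Real.rpow_one s]
          rw [← Real.rpow_add h]
          congr 1
          ring
      _ = ∫⁻ t in Set.Ioi (Real.sqrt s), ENNReal.ofReal (s * t ^ (r - 3)) :=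
          (J_tail r hr _ hsq s hs).symm
      _ = ∫⁻ t in Set.Ioi (Real.sqrt s), ENNReal.ofReal (min s (t ^ 2) * t ^ (r - 3)) := by
          refine setLIntegral_congr_fun measurableSet_Ioi fun t ht => ?_
          have : s ≤ t ^ 2 := by
            have := Real.sq_sqrt hs
            have h2 : Real.sqrt s < t := ht
            nlinarith
          simp only [min_eq_left this]
      _ ≤ _ := lintegral_mono_set (Set.Ioi_subset_Ioi hsq.le)

lemma J2 (r : ℝ) (hr1 : 1 < r) (hr : r < 2) (s : ℝ) (hs : 0 ≤ s) :
    ∫⁻ t in Set.Ioi (0:ℝ), ENNReal.ofReal (s * min s t * t ^ (r - 3)) ≤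
      ENNReal.ofReal (s ^ r * (1 / (r - 1) + 1 / (2 - r))) := by
  rcases eq_or_lt_of_le hs with h | h
  · rw [← h]; simp
  · rw [← Set.Ioc_union_Ioi_eq_Ioi hs, lintegral_union measurableSet_Ioi
      (Set.Ioc_disjoint_Ioi le_rfl)]
    have e1 : ∫⁻ t in Set.Ioc 0 s, ENNReal.ofReal (s * min s t * t ^ (r - 3)) =
        ENNReal.ofReal (s ^ r * (1 / (r - 1))) := by
      have : ∫⁻ t in Set.Ioc 0 s, ENNReal.ofReal (s * min s t * t ^ (r - 3)) =
          ∫⁻ t in Set.Ioc 0 s, ENNReal.ofReal (s * t ^ (r - 2)) := by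
        refine setLIntegral_congr_fun measurableSet_Ioc fun t ht => ?_
        rw [min_eq_right ht.2, mul_assoc]
        congr 2
        nth_rewrite 1 [← Real.rpow_one t]
        rw [← Real.rpow_add ht.1]
        congr 1; ring
      rw [this, ← ofReal_integral_eq_lintegral_ofReal]
      · rw [integral_const_mul, ← intervalIntegral.integral_of_le hs,
          integral_rpow (Or.inl (by linarith))]
        congr 1
        have : r - 2 + 1 = r - 1 := by ring
        rw [this, Real.zero_rpow (by linarith), sub_zero, mul_div_assoc', mul_one_div]
        congr 1
        nth_rewrite 1 [← Real.rpow_one s]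
        rw [← Real.rpow_add h]
        congr 1; ring
      · apply Integrable.const_mul
        have := (intervalIntegral.intervalIntegrable_rpow' (a := 0) (b := s) (by linarith : -1 < r - 2))
        rwa [intervalIntegrable_iff_integrableOn_Ioc_of_le hs] at this
      · refine (ae_restrict_iff' measurableSet_Ioc).2 (ae_of_all _ fun t ht => ?_)
        have : 0 < t := ht.1
        simp only [Pi.zero_apply]
        positivity
    have e2 : ∫⁻ t in Set.Ioi s, ENNReal.ofReal (s * min s t * t ^ (r - 3)) =
        ENNReal.ofReal (s ^ r * (1 / (2 - r))) := by
      have : ∫⁻ t in Set.Ioi s, ENNReal.ofReal (s * min s t * t ^ (r - 3)) =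
          ∫⁻ t in Set.Ioi s, ENNReal.ofReal (s * s * t ^ (r - 3)) := by
        refine setLIntegral_congr_fun measurableSet_Ioi fun t ht => ?_
        have : s ≤ t := le_of_lt ht
        simp only [min_eq_left this]
      rw [this, J_tail r hr s h _ (by positivity)]
      congr 1
      rw [mul_div_assoc', mul_one_div]
      congr 1
      rw [← pow_two, ← Real.rpow_natCast, ← Real.rpow_add h]
      congr 1; push_cast; ring
    rw [e1, e2, ← ENNReal.ofReal_add]
    · rw [mul_add]
    · have : 0 < r - 1 := by linarith
      positivity
    · have : 0 < 2 - r := by linarith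
      positivity

lemma Z_bound (r : ℝ) (hr1 : 1 < r) (hr : r < 2) : ∃ C : ℝ, 0 < C ∧
    ∀ (N L R : ℕ) (n : ℕ → ℕ), Monotone n → ∀ a : ℕ → ℂ, (∀ k, R ≤ k → a k = 0) →
    ∑ j ∈ range L, (Sq N n a j) ^ (r / 2) ≤ C * ∑ k ∈ range R, ‖a k‖ ^ r := by
  have h1 : 0 < r - 1 := by linarith
  have h2 : 0 < 2 - r := by linarith
  refine ⟨(2 - r) * (660 * (1 / (r - 1) + 1 / (2 - r))), by positivity, ?_⟩
  intro N L R n hn a ha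
  have key : ENNReal.ofReal (∑ j ∈ range L, (Sq N n a j) ^ (r / 2) / (2 - r)) ≤
      ENNReal.ofReal (660 * ∑ k ∈ range R, ‖a k‖ ^ r * (1 / (r - 1) + 1 / (2 - r))) := by
    calc ENNReal.ofReal (∑ j ∈ range L, (Sq N n a j) ^ (r / 2) / (2 - r))
        = ∑ j ∈ range L, ENNReal.ofReal ((Sq N n a j) ^ (r / 2) / (2 - r)) := by
          apply ENNReal.ofReal_sum_of_nonneg
          intro j _
          have := Sq_nonneg N n a j
          positivity
      _ ≤ ∑ j ∈ range L, ∫⁻ t in Set.Ioi (0:ℝ),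
            ENNReal.ofReal (min (Sq N n a j) (t ^ 2) * t ^ (r - 3)) :=
          sum_le_sum fun j _ => J1 r hr1 hr _ (Sq_nonneg N n a j)
      _ = ∫⁻ t in Set.Ioi (0:ℝ), ∑ j ∈ range L,
            ENNReal.ofReal (min (Sq N n a j) (t ^ 2) * t ^ (r - 3)) := by
          rw [lintegral_finsetSum]
          intro j _
          fun_prop
      _ ≤ ∫⁻ t in Set.Ioi (0:ℝ), ENNReal.ofReal 660 * ∑ k ∈ range R,
            ENNReal.ofReal (‖a k‖ * min ‖a k‖ t * t ^ (r - 3)) := by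
          refine setLIntegral_mono' measurableSet_Ioi fun t ht => ?_
          have ht0 : (0 : ℝ) < t := ht
          rw [← ENNReal.ofReal_sum_of_nonneg, ← ENNReal.ofReal_sum_of_nonneg,
            ← ENNReal.ofReal_mul (by norm_num)]
          · apply ENNReal.ofReal_le_ofReal
            rw [← sum_mul, ← sum_mul, ← mul_assoc]
            apply mul_le_mul_of_nonneg_right _ (by positivity)
            exact K_bound N L R n hn a ha t ht0
          · intro k _; positivity
          · intro j _
            have := Sq_nonneg N n a j
            positivity
      _ = ENNReal.ofReal 660 * ∑ k ∈ range R, ∫⁻ t in Set.Ioi (0:ℝ),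
            ENNReal.ofReal (‖a k‖ * min ‖a k‖ t * t ^ (r - 3)) := by
          rw [lintegral_const_mul, lintegral_finsetSum]
          · intro j _; fun_prop
          · fun_prop
      _ ≤ ENNReal.ofReal 660 * ∑ k ∈ range R,
            ENNReal.ofReal (‖a k‖ ^ r * (1 / (r - 1) + 1 / (2 - r))) := by
          gcongr
          exact J2 r hr1 hr _ (norm_nonneg _)
      _ = _ := by
          rw [← ENNReal.ofReal_sum_of_nonneg, ← ENNReal.ofReal_mul (by norm_num)]
          intro k _; positivity
  rw [ENNReal.ofReal_le_ofReal_iff (by positivity), ← sum_div, div_le_iff₀ h2, ← sum_mul] at key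
  linarith

end QME

namespace QME

section lam
variable {X : Type*} [MeasurableSpace X] {μ : Measure X} {p : ℝ≥0∞} [Fact (1 ≤ p)]

lemma lip_norm {E : Type*} [NormedAddCommGroup E] :
    LipschitzWith 1 (fun v : E => ((‖v‖ : ℝ) : ℂ)) := by
  refine LipschitzWith.of_dist_le_mul fun x y => ?_
  rw [NNReal.coe_one, one_mul, Complex.dist_of_im_eq (by simp)]
  simpa [dist_eq_norm x y] using dist_norm_norm_le x y

lemma lam_core {E : Type*} [NormedAddCommGroup E] [NormedSpace ℂ E] (hp : p ≠ ⊤)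
    (S : Lp ℂ p μ →L[ℂ] Lp ℂ p μ) (hS : IsLamperti S) {ι : Type*} [Fintype ι]
    (e : ι → E) (c : ι → E →L[ℂ] ℂ) (hec : ∀ v, ∑ i, c i v • e i = v) (F : Lp E p μ) :
    ∀ᵐ ω ∂μ, ‖S (lip_norm.compLp (by simp) F) ω‖ =
      ‖(∑ i, (ContinuousLinearMap.toSpanSingleton ℂ (e i)).compLpL p μ
          (S ((c i).compLpL p μ F)) : Lp E p μ) ω‖ := by
  set A : ι → (Lp ℂ p μ →L[ℂ] Lp E p μ) :=
    fun i => (ContinuousLinearMap.toSpanSingleton ℂ (e i)).compLpL p μ with hA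
  set B : ι → (Lp E p μ →L[ℂ] Lp ℂ p μ) := fun i => (c i).compLpL p μ with hB
  set W : Lp E p μ →L[ℂ] Lp E p μ := ∑ i, (A i).comp (S.comp (B i)) with hW
  have hWa : ∀ F, W F = ∑ i, A i (S (B i F)) := by intro F; simp [hW]
  have hWp : ∀ F, ∀ᵐ ω ∂μ, W F ω = ∑ i, (S (B i F)) ω • e i := by
    intro F
    rw [hWa]
    have h1 := Lp.coeFn_finsetSum (μ := μ) (p := p) univ (fun i => A i (S (B i F)))
    have h2 : ∀ᵐ ω ∂μ, ∀ i, (A i (S (B i F))) ω = (S (B i F)) ω • e i := by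
      refine ae_all_iff.2 fun i => ?_
      filter_upwards [ContinuousLinearMap.coeFn_compLpL (p := p) (μ := μ)
        (ContinuousLinearMap.toSpanSingleton ℂ (e i)) (S (B i F))] with ω hω
      rw [hA]; simp only; rw [hω]; simp
    filter_upwards [h1, h2] with ω h1 h2
    rw [h1]; simp [h2]
  suffices ∀ᵐ ω ∂μ, ‖S (lip_norm.compLp (by simp) F) ω‖ = ‖W F ω‖ by
    rw [hWa] at this; exact this
  refine Lp.induction hp (fun F : Lp E p μ =>
    ∀ᵐ ω ∂μ, ‖S (lip_norm.compLp (by simp) F) ω‖ = ‖W F ω‖) ?_ ?_ ?_ F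
  · intro v s hs hμs
    set one : Lp ℂ p μ := indicatorConstLp p hs hμs.ne (1 : ℂ) with hone
    have h1 : lip_norm.compLp (by simp) (Lp.simpleFunc.indicatorConst p hs hμs.ne v : Lp E p μ)
        = ((‖v‖ : ℝ) : ℂ) • one := by
      apply Lp.ext
      filter_upwards [LipschitzWith.coeFn_compLp lip_norm (by simp)
        (Lp.simpleFunc.indicatorConst p hs hμs.ne v : Lp E p μ),
        Lp.coeFn_smul ((‖v‖ : ℝ) : ℂ) one, indicatorConstLp_coeFn (p := p) (hs := hs)
          (hμs := hμs.ne) (c := (1 : ℂ)), indicatorConstLp_coeFn (p := p) (hs := hs)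
          (hμs := hμs.ne) (c := v)] with ω h1 h2 h3 h4
      rw [h1, h2, Lp.simpleFunc.coe_indicatorConst]
      simp only [Function.comp, h4, Pi.smul_apply, hone, h3]
      by_cases hω : ω ∈ s <;> simp [hω]
    have h2 : ∀ i, B i (Lp.simpleFunc.indicatorConst p hs hμs.ne v : Lp E p μ) = c i v • one := by
      intro i
      apply Lp.ext
      filter_upwards [ContinuousLinearMap.coeFn_compLpL (p := p) (μ := μ) (c i)
        (Lp.simpleFunc.indicatorConst p hs hμs.ne v : Lp E p μ),
        Lp.coeFn_smul (c i v) one, indicatorConstLp_coeFn (p := p) (hs := hs)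
          (hμs := hμs.ne) (c := (1 : ℂ)), indicatorConstLp_coeFn (p := p) (hs := hs)
          (hμs := hμs.ne) (c := v)] with ω h1 h2 h3 h4
      rw [hB]; simp only
      rw [h1, h2, Lp.simpleFunc.coe_indicatorConst]
      simp only [h4, Pi.smul_apply, hone, h3]
      by_cases hω : ω ∈ s <;> simp [hω]
    have h3 := hWp (Lp.simpleFunc.indicatorConst p hs hμs.ne v : Lp E p μ)
    simp only [h2, map_smul] at h3
    rw [h1, map_smul]
    have h4 : ∀ᵐ ω ∂μ, ∀ i, (c i v • S one) ω = c i v • (S one) ω :=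
      ae_all_iff.2 fun i => Lp.coeFn_smul (c i v) (S one)
    filter_upwards [h3, h4, Lp.coeFn_smul ((‖v‖ : ℝ) : ℂ) (S one)] with ω h3 h4 h5
    rw [h3, h5]
    have : ∑ i, (c i v • S one) ω • e i = (S one) ω • v := by
      conv_rhs => rw [← hec v, Finset.smul_sum]
      refine Finset.sum_congr rfl fun i _ => ?_
      rw [h4 i, smul_smul, smul_eq_mul, mul_comm]
    rw [this]
    simp [norm_smul, mul_comm]
  · intro f g hf hg hd h1 h2
    set nf : Lp ℂ p μ := lip_norm.compLp (by simp) (hf.toLp f) with hnf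
    set ng : Lp ℂ p μ := lip_norm.compLp (by simp) (hg.toLp g) with hng
    have a1 : ∀ᵐ ω ∂μ, nf ω = ((‖f ω‖ : ℝ) : ℂ) := by
      filter_upwards [LipschitzWith.coeFn_compLp lip_norm (by simp) (hf.toLp f),
        hf.coeFn_toLp] with ω b1 b2
      rw [hnf, b1, Function.comp, b2]
    have a2 : ∀ᵐ ω ∂μ, ng ω = ((‖g ω‖ : ℝ) : ℂ) := by
      filter_upwards [LipschitzWith.coeFn_compLp lip_norm (by simp) (hg.toLp g),
        hg.coeFn_toLp] with ω b1 b2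
      rw [hng, b1, Function.comp, b2]
    have hz : ∀ ω, f ω = 0 ∨ g ω = 0 := by
      intro ω
      by_contra hcon
      push Not at hcon
      exact Set.disjoint_left.1 hd (Function.mem_support.2 hcon.1) (Function.mem_support.2 hcon.2)
    have a3 : lip_norm.compLp (by simp) (hf.toLp f + hg.toLp g) = nf + ng := by
      apply Lp.ext
      filter_upwards [LipschitzWith.coeFn_compLp lip_norm (by simp) (hf.toLp f + hg.toLp g),
        hf.coeFn_toLp, hg.coeFn_toLp, Lp.coeFn_add (hf.toLp f) (hg.toLp g),
        Lp.coeFn_add nf ng, a1, a2] with ω b1 b2 b3 b4 b5 b6 b7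
      rw [b1, Function.comp, b4, b5, Pi.add_apply, Pi.add_apply, b2, b3, b6, b7]
      rcases hz ω with h | h <;> simp [h]
    have a4 := hS nf ng (by
      filter_upwards [a1, a2] with ω a1 a2
      rw [a1, a2]
      rcases hz ω with h | h <;> simp [h])
    rw [a3, map_add, map_add]
    filter_upwards [h1, h2, a4, Lp.coeFn_add (S nf) (S ng),
      Lp.coeFn_add (W (hf.toLp f)) (W (hg.toLp g))] with ω h1 h2 a4 b1 b2
    rw [b1, b2, Pi.add_apply, Pi.add_apply]
    rcases mul_eq_zero.1 a4 with h | h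
    · have : W (hf.toLp f) ω = 0 := by rw [← norm_eq_zero, ← h1, h, norm_zero]
      rw [h, this, zero_add, zero_add, h2]
    · have : W (hg.toLp g) ω = 0 := by rw [← norm_eq_zero, ← h2, h, norm_zero]
      rw [h, this, add_zero, add_zero, h1]
  · set U : Lp E p μ → Lp ℂ p μ := fun F =>
      lip_norm.compLp (by simp) (S (lip_norm.compLp (by simp) F)) with hU
    set V : Lp E p μ → Lp ℂ p μ := fun F => lip_norm.compLp (by simp) (W F) with hV
    have hUc : Continuous U := (LipschitzWith.continuous_compLp lip_norm (by simp)).comp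
      (S.continuous.comp (LipschitzWith.continuous_compLp lip_norm (by simp)))
    have hVc : Continuous V := (LipschitzWith.continuous_compLp lip_norm (by simp)).comp
      W.continuous
    convert isClosed_eq hUc hVc using 1
    ext F
    simp only [Set.mem_ofPred_eq]
    have b1 := LipschitzWith.coeFn_compLp lip_norm (by simp)
      (S (lip_norm.compLp (by simp) F))
    have b2 := LipschitzWith.coeFn_compLp lip_norm (by simp) (W F)
    constructor
    · intro h
      apply Lp.ext
      filter_upwards [h, b1, b2] with ω h b1 b2
      rw [hU, hV]; simp only
      rw [b1, b2]; simp [h]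
    · intro h
      have h' : (U F : X → ℂ) =ᵐ[μ] V F := by rw [h]
      filter_upwards [h', b1, b2] with ω h b1 b2
      rw [hU, hV] at h; simp only at h
      rw [b1, b2] at h
      simpa using h

lemma lam_rpow (hp : p ≠ ⊤) (S : Lp ℂ p μ →L[ℂ] Lp ℂ p μ) (hS : IsLamperti S)
    {ι : Type*} [Fintype ι] (r : ℝ) (hr : 1 ≤ r) (f : ι → Lp ℂ p μ) (u : Lp ℂ p μ)
    (hu : ∀ᵐ ω ∂μ, ‖u ω‖ = (∑ i, ‖f i ω‖ ^ r) ^ (1 / r)) :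
    ∀ᵐ ω ∂μ, ‖S u ω‖ = (∑ i, ‖S (f i) ω‖ ^ r) ^ (1 / r) := by
  classical
  have hr0 : 0 < r := by linarith
  -- reduce to nonneg u
  have scal : ∀ u : Lp ℂ p μ, ∀ᵐ ω ∂μ, ‖S u ω‖ = ‖S (lip_norm.compLp (by simp) u) ω‖ := by
    intro u
    have := lam_core hp S hS (ι := Unit) (fun _ => (1 : ℂ))
      (fun _ => ContinuousLinearMap.id ℂ ℂ) (by intro v; simp) u
    filter_upwards [this, ContinuousLinearMap.coeFn_compLpL (p := p) (μ := μ)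
        (ContinuousLinearMap.toSpanSingleton ℂ (1 : ℂ)) 
        (S ((ContinuousLinearMap.id ℂ ℂ).compLpL p μ u))] with ω h1 h2
    rw [h1]
    simp only [univ_unique, sum_const, card_singleton, one_smul]
    rw [h2]
    have : ((ContinuousLinearMap.id ℂ ℂ).compLpL p μ u) = u := by
      apply Lp.ext
      filter_upwards [ContinuousLinearMap.coeFn_compLpL (p := p) (μ := μ)
        (ContinuousLinearMap.id ℂ ℂ) u] with ω h
      rw [h]; simp
    rw [this]; simp
  set q : ℝ≥0∞ := ENNReal.ofReal r with hq
  have hqr : q.toReal = r := ENNReal.toReal_ofReal hr0.le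
  have : Fact (1 ≤ q) := ⟨by rw [hq, ← ENNReal.ofReal_one]; exact ENNReal.ofReal_le_ofReal hr⟩
  set e : ι → PiLp q (fun _ : ι => ℂ) := fun i => WithLp.toLp q (Pi.single i 1) with he
  set c : ι → PiLp q (fun _ : ι => ℂ) →L[ℂ] ℂ := fun i => PiLp.proj q (fun _ : ι => ℂ) i with hc
  have hsum : ∀ a : ι → ℂ, ∑ i, a i • e i = WithLp.toLp q a := by
    intro a
    ext j
    simp [he, Pi.single_apply]
  have hnorm : ∀ a : ι → ℂ, ‖WithLp.toLp q a‖ = (∑ i, ‖a i‖ ^ r) ^ (1 / r) := by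
    intro a
    rw [PiLp.norm_eq_sum (by rw [hqr]; exact hr0), hqr]
  set F : Lp (PiLp q (fun _ : ι => ℂ)) p μ :=
    ∑ i, (ContinuousLinearMap.toSpanSingleton ℂ (e i)).compLpL p μ (f i) with hF
  have key : ∀ g : ι → Lp ℂ p μ, ∀ᵐ ω ∂μ,
      (∑ i, (ContinuousLinearMap.toSpanSingleton ℂ (e i)).compLpL p μ (g i) :
        Lp (PiLp q (fun _ : ι => ℂ)) p μ) ω = WithLp.toLp q (fun i => g i ω) := by
    intro g
    have h1 := Lp.coeFn_finsetSum (μ := μ) (p := p) univ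
      (fun i => (ContinuousLinearMap.toSpanSingleton ℂ (e i)).compLpL p μ (g i))
    have h2 : ∀ᵐ ω ∂μ, ∀ i, ((ContinuousLinearMap.toSpanSingleton ℂ (e i)).compLpL p μ (g i)) ω
        = g i ω • e i := by
      refine ae_all_iff.2 fun i => ?_
      filter_upwards [ContinuousLinearMap.coeFn_compLpL (p := p) (μ := μ)
        (ContinuousLinearMap.toSpanSingleton ℂ (e i)) (g i)] with ω hω
      rw [hω]; simp
    filter_upwards [h1, h2] with ω h1 h2
    rw [h1, ← hsum]; simp [h2]
  have hcF : ∀ i, (c i).compLpL p μ F = f i := by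
    intro i
    apply Lp.ext
    filter_upwards [ContinuousLinearMap.coeFn_compLpL (p := p) (μ := μ) (c i) F, key f]
      with ω h1 h2
    rw [h1, hF, h2]; simp [hc]
  have main := lam_core hp S hS e c (by
    intro v
    have := hsum (fun i => c i v)
    rw [this]; ext j; simp [hc]) F
  simp only [hcF] at main
  have hnu : lip_norm.compLp (by simp) F = lip_norm.compLp (by simp) u := by
    apply Lp.ext
    filter_upwards [LipschitzWith.coeFn_compLp lip_norm (by simp) F,
      LipschitzWith.coeFn_compLp lip_norm (by simp) u, key f, hu] with ω h1 h2 h3 h4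
    rw [h1, h2, Function.comp, Function.comp, hF, h3, h4, hnorm]
  filter_upwards [main, scal u, key (fun i => S (f i))] with ω h1 h2 h3
  rw [h2, ← hnu, h1, h3, hnorm]

end lam
end QME

namespace QME

section lam
variable {X : Type*} [MeasurableSpace X] {μ : Measure X} {p : ℝ≥0∞} [Fact (1 ≤ p)]

lemma toReal_ge_one (hp : p ≠ ⊤) : 1 ≤ p.toReal := by
  have h : (1 : ℝ≥0∞) ≤ p := Fact.out
  simpa using (ENNReal.toReal_le_toReal (by simp) hp).2 h

lemma int_rpow {E : Type*} [NormedAddCommGroup E] (hp : p ≠ ⊤) (f : Lp E p μ) :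
    Integrable (fun ω => ‖f ω‖ ^ p.toReal) μ :=
  (Lp.memLp f).integrable_norm_rpow (by have : (1 : ℝ≥0∞) ≤ p := Fact.out; positivity) hp

lemma norm_rpow {E : Type*} [NormedAddCommGroup E] (hp : p ≠ ⊤) (f : Lp E p μ) :
    ‖f‖ ^ p.toReal = ∫ ω, ‖f ω‖ ^ p.toReal ∂μ := by
  have hP := toReal_ge_one hp
  have hp0 : p ≠ 0 := by have : (1 : ℝ≥0∞) ≤ p := Fact.out; positivity
  have h0 : 0 ≤ ∫ ω, ‖f ω‖ ^ p.toReal ∂μ := integral_nonneg fun ω => by positivity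
  rw [Lp.norm_def, (Lp.memLp f).eLpNorm_eq_integral_rpow_norm hp0 hp,
    ENNReal.toReal_ofReal (by positivity), ← Real.rpow_mul h0, inv_mul_cancel₀ (by linarith),
    Real.rpow_one]

lemma exists_root (hp : p ≠ ⊤) (h : X → ℝ) (hi : Integrable h μ) (h0 : ∀ᵐ ω ∂μ, 0 ≤ h ω) :
    ∃ u : Lp ℂ p μ, ∀ᵐ ω ∂μ, ‖u ω‖ ^ p.toReal = h ω := by
  have hP := toReal_ge_one hp
  have hp0 : p ≠ 0 := by have : (1 : ℝ≥0∞) ≤ p := Fact.out; positivity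
  have hm : AEStronglyMeasurable (fun ω => (((h ω) ^ (1 / p.toReal) : ℝ) : ℂ)) μ := by
    have := hi.aestronglyMeasurable.aemeasurable
    exact (Complex.measurable_ofReal.comp_aemeasurable
      (this.pow_const _)).aestronglyMeasurable
  have hpt : ∀ᵐ ω ∂μ, ‖(((h ω) ^ (1 / p.toReal) : ℝ) : ℂ)‖ ^ p.toReal = h ω := by
    filter_upwards [h0] with ω h0
    rw [Complex.norm_real, Real.norm_of_nonneg (by positivity), ← Real.rpow_mul h0,
      one_div, inv_mul_cancel₀ (by linarith), Real.rpow_one]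
  have hmem : MemLp (fun ω => (((h ω) ^ (1 / p.toReal) : ℝ) : ℂ)) p μ := by
    rw [← integrable_norm_rpow_iff hm hp0 hp]
    refine hi.congr ?_
    filter_upwards [hpt] with ω h using h.symm
  refine ⟨hmem.toLp _, ?_⟩
  filter_upwards [hpt, hmem.coeFn_toLp] with ω h1 h2
  rw [h2, h1]

lemma lam_pow (hp : p ≠ ⊤) (S : Lp ℂ p μ →L[ℂ] Lp ℂ p μ) (hS : IsLamperti S)
    {ι : Type*} [Fintype ι] (r : ℝ) (hr : 1 ≤ r) (f : ι → Lp ℂ p μ) (u : Lp ℂ p μ)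
    (hu : ∀ᵐ ω ∂μ, ‖u ω‖ ^ r = ∑ i, ‖f i ω‖ ^ r) :
    ∀ᵐ ω ∂μ, ‖S u ω‖ ^ r = ∑ i, ‖S (f i) ω‖ ^ r := by
  have hr0 : 0 < r := by linarith
  have := lam_rpow hp S hS r hr f u (by
    filter_upwards [hu] with ω h
    rw [← h, one_div, Real.rpow_rpow_inv (norm_nonneg _) hr0.ne'])
  filter_upwards [this] with ω h
  rw [h, one_div, Real.rpow_inv_rpow (sum_nonneg fun i _ => by positivity) hr0.ne']

lemma loss (hp : p ≠ ⊤) (S : Lp ℂ p μ →L[ℂ] Lp ℂ p μ) (hS : IsLamperti S) (hS1 : ‖S‖ ≤ 1)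
    (C : ℝ) (hC : 0 < C) (A B : ℕ) (φ b : ℕ → Lp ℂ p μ)
    (h : ∀ᵐ ω ∂μ, ∑ j ∈ range A, ‖φ j ω‖ ^ p.toReal ≤ C * ∑ k ∈ range B, ‖b k ω‖ ^ p.toReal) :
    C * ∑ k ∈ range B, ‖S (b k)‖ ^ p.toReal - ∑ j ∈ range A, ‖S (φ j)‖ ^ p.toReal ≤
    C * ∑ k ∈ range B, ‖b k‖ ^ p.toReal - ∑ j ∈ range A, ‖φ j‖ ^ p.toReal := by
  have hP := toReal_ge_one hp
  set P := p.toReal with hPdef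
  have i1 : ∀ b : ℕ → Lp ℂ p μ, ∀ B, Integrable (fun ω => ∑ k ∈ range B, ‖b k ω‖ ^ P) μ :=
    fun b B => integrable_finsetSum _ fun k _ => int_rpow hp (b k)
  have i2 : ∀ b : ℕ → Lp ℂ p μ, ∀ B, ∫ ω, ∑ k ∈ range B, ‖b k ω‖ ^ P ∂μ =
      ∑ k ∈ range B, ‖b k‖ ^ P := by
    intro b B
    rw [integral_finsetSum _ fun k _ => int_rpow hp (b k)]
    exact sum_congr rfl fun k _ => (norm_rpow hp (b k)).symm
  obtain ⟨u, hu⟩ := exists_root (p := p) (μ := μ) hp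
    (fun ω => C * ∑ k ∈ range B, ‖b k ω‖ ^ P - ∑ j ∈ range A, ‖φ j ω‖ ^ P)
    (((i1 b B).const_mul C).sub (i1 φ A)) (by
      filter_upwards [h] with ω h using sub_nonneg.2 h)
  obtain ⟨w, hw⟩ := exists_root (p := p) (μ := μ) hp
    (fun ω => C * ∑ k ∈ range B, ‖b k ω‖ ^ P) ((i1 b B).const_mul C) (by
      filter_upwards with ω; positivity)
  -- first decomposition
  have w1 := lam_pow hp S hS P hP (fun k : Fin B => ((C ^ P⁻¹ : ℝ) : ℂ) • b k) w (by
    have : ∀ᵐ ω ∂μ, ∀ k : Fin B, (((C ^ P⁻¹ : ℝ) : ℂ) • b k) ω = ((C ^ P⁻¹ : ℝ) : ℂ) • (b k ω) :=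
      ae_all_iff.2 fun k => Lp.coeFn_smul _ _
    filter_upwards [hw, this] with ω hw h
    rw [hw, Finset.sum_range, Finset.mul_sum]
    refine sum_congr rfl fun k _ => ?_
    rw [h, norm_smul, Complex.norm_real, Real.norm_of_nonneg (by positivity),
      Real.mul_rpow (by positivity) (by positivity), Real.rpow_inv_rpow hC.le (by linarith)])
  have w1' : ∀ᵐ ω ∂μ, ‖S w ω‖ ^ P = C * ∑ k ∈ range B, ‖S (b k) ω‖ ^ P := by
    have : ∀ᵐ ω ∂μ, ∀ k : Fin B, (((C ^ P⁻¹ : ℝ) : ℂ) • S (b k)) ω =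
        ((C ^ P⁻¹ : ℝ) : ℂ) • (S (b k) ω) :=
      ae_all_iff.2 fun k => Lp.coeFn_smul _ _
    filter_upwards [w1, this] with ω hw h
    rw [hw, Finset.sum_range, Finset.mul_sum]
    refine sum_congr rfl fun k _ => ?_
    rw [map_smul, h, norm_smul, Complex.norm_real, Real.norm_of_nonneg (by positivity),
      Real.mul_rpow (by positivity) (by positivity), Real.rpow_inv_rpow hC.le (by linarith)]
  have w2 := lam_pow hp S hS P hP
    (fun o : Option (Fin A) => o.elim u (fun j => φ j)) w (by
    filter_upwards [hw, hu] with ω hw hu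
    rw [hw, Fintype.sum_option]
    simp only [Option.elim]
    rw [hu, ← Finset.sum_range (fun j => ‖φ j ω‖ ^ P)]; ring)
  have su : ∀ᵐ ω ∂μ, ‖S u ω‖ ^ P =
      C * ∑ k ∈ range B, ‖S (b k) ω‖ ^ P - ∑ j ∈ range A, ‖S (φ j) ω‖ ^ P := by
    filter_upwards [w1', w2] with ω h1 h2
    rw [h1, Fintype.sum_option] at h2
    simp only [Option.elim] at h2
    rw [← Finset.sum_range (fun j => ‖S (φ j) ω‖ ^ P)] at h2
    linarith
  have e1 : ‖u‖ ^ P = C * ∑ k ∈ range B, ‖b k‖ ^ P - ∑ j ∈ range A, ‖φ j‖ ^ P := by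
    rw [norm_rpow hp, integral_congr_ae hu, integral_sub ((i1 b B).const_mul C) (i1 φ A),
      integral_const_mul, i2, i2]
  have e2 : ‖S u‖ ^ P = C * ∑ k ∈ range B, ‖S (b k)‖ ^ P - ∑ j ∈ range A, ‖S (φ j)‖ ^ P := by
    rw [norm_rpow hp, integral_congr_ae su, integral_sub ((i1 (fun k => S (b k)) B).const_mul C)
      (i1 (fun k => S (φ k)) A), integral_const_mul, i2 (fun k => S (b k)),
      i2 (fun k => S (φ k))]
  rw [← e1, ← e2]
  refine Real.rpow_le_rpow (norm_nonneg _) ?_ (by linarith)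
  exact (S.le_opNorm u).trans (mul_le_of_le_one_left (norm_nonneg _) hS1)

end lam
end QME

namespace QME

section words
variable {X : Type*} [MeasurableSpace X] {μ : Measure X} {p : ℝ≥0∞} [Fact (1 ≤ p)]

/-- Averages of sequences in `L^p`. -/
noncomputable def cavL (m j : ℕ) : (ℕ → Lp ℂ p μ) →L[ℂ] Lp ℂ p μ :=
  ((m : ℂ) + 1)⁻¹ • ∑ k ∈ range (m + 1), ContinuousLinearMap.proj (j + k)

noncomputable def dL (n : ℕ → ℕ) (j i : ℕ) : (ℕ → Lp ℂ p μ) →L[ℂ] Lp ℂ p μ :=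
  cavL (n i) j - cavL (n (i + 1)) j

noncomputable def ev (N : ℕ) (i : Fin N) : EuclideanSpace ℂ (Fin N) := EuclideanSpace.single i 1

noncomputable def HL (N : ℕ) (n : ℕ → ℕ) (j : ℕ) :
    (ℕ → Lp ℂ p μ) →L[ℂ] Lp (EuclideanSpace ℂ (Fin N)) p μ :=
  ∑ i : Fin N, ((ContinuousLinearMap.toSpanSingleton ℂ (ev N i)).compLpL p μ).comp (dL n j i)

lemma cavL_apply (m j : ℕ) (b : ℕ → Lp ℂ p μ) :
    cavL m j b = ((m : ℂ) + 1)⁻¹ • ∑ k ∈ range (m + 1), b (j + k) := by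
  simp [cavL]

lemma cavL_ae (m j : ℕ) (b : ℕ → Lp ℂ p μ) :
    ∀ᵐ ω ∂μ, cavL m j b ω = av m (fun k => b k ω) j := by
  rw [cavL_apply]
  filter_upwards [Lp.coeFn_smul ((m : ℂ) + 1)⁻¹ (∑ k ∈ range (m + 1), b (j + k)),
    Lp.coeFn_finsetSum (μ := μ) (p := p) (range (m + 1)) (fun k => b (j + k))] with ω h1 h2
  rw [h1, Pi.smul_apply, h2]
  simp [av, cav]

lemma dL_ae (n : ℕ → ℕ) (j i : ℕ) (b : ℕ → Lp ℂ p μ) :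
    ∀ᵐ ω ∂μ, dL n j i b ω = av (n i) (fun k => b k ω) j - av (n (i + 1)) (fun k => b k ω) j := by
  have : dL n j i b = cavL (n i) j b - cavL (n (i + 1)) j b := rfl
  rw [this]
  filter_upwards [Lp.coeFn_sub (cavL (n i) j b) (cavL (n (i + 1)) j b),
    cavL_ae (n i) j b, cavL_ae (n (i + 1)) j b] with ω h1 h2 h3
  rw [h1, Pi.sub_apply, h2, h3]

lemma HL_ae (N : ℕ) (n : ℕ → ℕ) (j : ℕ) (b : ℕ → Lp ℂ p μ) :
    ∀ᵐ ω ∂μ, ‖HL N n j b ω‖ ^ 2 = Sq N n (fun k => b k ω) j := by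
  have h0 : HL N n j b = ∑ i : Fin N,
    (ContinuousLinearMap.toSpanSingleton ℂ (ev N i)).compLpL p μ (dL n j i b) := by simp [HL]
  rw [h0]
  have h1 := Lp.coeFn_finsetSum (μ := μ) (p := p) univ
      (fun i : Fin N => (ContinuousLinearMap.toSpanSingleton ℂ (ev N i)).compLpL p μ (dL n j i b))
  have h2 : ∀ᵐ ω ∂μ, ∀ i : Fin N,
      ((ContinuousLinearMap.toSpanSingleton ℂ (ev N i)).compLpL p μ (dL n j i b)) ω
        = (av (n i) (fun k => b k ω) j - av (n (i + 1)) (fun k => b k ω) j) • ev N i := by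
    refine ae_all_iff.2 fun i => ?_
    filter_upwards [ContinuousLinearMap.coeFn_compLpL (p := p) (μ := μ)
        (ContinuousLinearMap.toSpanSingleton ℂ (ev N i)) (dL n j i b), dL_ae n j i b] with ω hω h
    rw [hω, h]; simp
  filter_upwards [h1, h2] with ω h1 h2
  rw [h1, Finset.sum_apply]
  simp only [h2]
  rw [EuclideanSpace.norm_sq_eq, Sq, Finset.sum_range]
  refine sum_congr rfl fun i _ => ?_
  congr 2
  simp [ev, Pi.single_apply]

/-- the scalar square function. -/
noncomputable def GG (N : ℕ) (n : ℕ → ℕ) (j : ℕ) (b : ℕ → Lp ℂ p μ) : Lp ℂ p μ :=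
  lip_norm.compLp (by simp) (HL N n j b)

lemma GG_ae' (N : ℕ) (n : ℕ → ℕ) (j : ℕ) (b : ℕ → Lp ℂ p μ) :
    ∀ᵐ ω ∂μ, ‖GG N n j b ω‖ = ‖HL N n j b ω‖ := by
  filter_upwards [LipschitzWith.coeFn_compLp lip_norm (by simp) (HL N n j b)] with ω h
  rw [GG, h]; simp

lemma GG_norm (N : ℕ) (n : ℕ → ℕ) (j : ℕ) (b : ℕ → Lp ℂ p μ) :
    ‖GG N n j b‖ = ‖HL N n j b‖ := by
  rw [Lp.norm_def, Lp.norm_def]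
  congr 1
  exact eLpNorm_congr_norm_ae (GG_ae' N n j b)

lemma GG_ae (N : ℕ) (n : ℕ → ℕ) (j : ℕ) (b : ℕ → Lp ℂ p μ) :
    ∀ᵐ ω ∂μ, ‖GG N n j b ω‖ ^ 2 = Sq N n (fun k => b k ω) j := by
  filter_upwards [GG_ae' N n j b, HL_ae N n j b] with ω h1 h2
  rw [h1, h2]

lemma GG_sum (N : ℕ) (n : ℕ → ℕ) (j : ℕ) (b : ℕ → Lp ℂ p μ) :
    ∀ᵐ ω ∂μ, ‖GG N n j b ω‖ ^ (2 : ℝ) = ∑ i : Fin N, ‖dL n j i b ω‖ ^ (2 : ℝ) := by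
  have : ∀ᵐ ω ∂μ, ∀ i : Fin N, dL n j i b ω =
    av (n i) (fun k => b k ω) j - av (n (i + 1)) (fun k => b k ω) j :=
    ae_all_iff.2 fun i => dL_ae n j i b
  filter_upwards [GG_ae N n j b, this] with ω h1 h2
  simp only [Real.rpow_two, h1, h2, Sq, Finset.sum_range]

lemma GG_shift (hp : p ≠ ⊤) (S : Lp ℂ p μ →L[ℂ] Lp ℂ p μ) (hS : IsLamperti S)
    (N : ℕ) (n : ℕ → ℕ) (j : ℕ) (b b' : ℕ → Lp ℂ p μ) (hb : ∀ k, b' (k + 1) = S (b k)) :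
    ‖GG N n (j + 1) b'‖ = ‖S (GG N n j b)‖ := by
  have h1 := lam_pow hp S hS 2 (by norm_num) (fun i : Fin N => dL n j i b) (GG N n j b)
    (GG_sum N n j b)
  have h2 := GG_sum N n (j + 1) b'
  have h3 : ∀ i, dL n (j + 1) i b' = S (dL n j i b) := by
    intro i
    have : ∀ k, b' (j + 1 + k) = S (b (j + k)) := by
      intro k; rw [← hb]; congr 1; ring
    simp only [dL, sub_apply, cavL_apply, map_sub, map_smul, map_sum, this]
  simp only [h3] at h2
  rw [Lp.norm_def, Lp.norm_def]
  congr 1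
  refine eLpNorm_congr_norm_ae ?_
  filter_upwards [h1, h2] with ω h1 h2
  rw [← h1] at h2
  simpa using (Real.rpow_left_inj (norm_nonneg _) (norm_nonneg _) (by norm_num)).1 h2

/-- The orbit of `x` along a word. -/
noncomputable def bw {κ : Type*} (S : κ → Lp ℂ p μ →L[ℂ] Lp ℂ p μ) (x : Lp ℂ p μ) :
    List κ → ℕ → Lp ℂ p μ
  | _, 0 => x
  | [], _ + 1 => 0
  | i :: l, k + 1 => S i (bw S x l k)

lemma bw_zero {κ : Type*} (S : κ → Lp ℂ p μ →L[ℂ] Lp ℂ p μ) (x : Lp ℂ p μ) (l : List κ) :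
    bw S x l 0 = x := by cases l <;> simp [bw]

lemma bw_cons {κ : Type*} (S : κ → Lp ℂ p μ →L[ℂ] Lp ℂ p μ) (x : Lp ℂ p μ) (l : List κ) (i : κ)
    (k : ℕ) : bw S x (i :: l) (k + 1) = S i (bw S x l k) := by simp [bw]

lemma bw_gt {κ : Type*} (S : κ → Lp ℂ p μ →L[ℂ] Lp ℂ p μ) (x : Lp ℂ p μ) (l : List κ) :
    ∀ k, l.length + 1 ≤ k → bw S x l k = 0 := by
  induction l with
  | nil => intro k hk; obtain ⟨k, rfl⟩ := Nat.exists_eq_add_of_le' (by simpa using hk); simp [bw]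
  | cons i l ih =>
    intro k hk
    simp only [List.length_cons] at hk
    obtain ⟨k, rfl⟩ := Nat.exists_eq_add_of_le' (show 1 ≤ k by omega)
    rw [bw_cons, ih k (by omega), map_zero]

/-- Average over words of length `m`. -/
noncomputable def avg {κ : Type*} [Fintype κ] {V : Type*} [AddCommGroup V] [Module ℝ V]
    (w : κ → ℝ) : ℕ → (List κ → V) → V
  | 0, f => f []
  | m + 1, f => ∑ i, w i • avg w m (fun l => f (i :: l))

section avg
variable {κ : Type*} [Fintype κ] {V : Type*} [AddCommGroup V] [Module ℝ V] (w : κ → ℝ)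

lemma avg_zero (f : List κ → V) : avg w 0 f = f [] := rfl

lemma avg_succ (m : ℕ) (f : List κ → V) :
    avg w (m + 1) f = ∑ i, w i • avg w m (fun l => f (i :: l)) := rfl

lemma avg_add (m : ℕ) : ∀ f g : List κ → V,
    avg w m (fun l => f l + g l) = avg w m f + avg w m g := by
  induction m with
  | zero => intro f g; rfl
  | succ m ih =>
    intro f g
    simp only [avg_succ, ih, smul_add, sum_add_distrib]

lemma avg_const (hw : ∑ i, w i = 1) (m : ℕ) (v : V) : avg w m (fun _ => v) = v := by
  induction m with
  | zero => rfl
  | succ m ih => rw [avg_succ]; simp only [ih]; rw [← sum_smul, hw, one_smul]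

lemma avg_map {V' : Type*} [AddCommGroup V'] [Module ℝ V'] (A : V →ₗ[ℝ] V') (m : ℕ) :
    ∀ f : List κ → V, avg w m (fun l => A (f l)) = A (avg w m f) := by
  induction m with
  | zero => intro f; rfl
  | succ m ih => intro f; simp only [avg_succ, ih, map_sum, map_smul]

lemma avg_mono (hw0 : ∀ i, 0 ≤ w i) (m : ℕ) : ∀ f g : List κ → ℝ,
    (∀ l, l.length = m → f l ≤ g l) → avg w m f ≤ avg w m g := by
  induction m with
  | zero => intro f g h; exact h [] rfl
  | succ m ih =>
    intro f g h
    rw [avg_succ, avg_succ]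
    refine sum_le_sum fun i _ => ?_
    exact mul_le_mul_of_nonneg_left (ih _ _ fun l hl => h _ (by simp [hl])) (hw0 i)

lemma avg_jensen (hw0 : ∀ i, 0 ≤ w i) (hw : ∑ i, w i = 1) (Φ : V → ℝ)
    (hΦ : ConvexOn ℝ Set.univ Φ) (m : ℕ) :
    ∀ f : List κ → V, Φ (avg w m f) ≤ avg w m (fun l => Φ (f l)) := by
  induction m with
  | zero => intro f; exact le_rfl
  | succ m ih =>
    intro f
    rw [avg_succ, avg_succ]
    refine (hΦ.map_sum_le (fun i _ => hw0 i) hw (fun i _ => Set.mem_univ _)).trans ?_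
    refine sum_le_sum fun i _ => ?_
    exact mul_le_mul_of_nonneg_left (ih _) (hw0 i)

end avg

lemma avg_bw {κ : Type*} [Fintype κ] (w : κ → ℝ) (hw : ∑ i, w i = 1)
    (S : κ → Lp ℂ p μ →L[ℂ] Lp ℂ p μ) (x : Lp ℂ p μ) (m : ℕ) :
    ∀ k ≤ m, avg w m (fun l => bw S x l k) = ((∑ i, w i • S i) ^ k) x := by
  induction m with
  | zero => intro k hk; obtain rfl : k = 0 := by omega
            simp [avg_zero, bw_zero]
  | succ m ih =>
    intro k hk
    rcases k with _ | k
    · simp only [bw_zero]; rw [avg_const w hw]; simp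
    · rw [avg_succ]
      simp only [bw_cons]
      have : ∀ i, avg w m (fun l => S i (bw S x l k)) = S i (((∑ i, w i • S i) ^ k) x) := by
        intro i
        rw [← ih k (by omega)]
        exact avg_map w ((S i).toLinearMap.restrictScalars ℝ) m (fun l => bw S x l k)
      simp only [this]
      rw [pow_succ']
      simp

lemma convex_HL (hp : p ≠ ⊤) (N : ℕ) (n : ℕ → ℕ) (j : ℕ) :
    ConvexOn ℝ Set.univ (fun b : ℕ → Lp ℂ p μ => ‖HL N n j b‖ ^ p.toReal) := by
  have hP := toReal_ge_one hp
  refine ⟨convex_univ, fun a _ b _ s t hs ht hst => ?_⟩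
  have h2 : ‖HL N n j (s • a + t • b)‖ ≤ s • ‖HL N n j a‖ + t • ‖HL N n j b‖ := by
    rw [map_add, (HL N n j).map_smul_of_tower, (HL N n j).map_smul_of_tower]
    refine (norm_add_le _ _).trans (le_of_eq ?_)
    rw [norm_smul, norm_smul, Real.norm_of_nonneg hs, Real.norm_of_nonneg ht]
    rfl
  refine (Real.rpow_le_rpow (norm_nonneg _) h2 (by linarith)).trans ?_
  exact (convexOn_rpow hP).2 (norm_nonneg (HL N n j a)) (norm_nonneg (HL N n j b)) hs ht hst

lemma HL_congr (N : ℕ) (n : ℕ → ℕ) (hn : Monotone n) (b b' : ℕ → Lp ℂ p μ)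
    (h : ∀ k ≤ n N, b k = b' k) : HL N n 0 b = HL N n 0 b' := by
  have : ∀ i : Fin N, dL n 0 i b = dL n 0 i b' := by
    intro i
    have h1 : n i ≤ n N := hn (by omega)
    have h2 : n (i + 1) ≤ n N := hn (by omega)
    simp only [dL, sub_apply, cavL_apply, zero_add]
    congr 2
    · exact sum_congr rfl fun k hk => h k (by have := mem_range.1 hk; omega)
    · exact sum_congr rfl fun k hk => h k (by have := mem_range.1 hk; omega)
  simp [HL, this]

/-- Main bound for convex combinations. -/
lemma conv_bound (hp : p ≠ ⊤) (C : ℝ) (hC : 0 < C)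
    (hZ : ∀ (N L R : ℕ) (n : ℕ → ℕ), Monotone n → ∀ a : ℕ → ℂ, (∀ k, R ≤ k → a k = 0) →
      ∑ j ∈ range L, (Sq N n a j) ^ (p.toReal / 2) ≤ C * ∑ k ∈ range R, ‖a k‖ ^ p.toReal)
    {κ : Type*} [Fintype κ] (w : κ → ℝ) (hw0 : ∀ i, 0 ≤ w i) (hw : ∑ i, w i = 1)
    (S : κ → Lp ℂ p μ →L[ℂ] Lp ℂ p μ) (hS : ∀ i, ‖S i‖ ≤ 1 ∧ IsLamperti (S i))
    (N : ℕ) (n : ℕ → ℕ) (hn : Monotone n) (x : Lp ℂ p μ) :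
    ‖HL N n 0 (fun k => ((∑ i, w i • S i) ^ k) x)‖ ^ p.toReal ≤ 2 * C * ‖x‖ ^ p.toReal := by
  have hP := toReal_ge_one hp
  set P := p.toReal with hPdef
  set D : List κ → ℝ := fun l => C * ∑ k ∈ range (l.length + 1), ‖bw S x l k‖ ^ P -
    ∑ j ∈ range (l.length + 1), ‖GG N n j (bw S x l)‖ ^ P with hD
  set e : List κ → ℝ := fun l => ‖GG N n 0 (bw S x l)‖ ^ P with he
  have pt : ∀ l : List κ, ∀ᵐ ω ∂μ, ∑ j ∈ range (l.length + 1), ‖GG N n j (bw S x l) ω‖ ^ P ≤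
      C * ∑ k ∈ range (l.length + 1), ‖bw S x l k ω‖ ^ P := by
    intro l
    have h1 : ∀ᵐ ω ∂μ, ∀ j, ‖GG N n j (bw S x l) ω‖ ^ 2 = Sq N n (fun k => bw S x l k ω) j :=
      ae_all_iff.2 fun j => GG_ae N n j _
    have h2 : ∀ᵐ ω ∂μ, ∀ k, l.length + 1 ≤ k → bw S x l k ω = 0 := by
      refine ae_all_iff.2 fun k => ?_
      by_cases hk : l.length + 1 ≤ k
      · rw [bw_gt S x l k hk]
        filter_upwards [Lp.coeFn_zero ℂ p μ] with ω h _
        simpa using h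
      · filter_upwards with ω h using absurd h hk
    filter_upwards [h1, h2] with ω h1 h2
    refine le_trans (le_of_eq ?_) (hZ N (l.length + 1) (l.length + 1) n hn (fun k => bw S x l k ω) h2)
    refine sum_congr rfl fun j _ => ?_
    rw [← h1 j, ← Real.rpow_natCast, ← Real.rpow_mul (norm_nonneg _)]
    congr 1; push_cast; ring
  have hD0 : ∀ l, 0 ≤ D l := by
    intro l
    have := integral_mono_ae (μ := μ)
      (integrable_finsetSum _ fun j _ => int_rpow hp (GG N n j (bw S x l)))
      ((integrable_finsetSum _ fun k _ => int_rpow hp (bw S x l k)).const_mul C) (pt l)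
    rw [integral_const_mul, integral_finsetSum _ fun j _ => int_rpow hp (GG N n j (bw S x l)),
      integral_finsetSum _ fun k _ => int_rpow hp (bw S x l k)] at this
    simp only [← norm_rpow hp] at this
    rw [hD]; simp only; linarith
  have hstep : ∀ i l, D (i :: l) ≤ D l + C * ‖x‖ ^ P - e (i :: l) := by
    intro i l
    have h1 := loss hp (S i) (hS i).2 (hS i).1 C hC (l.length + 1) (l.length + 1)
      (fun j => GG N n j (bw S x l)) (bw S x l) (pt l)
    have h2 : D (i :: l) = C * ‖x‖ ^ P - e (i :: l) +
        (C * ∑ k ∈ range (l.length + 1), ‖S i (bw S x l k)‖ ^ P -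
          ∑ j ∈ range (l.length + 1), ‖S i (GG N n j (bw S x l))‖ ^ P) := by
      rw [hD, he]
      simp only [List.length_cons]
      rw [sum_range_succ' _ (l.length + 1), sum_range_succ' _ (l.length + 1), bw_zero]
      simp only [bw_cons]
      have : ∀ j, ‖GG N n (j + 1) (bw S x (i :: l))‖ = ‖S i (GG N n j (bw S x l))‖ :=
        fun j => GG_shift hp (S i) (hS i).2 N n j _ _ (fun k => bw_cons S x l i k)
      simp only [this]
      ring
    rw [h2]
    have h3 : D l = C * ∑ k ∈ range (l.length + 1), ‖bw S x l k‖ ^ P -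
      ∑ j ∈ range (l.length + 1), ‖GG N n j (bw S x l)‖ ^ P := rfl
    linarith
  have hd : ∀ m, avg w m D ≤ C * (m + 1) * ‖x‖ ^ P - ∑ t ∈ range (m + 1), avg w t e := by
    intro m
    induction m with
    | zero =>
      simp only [zero_add, sum_range_one, avg_zero, hD, he]
      simp [bw_zero]
    | succ m ih =>
      have h1 : avg w (m + 1) D + avg w (m + 1) e ≤ avg w m D + C * ‖x‖ ^ P := by
        rw [← avg_add, avg_succ]
        have : ∀ i, avg w m (fun l => D (i :: l) + e (i :: l)) ≤ avg w m D + C * ‖x‖ ^ P := by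
          intro i
          rw [← avg_const w hw m (C * ‖x‖ ^ P), ← avg_add]
          refine avg_mono w hw0 m _ _ fun l _ => ?_
          have := hstep i l
          linarith
        calc ∑ i, w i • avg w m (fun l => D (i :: l) + e (i :: l))
            ≤ ∑ i, w i • (avg w m D + C * ‖x‖ ^ P) :=
              sum_le_sum fun i _ => mul_le_mul_of_nonneg_left (this i) (hw0 i)
          _ = avg w m D + C * ‖x‖ ^ P := by rw [← sum_smul, hw, one_smul]
      rw [sum_range_succ]
      push_cast
      linarith
  have hd0 : ∀ m, 0 ≤ avg w m D := by
    intro m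
    rw [← avg_const w hw m (0 : ℝ)]
    exact avg_mono w hw0 m _ _ fun l _ => hD0 l
  have he0 : ∀ m, 0 ≤ avg w m e := by
    intro m
    rw [← avg_const w hw m (0 : ℝ)]
    exact avg_mono w hw0 m _ _ fun l _ => by rw [he]; positivity
  set K := n N with hK
  have hJ : ∀ m, K ≤ m → ‖HL N n 0 (fun k => ((∑ i, w i • S i) ^ k) x)‖ ^ P ≤ avg w m e := by
    intro m hm
    have h1 := avg_jensen w hw0 hw _ (convex_HL (μ := μ) hp N n 0) m (fun l => bw S x l)
    simp only [← GG_norm] at h1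
    refine le_trans (le_of_eq ?_) h1
    rw [GG_norm]
    congr 2
    refine HL_congr N n hn _ _ fun k hk => ?_
    rw [← avg_bw w hw S x m k (by omega)]
    exact avg_map w (LinearMap.proj (R := ℝ) (φ := fun _ : ℕ => Lp ℂ p μ) k) m (fun l => bw S x l)
  set Q := ‖HL N n 0 (fun k => ((∑ i, w i • S i) ^ k) x)‖ ^ P with hQ
  have h1 : ((K : ℝ) + 1) * Q ≤ ∑ t ∈ range (2 * K + 1), avg w t e := by
    have : ∑ t ∈ Ico K (2 * K + 1), Q ≤ ∑ t ∈ Ico K (2 * K + 1), avg w t e :=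
      sum_le_sum fun t ht => hJ t (mem_Ico.1 ht).1
    rw [sum_const, Nat.card_Ico, nsmul_eq_mul] at this
    have h3 : ((2 * K + 1 - K : ℕ) : ℝ) = K + 1 := by
      rw [show 2 * K + 1 - K = K + 1 by omega]; push_cast; ring
    rw [h3] at this
    refine this.trans (sum_le_sum_of_subset_of_nonneg ?_ fun t _ _ => he0 t)
    intro t ht
    exact mem_range.2 (mem_Ico.1 ht).2
  have h2 := hd (2 * K)
  have h3 := hd0 (2 * K)
  push_cast at h2
  have hxP : 0 ≤ ‖x‖ ^ P := by positivity
  have h4 : ((K : ℝ) + 1) * Q ≤ (K + 1) * (2 * C * ‖x‖ ^ P) := by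
    have : 0 ≤ C * ‖x‖ ^ P := by positivity
    nlinarith
  exact le_of_mul_le_mul_left h4 (by positivity)

end words
end QME

/-- Quantitative mean ergodic inequality for positive operators in the
strong-operator-topology closure of the convex hull of the Lamperti contractions on
`L^p`, `1 < p < 2` (commutative case of Theorem 1.3). -/
theorem quantitative_mean_ergodic_lamperti_positive
    (p : ℝ≥0∞) [Fact (1 ≤ p)] (hp : 1 < p) (hp' : p < 2) :
    ∃ C : ℝ, 0 < C ∧
      ∀ (X : Type) [MeasurableSpace X] (μ : Measure X) [SigmaFinite μ]
        (T : Lp ℂ p μ →L[ℂ] Lp ℂ p μ),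
        IsPositiveOp T →
        -- `T` lies in the SOT-closure of the convex hull of the Lamperti contractions:
        (∀ (m : ℕ) (y : Fin m → Lp ℂ p μ) (ε : ℝ), 0 < ε →
          ∃ S ∈ convexHull ℝ
              {S : Lp ℂ p μ →L[ℂ] Lp ℂ p μ | ‖S‖ ≤ 1 ∧ IsLamperti S},
            ∀ j : Fin m, ‖T (y j) - S (y j)‖ < ε) →
        ∀ (N : ℕ) (n : ℕ → ℕ), StrictMono n → (∀ i, 0 < n i) →
        ∀ x : Lp ℂ p μ,
          eLpNorm
            (fun ω => (∑ i ∈ Finset.range N,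
                ‖(ergAvg T (n i) x) ω - (ergAvg T (n (i + 1)) x) ω‖ ^ 2 : ℝ)
              ^ (1 / 2 : ℝ)) p μ
          ≤ ENNReal.ofReal (C * ‖x‖) := by
  have hpt : p ≠ ⊤ := ne_top_of_lt hp'
  have hP1 : 1 < p.toReal := by
    simpa using (ENNReal.toReal_lt_toReal (by simp) hpt).2 hp
  have hP2 : p.toReal < 2 := by
    simpa using (ENNReal.toReal_lt_toReal hpt (by simp)).2 hp'
  obtain ⟨C, hC, hZ⟩ := QME.Z_bound p.toReal hP1 hP2
  have hP0 : p.toReal ≠ 0 := by linarith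
  refine ⟨(2 * C) ^ (p.toReal)⁻¹, by positivity, ?_⟩
  intro X _ μ _ T _ hT N n hn _ x
  choose S hS hST using fun t : ℕ => hT t (fun j => (T ^ (j : ℕ)) x) (1 / ((t : ℝ) + 1)) (by positivity)
  have hbound : ∀ t, ‖QME.HL N n 0 (fun k => ((S t) ^ k) x)‖ ≤ (2 * C) ^ (p.toReal)⁻¹ * ‖x‖ := by
    intro t
    obtain ⟨κ, _, w, z, hw0, hw, hz, hSz⟩ := mem_convexHull_iff_exists_fintype.1 (hS t)
    have := QME.conv_bound hpt C hC hZ w hw0 hw z hz N n hn.monotone x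
    rw [hSz] at this
    rw [← Real.rpow_le_rpow_iff (norm_nonneg _) (by positivity) (by linarith : 0 < p.toReal)]
    rwa [Real.mul_rpow (by positivity) (by positivity), Real.rpow_inv_rpow (by positivity) hP0]
  have hS1 : ∀ t, ‖S t‖ ≤ 1 := by
    intro t
    have h1 : convexHull ℝ {S : Lp ℂ p μ →L[ℂ] Lp ℂ p μ | ‖S‖ ≤ 1 ∧ IsLamperti S} ⊆
        Metric.closedBall 0 1 :=
      convexHull_min (fun S hS => by simpa using hS.1) (convex_closedBall 0 1)
    simpa using h1 (hS t)
  have hlim : ∀ k : ℕ, Filter.Tendsto (fun t => ((S t) ^ k) x) Filter.atTop (nhds ((T ^ k) x)) := by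
    intro k
    rw [tendsto_iff_norm_sub_tendsto_zero]
    have hle : ∀ t k : ℕ, k ≤ t → ‖((S t) ^ k) x - (T ^ k) x‖ ≤ k * (1 / ((t : ℝ) + 1)) := by
      intro t k
      induction k with
      | zero => intro _; simp
      | succ k ih =>
        intro hk
        have h1 := ih (by omega)
        have h2 := (hST t ⟨k, by omega⟩).le
        simp only at h2
        have h3 : ((S t) ^ (k + 1)) x - (T ^ (k + 1)) x =
            S t (((S t) ^ k) x - (T ^ k) x) - (T ((T ^ k) x) - S t ((T ^ k) x)) := by
          rw [pow_succ', pow_succ', map_sub]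
          change S t ((S t ^ k) x) - T ((T ^ k) x) = _
          abel
        rw [h3]
        have h4 : ‖S t (((S t) ^ k) x - (T ^ k) x)‖ ≤ ‖((S t) ^ k) x - (T ^ k) x‖ :=
          ((S t).le_opNorm _).trans (mul_le_of_le_one_left (norm_nonneg _) (hS1 t))
        refine (norm_sub_le _ _).trans ?_
        rw [Nat.cast_succ]
        linarith
    have hz : Filter.Tendsto (fun t : ℕ => (k : ℝ) * (1 / ((t : ℝ) + 1))) Filter.atTop (nhds 0) := by
      simpa using tendsto_one_div_add_atTop_nhds_zero_nat.const_mul (k : ℝ)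
    refine squeeze_zero' (Filter.Eventually.of_forall fun t => norm_nonneg _) ?_ hz
    filter_upwards [Filter.eventually_ge_atTop k] with t ht using hle t k ht
  have hlim2 : Filter.Tendsto (fun t => ‖QME.HL N n 0 (fun k => ((S t) ^ k) x)‖) Filter.atTop
      (nhds ‖QME.HL N n 0 (fun k => (T ^ k) x)‖) := by
    refine Filter.Tendsto.norm (((QME.HL N n 0).continuous.tendsto _).comp ?_)
    exact tendsto_pi_nhds.2 hlim
  have hfin := le_of_tendsto' hlim2 hbound
  have hae : ∀ᵐ ω ∂μ, ‖((∑ i ∈ Finset.range N,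
      ‖(ergAvg T (n i) x) ω - (ergAvg T (n (i + 1)) x) ω‖ ^ 2 : ℝ) ^ (1 / 2 : ℝ))‖ =
      ‖QME.HL N n 0 (fun k => (T ^ k) x) ω‖ := by
    have h1 : ∀ m, ergAvg T m x = QME.cavL m 0 (fun k => (T ^ k) x) := by
      intro m
      rw [QME.cavL_apply]
      simp [ergAvg]
    have h2 : ∀ᵐ ω ∂μ, ∀ m, ergAvg T m x ω = QME.av m (fun k => (T ^ k) x ω) 0 := by
      refine ae_all_iff.2 fun m => ?_
      rw [h1]
      exact QME.cavL_ae m 0 _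
    filter_upwards [h2, QME.HL_ae N n 0 (fun k => (T ^ k) x)] with ω h2 h3
    simp only [h2]
    rw [QME.Sq] at h3
    rw [← h3, Real.norm_of_nonneg (by positivity), ← Real.sqrt_eq_rpow,
      Real.sqrt_sq (norm_nonneg _)]
  rw [eLpNorm_congr_norm_ae hae, ← Lp.enorm_def]
  rw [← ofReal_norm]
  exact ENNReal.ofReal_le_ofReal hfin
end

section
/- There exists an absolute constant C such that for every N ∈ ℕ, every strictly increasing finite sequence n_0 < n_1 < ⋯ < n_N of positive integers, every f ∈ ℓ^1(ℤ) (complex valued), and every λ > 0, the cardinality of the set { v ∈ ℤ : ( ∑_{i=0}^{N-1} |M_{n_i} f(v) − M_{n_{i+1}} f(v)|^2 )^{1/2} > λ } is at most C ‖f‖_{ℓ^1(ℤ)} / λ. (This is the scalar-valued case of the weak type (1,1) estimate in Theorem 1.6(i).) -/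
open MeasureTheory Finset ENNReal

/-- The one-sided averaging operator on `ℤ`:
`M_n f(v) = (1/(n+1)) ∑_{y=0}^{n} f(v+y)`. -/
noncomputable def avgZ (n : ℕ) (f : ℤ → ℂ) : ℤ → ℂ :=
  fun v => ((n : ℂ) + 1)⁻¹ * ∑ y ∈ Finset.range (n + 1), f (v + (y : ℤ))


noncomputable def QZ (j : ℤ × ℕ) : Finset ℤ := Finset.Ico j.1 (j.1 + (j.2 : ℤ))

lemma mem_QZ (j : ℤ × ℕ) (x : ℤ) : x ∈ QZ j ↔ j.1 ≤ x ∧ x < j.1 + j.2 := by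
  simp [QZ]

lemma cz_decomp (f : ℤ → ℝ) (hf : ∀ x, 0 ≤ f x) (lam : ℝ) : ∀ (M : ℕ) (a : ℤ),
    ∑ x ∈ QZ (a, 2 ^ M), f x ≤ lam * 2 ^ M →
    ∃ J : Finset (ℤ × ℕ),
      (∀ j ∈ J, 0 < j.2 ∧ QZ j ⊆ QZ (a, 2 ^ M) ∧ lam * j.2 < ∑ x ∈ QZ j, f x ∧
        ∑ x ∈ QZ j, f x ≤ 2 * lam * j.2) ∧
      (∀ j ∈ J, ∀ k ∈ J, ∀ x, x ∈ QZ j → x ∈ QZ k → j = k) ∧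
      ∀ x ∈ QZ (a, 2 ^ M), (∀ j ∈ J, x ∉ QZ j) → f x ≤ lam := by
  intro M
  induction M with
  | zero =>
    intro a h
    refine ⟨∅, by simp, by simp, ?_⟩
    intro x hx _
    rw [mem_QZ] at hx
    have hxa : x = a := by simp at hx; omega
    subst hxa
    have hs : QZ (x, 2 ^ 0) = {x} := by
      ext y; rw [mem_QZ]; simp; omega
    rw [hs] at h
    simpa using h
  | succ M ih =>
    intro a h
    have key : ∀ c : ℤ, QZ (c, 2 ^ M) ⊆ QZ (a, 2 ^ (M + 1)) →
      ∃ J : Finset (ℤ × ℕ),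
      (∀ j ∈ J, 0 < j.2 ∧ QZ j ⊆ QZ (c, 2 ^ M) ∧ lam * j.2 < ∑ x ∈ QZ j, f x ∧
        ∑ x ∈ QZ j, f x ≤ 2 * lam * j.2) ∧
      (∀ j ∈ J, ∀ k ∈ J, ∀ x, x ∈ QZ j → x ∈ QZ k → j = k) ∧
      ∀ x ∈ QZ (c, 2 ^ M), (∀ j ∈ J, x ∉ QZ j) → f x ≤ lam := by
      intro c hc
      by_cases hle : ∑ x ∈ QZ (c, 2 ^ M), f x ≤ lam * 2 ^ M
      · exact ih c hle
      · refine ⟨{(c, 2 ^ M)}, ?_, ?_, ?_⟩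
        · intro j hj
          rw [Finset.mem_singleton] at hj
          subst hj
          refine ⟨by positivity, Finset.Subset.refl _, ?_, ?_⟩
          · push_cast; linarith
          · have := Finset.sum_le_sum_of_subset_of_nonneg hc (fun x _ _ => hf x)
            push_cast
            have h' : lam * 2 ^ (M + 1) = 2 * lam * 2 ^ M := by ring
            linarith
        · intro j hj k hk _ _ _
          rw [Finset.mem_singleton] at hj hk
          rw [hj, hk]
        · intro x hx hx'
          exact absurd hx (hx' _ (Finset.mem_singleton_self _))
    have hm : ∀ x, x ∈ QZ (a, 2 ^ (M + 1)) ↔ x ∈ QZ (a, 2 ^ M) ∨ x ∈ QZ (a + 2 ^ M, 2 ^ M) := by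
      intro x
      have : (0 : ℤ) < 2 ^ M := by positivity
      simp only [mem_QZ]
      push_cast
      rw [pow_succ]
      omega
    have hd : ∀ x, x ∈ QZ (a, 2 ^ M) → x ∈ QZ (a + 2 ^ M, 2 ^ M) → False := by
      intro x
      simp only [mem_QZ]
      push_cast
      omega
    obtain ⟨J1, h11, h12, h13⟩ := key a (fun x hx => (hm x).2 (Or.inl hx))
    obtain ⟨J2, h21, h22, h23⟩ := key (a + 2 ^ M) (fun x hx => (hm x).2 (Or.inr hx))
    refine ⟨J1 ∪ J2, ?_, ?_, ?_⟩
    · intro j hj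
      rcases Finset.mem_union.1 hj with hj | hj
      · obtain ⟨p, q, r, s⟩ := h11 j hj
        exact ⟨p, fun x hx => (hm x).2 (Or.inl (q hx)), r, s⟩
      · obtain ⟨p, q, r, s⟩ := h21 j hj
        exact ⟨p, fun x hx => (hm x).2 (Or.inr (q hx)), r, s⟩
    · intro j hj k hk x hxj hxk
      rcases Finset.mem_union.1 hj with hj | hj <;> rcases Finset.mem_union.1 hk with hk | hk
      · exact h12 j hj k hk x hxj hxk
      · exact (hd x ((h11 j hj).2.1 hxj) ((h21 k hk).2.1 hxk)).elim
      · exact (hd x ((h11 k hk).2.1 hxk) ((h21 j hj).2.1 hxj)).elim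
      · exact h22 j hj k hk x hxj hxk
    · intro x hx hx'
      rcases (hm x).1 hx with hx | hx
      · exact h13 x hx (fun j hj => hx' j (Finset.mem_union_left _ hj))
      · exact h23 x hx (fun j hj => hx' j (Finset.mem_union_right _ hj))

/-- The symbol of the averaging operator. -/
noncomputable def mZ (n : ℕ) (z : ℂ) : ℂ := ((n : ℂ) + 1)⁻¹ * ∑ y ∈ Finset.range (n + 1), z ^ y

lemma norm_natc (n : ℕ) : ‖((n : ℂ) + 1)‖ = (n : ℝ) + 1 := by
  have : ((n : ℂ) + 1) = ((n + 1 : ℕ) : ℂ) := by push_cast; rfl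
  rw [this, Complex.norm_natCast]; push_cast; rfl

lemma mZ_le_one (n : ℕ) (z : ℂ) (hz : ‖z‖ = 1) : ‖mZ n z‖ ≤ 1 := by
  rw [mZ, norm_mul, norm_inv, norm_natc]
  have : ‖∑ y ∈ Finset.range (n + 1), z ^ y‖ ≤ (n : ℝ) + 1 := by
    refine (norm_sum_le _ _).trans ?_
    simp [hz]
  rw [inv_mul_le_iff₀ (by positivity)]
  linarith

lemma mZ_le_inv (n : ℕ) (z : ℂ) (hz : ‖z‖ = 1) : ‖mZ n z‖ * ‖z - 1‖ * (n + 1) ≤ 2 := by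
  have h : mZ n z * (z - 1) * ((n : ℂ) + 1) = z ^ (n + 1) - 1 := by
    rw [mZ, ← geom_sum_mul]
    have : ((n : ℂ) + 1) ≠ 0 := Nat.cast_add_one_ne_zero n
    field_simp
  rw [← norm_natc, ← norm_mul, ← norm_mul, h]
  refine (norm_sub_le _ _).trans ?_
  simp [hz]; norm_num

lemma mZ_step (n : ℕ) (z : ℂ) : mZ (n + 1) z - mZ n z = ((n : ℂ) + 2)⁻¹ * (z ^ (n + 1) - mZ n z) := by
  have h1 : ((n : ℂ) + 1) ≠ 0 := Nat.cast_add_one_ne_zero n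
  have h2 : ((n : ℂ) + 2) ≠ 0 := by
    have : ((n : ℂ) + 2) = ((n + 2 : ℕ) : ℂ) := by push_cast; rfl
    rw [this]; exact Nat.cast_ne_zero.2 (by omega)
  rw [mZ, mZ, Finset.sum_range_succ _ (n + 1)]
  push_cast
  have h3 : (n : ℂ) + 1 + 1 = n + 2 := by ring
  rw [h3]
  field_simp
  ring

lemma norm_natc2 (n : ℕ) : ‖((n : ℂ) + 2)‖ = (n : ℝ) + 2 := by
  have : ((n : ℂ) + 2) = ((n + 2 : ℕ) : ℂ) := by push_cast; rfl
  rw [this, Complex.norm_natCast]; push_cast; rfl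

lemma norm_pow_sub_one_le (z : ℂ) (hz : ‖z‖ = 1) (k : ℕ) : ‖z ^ k - 1‖ ≤ k * ‖z - 1‖ := by
  rw [← geom_sum_mul, norm_mul]
  gcongr
  refine (norm_sum_le _ _).trans ?_
  simp [hz]

lemma mZ_step_le (n : ℕ) (z : ℂ) (hz : ‖z‖ = 1) : ‖mZ (n + 1) z - mZ n z‖ ≤ ‖z - 1‖ := by
  have h1 : ((n : ℂ) + 1) ≠ 0 := Nat.cast_add_one_ne_zero n
  rw [mZ_step, norm_mul, norm_inv, norm_natc2, inv_mul_le_iff₀ (by positivity)]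
  have : z ^ (n + 1) - mZ n z = ((n : ℂ) + 1)⁻¹ *
      ∑ y ∈ Finset.range (n + 1), (z ^ (n + 1) - z ^ y) := by
    rw [mZ, Finset.sum_sub_distrib]
    simp
    field_simp
  rw [this, norm_mul, norm_inv, norm_natc, inv_mul_le_iff₀ (by positivity)]
  calc _ ≤ ∑ y ∈ Finset.range (n + 1), ‖z ^ (n + 1) - z ^ y‖ := norm_sum_le _ _
    _ ≤ ∑ y ∈ Finset.range (n + 1), ((n : ℝ) + 2) * ‖z - 1‖ := by
        apply Finset.sum_le_sum
        intro y hy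
        have hy : y ≤ n + 1 := (Finset.mem_range.1 hy).le
        have h : z ^ (n + 1) - z ^ y = z ^ y * (z ^ (n + 1 - y) - 1) := by
          rw [mul_sub, ← pow_add, Nat.add_sub_cancel' hy, mul_one]
        rw [h, norm_mul, norm_pow, hz, one_pow, one_mul]
        refine (norm_pow_sub_one_le z hz _).trans ?_
        gcongr
        have : n + 1 - y ≤ n + 2 := by omega
        exact_mod_cast this
    _ = _ := by simp

lemma mZ_step_le' (n : ℕ) (z : ℂ) (hz : ‖z‖ = 1) : ‖mZ (n + 1) z - mZ n z‖ * (n + 2) ≤ 2 := by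
  rw [mZ_step, norm_mul, norm_inv, norm_natc2]
  have := norm_sub_le (z ^ (n + 1)) (mZ n z)
  have h2 := mZ_le_one n z hz
  rw [norm_pow, hz, one_pow] at this
  field_simp
  linarith

lemma mZ_diff_c (n k : ℕ) (z : ℂ) (hz : ‖z‖ = 1) :
    ‖mZ (n + k) z - mZ n z‖ ≤ k * ‖z - 1‖ := by
  induction k with
  | zero => simp
  | succ k ih =>
    have := norm_sub_le_norm_sub_add_norm_sub (mZ (n + (k + 1)) z) (mZ (n + k) z) (mZ n z)
    have h2 := mZ_step_le (n + k) z hz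
    rw [← add_assoc] at this ⊢
    push_cast
    linarith

lemma mZ_diff_a (n k : ℕ) (z : ℂ) (hz : ‖z‖ = 1) :
    ‖mZ (n + k) z - mZ n z‖ * (n + k + 1) ≤ 2 * k := by
  have h1 : ((n : ℂ) + 1) ≠ 0 := Nat.cast_add_one_ne_zero n
  have h2 : ((n : ℂ) + k + 1) ≠ 0 := by
    have := Nat.cast_add_one_ne_zero (R := ℂ) (n + k)
    push_cast at this
    exact this
  have h : (mZ (n + k) z - mZ n z) * (((n + k : ℕ) : ℂ) + 1) =
      ∑ y ∈ Finset.range k, z ^ (n + 1 + y) - k * mZ n z := by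
    rw [mZ, mZ, show n + k + 1 = n + 1 + k by ring, Finset.sum_range_add]
    push_cast
    field_simp
    ring
  have h3 := norm_natc (n + k)
  push_cast at h3 h
  rw [← h3, ← norm_mul, h]
  refine (norm_sub_le _ _).trans ?_
  have h4 : ‖∑ y ∈ Finset.range k, z ^ (n + 1 + y)‖ ≤ k := by
    refine (norm_sum_le _ _).trans ?_
    simp [hz]
  have h5 : ‖(k : ℂ) * mZ n z‖ ≤ k := by
    rw [norm_mul, Complex.norm_natCast]
    exact mul_le_of_le_one_right (by positivity) (mZ_le_one n z hz)
  linarith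

noncomputable def phiZ (d : ℝ) (n : ℕ) : ℝ := d * (n + 1) / (1 + d * (n + 1))

lemma mZ_sq_diff (n k : ℕ) (z : ℂ) (hz : ‖z‖ = 1) :
    ‖mZ n z - mZ (n + k) z‖ ^ 2 ≤ 32 * (phiZ ‖z - 1‖ (n + k) - phiZ ‖z - 1‖ n) := by
  rw [norm_sub_rev]
  have ha := mZ_diff_a n k z hz
  have hc := mZ_diff_c n k z hz
  have h1 := mZ_le_one n z hz
  have h2 := mZ_le_one (n + k) z hz
  have hb1 := mZ_le_inv n z hz
  have hb2 := mZ_le_inv (n + k) z hz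
  have ht := norm_sub_le (mZ (n + k) z) (mZ n z)
  have hD0 := norm_nonneg (mZ (n + k) z - mZ n z)
  have hn1 := norm_nonneg (mZ (n + k) z)
  have hn0 := norm_nonneg (mZ n z)
  have hd0 := norm_nonneg (z - 1)
  set D := ‖mZ (n + k) z - mZ n z‖
  set d := ‖z - 1‖
  have hn : (0 : ℝ) ≤ n := Nat.cast_nonneg n
  have hk : (0 : ℝ) ≤ k := Nat.cast_nonneg k
  have hphi : phiZ d (n + k) - phiZ d n =
      d * k / ((1 + d * (n + 1)) * (1 + d * (n + k + 1))) := by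
    unfold phiZ
    push_cast
    field_simp
    ring
  rw [hphi]
  push_cast at hb2
  have ha0 : (0 : ℝ) < n + 1 := by positivity
  have hb0 : (0 : ℝ) < n + k + 1 := by positivity
  have hab : (n : ℝ) + 1 ≤ n + k + 1 := by linarith
  generalize (n : ℝ) + 1 = a at *
  generalize (n : ℝ) + k + 1 = b at *
  generalize (k : ℝ) = κ at *
  rw [← mul_div_assoc, le_div_iff₀ (by positivity)]
  have hD2 : D ≤ 2 := by linarith
  have hX : (0 : ℝ) ≤ d * κ := by positivity
  rcases le_total (d * b) 1 with hb | hb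
  · have hda : d * a ≤ 1 := (mul_le_mul_of_nonneg_left hab hd0).trans hb
    have e1 : (1 + d * a) * (1 + d * b) ≤ 2 * 2 := by gcongr <;> linarith
    have e2 : D ^ 2 ≤ 2 * (κ * d) := by nlinarith
    calc D ^ 2 * ((1 + d * a) * (1 + d * b)) ≤ (2 * (κ * d)) * (2 * 2) := by gcongr
      _ ≤ _ := by nlinarith
  · rcases le_total (d * a) 1 with hda | hda
    · have e1 : (1 + d * a) * (1 + d * b) ≤ 2 * (2 * (d * b)) := by gcongr <;> linarith
      have e2 : D ^ 2 * b ≤ 2 * (2 * κ) := by nlinarith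
      calc D ^ 2 * ((1 + d * a) * (1 + d * b)) ≤ D ^ 2 * (2 * (2 * (d * b))) := by gcongr
        _ = 4 * d * (D ^ 2 * b) := by ring
        _ ≤ 4 * d * (2 * (2 * κ)) := by gcongr
        _ ≤ _ := by nlinarith
    · have e1 : (1 + d * a) * (1 + d * b) ≤ (2 * (d * a)) * (2 * (d * b)) := by gcongr <;> linarith
      have e3 : D * (d * a) ≤ 4 := by
        have : ‖mZ (n + k) z‖ * d * a ≤ ‖mZ (n + k) z‖ * d * b := by gcongr
        nlinarith [mul_nonneg hd0 ha0.le]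
      calc D ^ 2 * ((1 + d * a) * (1 + d * b)) ≤ D ^ 2 * ((2 * (d * a)) * (2 * (d * b))) := by gcongr
        _ = 4 * d * ((D * (d * a)) * (D * b)) := by ring
        _ ≤ 4 * d * (4 * (2 * κ)) := by gcongr
        _ = _ := by ring

lemma mZ_sq_sum (N : ℕ) (n : ℕ → ℕ) (hn : StrictMono n) (z : ℂ) (hz : ‖z‖ = 1) :
    ∑ i ∈ Finset.range N, ‖mZ (n i) z - mZ (n (i + 1)) z‖ ^ 2 ≤ 32 := by
  have h : ∀ i ∈ Finset.range N, ‖mZ (n i) z - mZ (n (i + 1)) z‖ ^ 2 ≤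
      32 * (phiZ ‖z - 1‖ (n (i + 1)) - phiZ ‖z - 1‖ (n i)) := by
    intro i _
    obtain ⟨k, hk⟩ := Nat.exists_eq_add_of_le (hn (Nat.lt_succ_self i)).le
    rw [Nat.succ_eq_add_one] at hk
    rw [hk]
    exact mZ_sq_diff _ _ z hz
  refine (Finset.sum_le_sum h).trans ?_
  rw [← Finset.mul_sum, Finset.sum_range_sub (fun i => phiZ ‖z - 1‖ (n i))]
  have h1 : phiZ ‖z - 1‖ (n N) ≤ 1 := by
    unfold phiZ
    rw [div_le_one (by positivity)]
    linarith
  have h2 : 0 ≤ phiZ ‖z - 1‖ (n 0) := by unfold phiZ; positivity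
  linarith



lemma toLp_norm_sq (h : C(AddCircle (1 : ℝ), ℂ)) :
    ‖ContinuousMap.toLp 2 AddCircle.haarAddCircle ℂ h‖ ^ 2 =
      ∫ t, ‖h t‖ ^ 2 ∂AddCircle.haarAddCircle := by
  have h1 := ContinuousMap.inner_toLp (𝕜 := ℂ) (AddCircle.haarAddCircle (T := (1 : ℝ))) h h
  rw [inner_self_eq_norm_sq_to_K] at h1
  have h2 : ∀ t, h t * (starRingEnd ℂ) (h t) = ((‖h t‖ ^ 2 : ℝ) : ℂ) := by
    intro t
    rw [Complex.mul_conj, Complex.normSq_eq_norm_sq]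
  simp_rw [h2] at h1
  rw [integral_complex_ofReal] at h1
  apply Complex.ofReal_injective
  rw [Complex.ofReal_pow]
  exact h1

/-- The trigonometric polynomial whose coefficients are the averages of `g`. -/
noncomputable def trigZ (s : Finset ℤ) (g : ℤ → ℂ) (n : ℕ) : C(AddCircle (1 : ℝ), ℂ) :=
  ∑ y ∈ Finset.range (n + 1), ∑ k ∈ s, (((n : ℂ) + 1)⁻¹ * g k) • fourier (k - (y : ℤ))

noncomputable def trigG (s : Finset ℤ) (g : ℤ → ℂ) : C(AddCircle (1 : ℝ), ℂ) :=
  ∑ k ∈ s, g k • fourier k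

lemma inner_trigZ (s : Finset ℤ) (g : ℤ → ℂ) (hg : ∀ x, x ∉ s → g x = 0) (n : ℕ) (v : ℤ) :
    inner ℂ (fourierLp (T := (1 : ℝ)) 2 v)
      (ContinuousMap.toLp 2 AddCircle.haarAddCircle ℂ (trigZ s g n)) = avgZ n g v := by
  have ho := (orthonormal_iff_ite (𝕜 := ℂ)).1 (orthonormal_fourier (T := (1 : ℝ))) v
  unfold trigZ avgZ
  rw [map_sum, inner_sum, Finset.mul_sum]
  apply Finset.sum_congr rfl
  intro y _
  rw [map_sum, inner_sum]
  have h1 : ∀ k ∈ s, inner ℂ (fourierLp (T := (1 : ℝ)) 2 v)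
      (ContinuousMap.toLp 2 AddCircle.haarAddCircle ℂ
        ((((n : ℂ) + 1)⁻¹ * g k) • fourier (k - (y : ℤ)))) =
      if v + (y : ℤ) = k then ((n : ℂ) + 1)⁻¹ * g k else 0 := by
    intro k _
    rw [map_smul, inner_smul_right]
    have := ho (k - (y : ℤ))
    rw [fourierLp, fourierLp] at this
    rw [fourierLp, this]
    have e : (v = k - (y : ℤ)) ↔ (v + (y : ℤ) = k) := by omega
    simp [e]
  rw [Finset.sum_congr rfl h1, Finset.sum_ite_eq]
  split_ifs with h
  · rfl
  · rw [hg _ h, mul_zero]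

lemma trigG_norm (s : Finset ℤ) (g : ℤ → ℂ) :
    ∫ t, ‖trigG s g t‖ ^ 2 ∂AddCircle.haarAddCircle = ∑ k ∈ s, ‖g k‖ ^ 2 := by
  rw [← toLp_norm_sq]
  have e : ContinuousMap.toLp 2 AddCircle.haarAddCircle ℂ (trigG s g) =
      ∑ k ∈ s, g k • fourierLp (T := (1 : ℝ)) 2 k := by
    unfold trigG
    rw [map_sum]
    apply Finset.sum_congr rfl
    intro k _
    rw [map_smul, fourierLp]
  rw [e]
  have h1 := (orthonormal_fourier (T := (1 : ℝ))).inner_sum g g s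
  rw [inner_self_eq_norm_sq_to_K] at h1
  have h2 : ∀ k, (starRingEnd ℂ) (g k) * g k = ((‖g k‖ ^ 2 : ℝ) : ℂ) := by
    intro k
    rw [mul_comm, Complex.mul_conj, Complex.normSq_eq_norm_sq]
  simp_rw [h2] at h1
  rw [← Complex.ofReal_sum] at h1
  apply Complex.ofReal_injective
  rw [Complex.ofReal_pow]
  exact h1

lemma trigZ_apply (s : Finset ℤ) (g : ℤ → ℂ) (n : ℕ) (t : AddCircle (1 : ℝ)) :
    trigZ s g n t = mZ n (fourier (-1) t) * trigG s g t := by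
  have hp : ∀ y : ℕ, (fourier (-1) t : ℂ) ^ y = fourier (-(y : ℤ)) t := by
    intro y
    induction y with
    | zero => simp
    | succ y ih =>
      rw [pow_succ, ih, ← fourier_add]
      congr 2
      push_cast; ring
  unfold trigZ mZ trigG
  simp only [ContinuousMap.coe_sum, Finset.sum_apply, ContinuousMap.coe_smul, Pi.smul_apply, smul_eq_mul, hp]
  rw [mul_assoc, Finset.sum_mul, Finset.mul_sum]
  apply Finset.sum_congr rfl
  intro y _
  rw [Finset.mul_sum, Finset.mul_sum]
  apply Finset.sum_congr rfl
  intro k _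
  rw [sub_eq_add_neg, fourier_add]
  ring

lemma l2_bound (N : ℕ) (n : ℕ → ℕ) (hn : StrictMono n) (s : Finset ℤ) (g : ℤ → ℂ)
    (hg : ∀ x, x ∉ s → g x = 0) (A : Finset ℤ) :
    ∑ v ∈ A, ∑ i ∈ Finset.range N, ‖avgZ (n i) g v - avgZ (n (i + 1)) g v‖ ^ 2 ≤
      32 * ∑ k ∈ s, ‖g k‖ ^ 2 := by
  rw [Finset.sum_comm]
  have hint : ∀ h : C(AddCircle (1 : ℝ), ℂ), Integrable (fun t => ‖h t‖ ^ 2)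
      AddCircle.haarAddCircle := by
    intro h
    apply Continuous.integrable_of_hasCompactSupport
    · fun_prop
    · exact HasCompactSupport.of_compactSpace _
  have h1 : ∀ i ∈ Finset.range N, ∑ v ∈ A, ‖avgZ (n i) g v - avgZ (n (i + 1)) g v‖ ^ 2 ≤
      ∫ t, ‖(trigZ s g (n i) - trigZ s g (n (i + 1))) t‖ ^ 2 ∂AddCircle.haarAddCircle := by
    intro i _
    rw [← toLp_norm_sq]
    refine le_trans (le_of_eq ?_) ((orthonormal_fourier (T := (1 : ℝ))).sum_inner_products_le
      (s := A) _)
    apply Finset.sum_congr rfl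
    intro v _
    rw [map_sub, inner_sub_right, inner_trigZ s g hg, inner_trigZ s g hg]
  refine (Finset.sum_le_sum h1).trans ?_
  rw [← integral_finsetSum _ (fun i _ => hint _), ← trigG_norm, ← integral_const_mul]
  apply integral_mono
  · exact integrable_finsetSum _ (fun i _ => hint _)
  · exact (hint _).const_mul _
  · intro t
    simp only [ContinuousMap.sub_apply, trigZ_apply, ← sub_mul, norm_mul, mul_pow]
    rw [← Finset.sum_mul]
    gcongr
    apply mZ_sq_sum N n hn
    rw [fourier_apply]
    exact Circle.norm_coe _

lemma card_QZ (j : ℤ × ℕ) : (QZ j).card = j.2 := by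
  simp [QZ]

lemma sum_shift_le (phi : ℤ → ℝ) (h0 : ∀ x, 0 ≤ phi x) (Q : Finset ℤ)
    (hQ : ∀ x, x ∉ Q → phi x = 0) (v : ℤ) (K : ℕ) :
    ∑ m ∈ Finset.range K, phi (v + (m : ℤ)) ≤ ∑ x ∈ Q, phi x := by
  have hinj : Set.InjOn (fun m : ℕ => v + (m : ℤ)) (Finset.range K : Finset ℕ) := by
    intro a _ b _ h
    simpa using h
  rw [← Finset.sum_image (f := phi) hinj]
  calc _ ≤ ∑ x ∈ (Finset.range K).image (fun m : ℕ => v + (m : ℤ)) ∪ Q, phi x :=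
        Finset.sum_le_sum_of_subset_of_nonneg Finset.subset_union_left (fun x _ _ => h0 x)
    _ = _ := by
        symm
        apply Finset.sum_subset Finset.subset_union_right
        intro x _ hx
        exact hQ x hx

lemma avgZ_step (n : ℕ) (b : ℤ → ℂ) (v : ℤ) :
    avgZ (n + 1) b v - avgZ n b v = ((n : ℂ) + 2)⁻¹ * (b (v + 1 + (n : ℤ)) - avgZ n b v) := by
  have h1 : ((n : ℂ) + 1) ≠ 0 := Nat.cast_add_one_ne_zero n
  have h2 : ((n : ℂ) + 2) ≠ 0 := by
    have : ((n : ℂ) + 2) = ((n + 2 : ℕ) : ℂ) := by push_cast; rfl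
    rw [this]; exact Nat.cast_ne_zero.2 (by omega)
  rw [avgZ, avgZ, Finset.sum_range_succ _ (n + 1)]
  push_cast
  have h3 : (n : ℂ) + 1 + 1 = n + 2 := by ring
  have h4 : v + ((n : ℤ) + 1) = v + 1 + n := by ring
  rw [h3, h4]
  field_simp
  ring

lemma avgZ_add (n : ℕ) (f g : ℤ → ℂ) (v : ℤ) :
    avgZ n (fun x => f x + g x) v = avgZ n f v + avgZ n g v := by
  simp only [avgZ, Finset.sum_add_distrib, mul_add]

lemma avgZ_sum (n : ℕ) {ι : Type*} (J : Finset ι) (b : ι → ℤ → ℂ) (v : ℤ) :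
    avgZ n (fun x => ∑ j ∈ J, b j x) v = ∑ j ∈ J, avgZ n (b j) v := by
  simp only [avgZ]
  rw [Finset.sum_comm, Finset.mul_sum]

/-- Averages of an atom at a point outside its interval vanish unless the right endpoint of the
averaging interval lies in the interval of the atom. -/
lemma avgZ_atom_zero (j : ℤ × ℕ) (b : ℤ → ℂ) (hb : ∀ x, x ∉ QZ j → b x = 0)
    (hsum : ∑ x ∈ QZ j, b x = 0) (v : ℤ) (hv : v ∉ QZ j) (n : ℕ) (h : v + (n : ℤ) ∉ QZ j) :
    avgZ n b v = 0 := by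
  rw [mem_QZ] at hv h
  unfold avgZ
  by_cases hc : v < j.1 ∧ j.1 + j.2 ≤ v + n
  · have : ∑ y ∈ Finset.range (n + 1), b (v + (y : ℤ)) = 0 := by
      have hinj : Set.InjOn (fun m : ℕ => v + (m : ℤ)) (Finset.range (n + 1) : Finset ℕ) := by
        intro a _ b _ h
        simpa using h
      rw [← Finset.sum_image (f := b) hinj, ← hsum]
      symm
      apply Finset.sum_subset
      · intro x hx
        rw [mem_QZ] at hx
        rw [Finset.mem_image]
        exact ⟨(x - v).toNat, by rw [Finset.mem_range]; omega, by omega⟩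
      · intro x _ hx
        exact hb x hx
    rw [this, mul_zero]
  · rw [Finset.sum_eq_zero, mul_zero]
    intro y hy
    rw [Finset.mem_range] at hy
    apply hb
    rw [mem_QZ]
    omega

lemma variation_le (N : ℕ) (n : ℕ → ℕ) (hn : StrictMono n) (u : ℕ → ℂ) :
    ∑ i ∈ Finset.range N, ‖u (n i) - u (n (i + 1))‖ ≤
      ∑ k ∈ Finset.range (n N), ‖u (k + 1) - u k‖ := by
  induction N with
  | zero => simp; positivity
  | succ N ih =>
    rw [Finset.sum_range_succ]
    have hle : n N ≤ n (N + 1) := (hn (Nat.lt_succ_self N)).le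
    rw [← Finset.sum_range_add_sum_Ico _ hle]
    have := dist_le_Ico_sum_dist u hle
    simp only [dist_eq_norm] at this
    have e : ∑ i ∈ Finset.Ico (n N) (n (N + 1)), ‖u i - u (i + 1)‖ =
        ∑ i ∈ Finset.Ico (n N) (n (N + 1)), ‖u (i + 1) - u i‖ :=
      Finset.sum_congr rfl (fun i _ => norm_sub_rev _ _)
    linarith

lemma atom_variation (j : ℤ × ℕ) (b : ℤ → ℂ) (hb : ∀ x, x ∉ QZ j → b x = 0)
    (hsum : ∑ x ∈ QZ j, b x = 0) (hj : 0 < j.2) (v : ℤ) (hv : v < j.1 - j.2) (K : ℕ) :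
    ∑ k ∈ Finset.range K, ‖avgZ (k + 1) b v - avgZ k b v‖ ≤
      2 * (∑ x ∈ QZ j, ‖b x‖) / ((j.1 - v : ℤ) : ℝ) := by
  set B := ∑ x ∈ QZ j, ‖b x‖ with hB
  have hB0 : 0 ≤ B := Finset.sum_nonneg (fun _ _ => norm_nonneg _)
  set d : ℝ := ((j.1 - v : ℤ) : ℝ) with hd
  have hdL : (j.2 : ℝ) ≤ d := by
    rw [hd]
    have : (j.2 : ℤ) ≤ j.1 - v := by omega
    exact_mod_cast this
  have hL : (0 : ℝ) < j.2 := by exact_mod_cast hj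
  have hd0 : 0 < d := by linarith
  have hvQ : v ∉ QZ j := by rw [mem_QZ]; omega
  have hstep : ∀ k ∈ Finset.range K, ‖avgZ (k + 1) b v - avgZ k b v‖ ≤
      ‖b (v + 1 + (k : ℤ))‖ / d + (if v + (k : ℤ) ∈ QZ j then B / d ^ 2 else 0) := by
    intro k _
    rw [avgZ_step, norm_mul, norm_inv, norm_natc2]
    have h1 : ((k : ℝ) + 2)⁻¹ * ‖b (v + 1 + (k : ℤ))‖ ≤ ‖b (v + 1 + (k : ℤ))‖ / d := by
      by_cases hk : v + 1 + (k : ℤ) ∈ QZ j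
      · rw [mem_QZ] at hk
        rw [div_eq_inv_mul]
        gcongr
        rw [hd]
        have : j.1 - v ≤ (k : ℤ) + 2 := by omega
        exact_mod_cast this
      · rw [hb _ hk]; simp
    have h2 : ((k : ℝ) + 2)⁻¹ * ‖avgZ k b v‖ ≤ if v + (k : ℤ) ∈ QZ j then B / d ^ 2 else 0 := by
      split_ifs with hk
      · have hk' := hk
        rw [mem_QZ] at hk'
        have hdk : d ≤ k := by
          rw [hd]
          have : j.1 - v ≤ (k : ℤ) := by omega
          exact_mod_cast this
        have hA : ‖avgZ k b v‖ ≤ d⁻¹ * B := by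
          unfold avgZ
          rw [norm_mul, norm_inv, norm_natc]
          gcongr
          · linarith
          · refine (norm_sum_le _ _).trans ?_
            exact sum_shift_le (fun x => ‖b x‖) (fun _ => norm_nonneg _) (QZ j)
              (fun x hx => by simp [hb x hx]) v (k + 1)
        calc ((k : ℝ) + 2)⁻¹ * ‖avgZ k b v‖ ≤ d⁻¹ * (d⁻¹ * B) := by
              gcongr
              linarith
          _ = B / d ^ 2 := by field_simp
      · rw [avgZ_atom_zero j b hb hsum v hvQ k hk]; simp
    calc _ ≤ ((k : ℝ) + 2)⁻¹ * (‖b (v + 1 + (k : ℤ))‖ + ‖avgZ k b v‖) := by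
          gcongr
          exact norm_sub_le _ _
      _ ≤ _ := by rw [mul_add]; linarith
  refine (Finset.sum_le_sum hstep).trans ?_
  rw [Finset.sum_add_distrib, ← Finset.sum_div]
  have s1 := sum_shift_le (fun x => ‖b x‖) (fun _ => norm_nonneg _) (QZ j)
    (fun x hx => by simp [hb x hx]) (v + 1) K
  have s2 := sum_shift_le (fun x => if x ∈ QZ j then B / d ^ 2 else 0)
    (fun x => by split_ifs <;> positivity) (QZ j)
    (fun x hx => by simp [hx]) v K
  have s3 : ∑ x ∈ QZ j, (if x ∈ QZ j then B / d ^ 2 else 0) = j.2 * (B / d ^ 2) := by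
    rw [Finset.sum_congr rfl (fun x hx => if_pos hx), Finset.sum_const, card_QZ, nsmul_eq_mul]
  have s4 : j.2 * (B / d ^ 2) ≤ d * (B / d ^ 2) := by gcongr
  have s5 : d * (B / d ^ 2) = B / d := by field_simp
  have s6 : (∑ k ∈ Finset.range K, ‖b (v + 1 + (k : ℤ))‖) / d ≤ B / d := by gcongr
  have s7 : 2 * B / d = B / d + B / d := by ring
  rw [s3] at s2
  linarith

lemma atom_sq (N : ℕ) (n : ℕ → ℕ) (hn : StrictMono n) (j : ℤ × ℕ) (b : ℤ → ℂ)
    (hb : ∀ x, x ∉ QZ j → b x = 0)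
    (hsum : ∑ x ∈ QZ j, b x = 0) (hj : 0 < j.2) (v : ℤ) (hv : v < j.1 - j.2) :
    ∑ i ∈ Finset.range N, ‖avgZ (n i) b v - avgZ (n (i + 1)) b v‖ ^ 2 ≤
      4 * (∑ x ∈ QZ j, ‖b x‖) ^ 2 * ((((j.1 - v).toNat : ℝ)) ^ 2)⁻¹ := by
  have h1 := (variation_le N n hn (fun k => avgZ k b v)).trans
    (atom_variation j b hb hsum hj v hv (n N))
  have h2 : ((j.1 - v : ℤ) : ℝ) = ((j.1 - v).toNat : ℝ) := by
    have : ((j.1 - v).toNat : ℤ) = j.1 - v := Int.toNat_of_nonneg (by omega)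
    exact_mod_cast congrArg (fun q : ℤ => (q : ℝ)) this.symm
  rw [h2] at h1
  have h3 : ∑ i ∈ Finset.range N, ‖avgZ (n i) b v - avgZ (n (i + 1)) b v‖ ^ 2 ≤
      (∑ i ∈ Finset.range N, ‖avgZ (n i) b v - avgZ (n (i + 1)) b v‖) ^ 2 :=
    Finset.sum_sq_le_sq_sum_of_nonneg (fun _ _ => norm_nonneg _)
  refine h3.trans ?_
  have h4 := pow_le_pow_left₀ (Finset.sum_nonneg (fun _ _ => norm_nonneg _)) h1 2
  refine h4.trans (le_of_eq ?_)
  rw [div_pow, mul_pow, div_eq_mul_inv]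
  norm_num

lemma sum_inv_sq (a : ℤ) (L : ℕ) (hL : 0 < L) (A : Finset ℤ) (hA : ∀ v ∈ A, v < a - L) :
    ∑ v ∈ A, (((a - v).toNat : ℝ) ^ 2)⁻¹ ≤ (L : ℝ)⁻¹ := by
  have hinj : Set.InjOn (fun v : ℤ => (a - v).toNat) (A : Finset ℤ) := by
    intro x hx y hy h
    have h1 := hA x hx
    have h2 := hA y hy
    dsimp only at h
    omega
  rw [← Finset.sum_image (f := fun m : ℕ => ((m : ℝ) ^ 2)⁻¹) hinj]
  set T := A.image (fun v : ℤ => (a - v).toNat)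
  have hsub : T ⊆ Finset.Ioc L (T.sup id + L) := by
    intro m hm
    have h1 : m ≤ T.sup id := Finset.le_sup (f := id) hm
    obtain ⟨v, hv, rfl⟩ := Finset.mem_image.1 hm
    have := hA v hv
    rw [Finset.mem_Ioc]
    omega
  calc _ ≤ ∑ m ∈ Finset.Ioc L (T.sup id + L), ((m : ℝ) ^ 2)⁻¹ :=
        Finset.sum_le_sum_of_subset_of_nonneg hsub (fun _ _ _ => by positivity)
    _ ≤ (L : ℝ)⁻¹ - ((T.sup id + L : ℕ) : ℝ)⁻¹ :=
        sum_Ioc_inv_sq_le_sub (by omega) (by omega)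
    _ ≤ _ := by
        have : (0 : ℝ) ≤ ((T.sup id + L : ℕ) : ℝ)⁻¹ := by positivity
        linarith

lemma atom_total (N : ℕ) (n : ℕ → ℕ) (hn : StrictMono n) (j : ℤ × ℕ) (b : ℤ → ℂ)
    (hb : ∀ x, x ∉ QZ j → b x = 0)
    (hsum : ∑ x ∈ QZ j, b x = 0) (hj : 0 < j.2) (A : Finset ℤ)
    (hA : ∀ v ∈ A, v < j.1 - j.2 ∨ j.1 + j.2 ≤ v) :
    ∑ v ∈ A, ∑ i ∈ Finset.range N, ‖avgZ (n i) b v - avgZ (n (i + 1)) b v‖ ^ 2 ≤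
      4 * (∑ x ∈ QZ j, ‖b x‖) ^ 2 * (j.2 : ℝ)⁻¹ := by
  rw [← Finset.sum_filter_add_sum_filter_not A (fun v => v < j.1 - j.2)]
  have h2 : ∑ v ∈ A with ¬ (v < j.1 - j.2), ∑ i ∈ Finset.range N,
      ‖avgZ (n i) b v - avgZ (n (i + 1)) b v‖ ^ 2 = 0 := by
    apply Finset.sum_eq_zero
    intro v hv
    rw [Finset.mem_filter] at hv
    have := hA v hv.1
    have hz : ∀ k : ℕ, avgZ k b v = 0 := by
      intro k
      apply avgZ_atom_zero j b hb hsum v <;> rw [mem_QZ] <;> omega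
    simp [hz]
  rw [h2, add_zero]
  calc _ ≤ ∑ v ∈ A with v < j.1 - j.2,
        4 * (∑ x ∈ QZ j, ‖b x‖) ^ 2 * ((((j.1 - v).toNat : ℝ)) ^ 2)⁻¹ := by
        apply Finset.sum_le_sum
        intro v hv
        rw [Finset.mem_filter] at hv
        exact atom_sq N n hn j b hb hsum hj v hv.2
    _ ≤ _ := by
        rw [← Finset.mul_sum]
        gcongr
        apply sum_inv_sq _ _ hj
        intro v hv
        exact (Finset.mem_filter.1 hv).2

lemma two_piece {ι : Type*} [DecidableEq ι] (J : Finset ι) (x y : ι → ℂ)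
    (hx : ∀ j ∈ J, ∀ k ∈ J, x j ≠ 0 → x k ≠ 0 → j = k)
    (hy : ∀ j ∈ J, ∀ k ∈ J, y j ≠ 0 → y k ≠ 0 → j = k) :
    ‖∑ j ∈ J, x j - ∑ j ∈ J, y j‖ ^ 2 ≤ 2 * ∑ j ∈ J, ‖x j - y j‖ ^ 2 := by
  set T := J.filter (fun j => x j ≠ 0) ∪ J.filter (fun j => y j ≠ 0) with hT
  have hTJ : T ⊆ J := by
    rw [hT]
    exact Finset.union_subset (Finset.filter_subset _ _) (Finset.filter_subset _ _)
  have hcard : T.card ≤ 2 := by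
    refine (Finset.card_union_le _ _).trans ?_
    have h1 : (J.filter (fun j => x j ≠ 0)).card ≤ 1 := by
      rw [Finset.card_le_one]
      intro a ha b hb
      rw [Finset.mem_filter] at ha hb
      exact hx a ha.1 b hb.1 ha.2 hb.2
    have h2 : (J.filter (fun j => y j ≠ 0)).card ≤ 1 := by
      rw [Finset.card_le_one]
      intro a ha b hb
      rw [Finset.mem_filter] at ha hb
      exact hy a ha.1 b hb.1 ha.2 hb.2
    omega
  have hsum : ∑ j ∈ J, x j - ∑ j ∈ J, y j = ∑ j ∈ T, (x j - y j) := by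
    rw [← Finset.sum_sub_distrib]
    symm
    apply Finset.sum_subset hTJ
    intro j hj hjT
    simp only [hT, Finset.mem_union, Finset.mem_filter, not_or, not_and, not_not] at hjT
    rw [hjT.1 hj, hjT.2 hj, sub_zero]
  rw [hsum]
  have hcr : (T.card : ℝ) ≤ 2 := by exact_mod_cast hcard
  calc _ ≤ (∑ j ∈ T, ‖x j - y j‖) ^ 2 := by
        gcongr
        exact norm_sum_le _ _
    _ ≤ T.card * ∑ j ∈ T, ‖x j - y j‖ ^ 2 := sq_sum_le_card_mul_sum_sq
    _ ≤ 2 * ∑ j ∈ J, ‖x j - y j‖ ^ 2 := by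
        gcongr

lemma exists_big (R : ℕ) (F lam : ℝ) (hlam : 0 < lam) :
    ∃ M : ℕ, 2 * R + 1 ≤ 2 ^ M ∧ F ≤ lam * 2 ^ M := by
  obtain ⟨M, hM⟩ := pow_unbounded_of_one_lt (max ((2 * R + 1 : ℕ) : ℝ) (F / lam))
    (by norm_num : (1 : ℝ) < 2)
  refine ⟨M, ?_, ?_⟩
  · have := (le_max_left _ _).trans hM.le
    exact_mod_cast this
  · have := (le_max_right _ _).trans hM.le
    rw [div_le_iff₀ hlam] at this
    linarith

lemma weak_fin (N : ℕ) (n : ℕ → ℕ) (hn : StrictMono n) (s : Finset ℤ) (f : ℤ → ℂ)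
    (hf : ∀ x, x ∉ s → f x = 0) (lam : ℝ) (hlam : 0 < lam) (A : Finset ℤ)
    (hA : ∀ v ∈ A, lam ^ 2 <
      ∑ i ∈ Finset.range N, ‖avgZ (n i) f v - avgZ (n (i + 1)) f v‖ ^ 2) :
    (A.card : ℝ) * lam ≤ 1000 * ∑ x ∈ s, ‖f x‖ := by
  classical
  set F := ∑ x ∈ s, ‖f x‖ with hF
  obtain ⟨M, hM1, hM2⟩ := exists_big (s.sup Int.natAbs) F lam hlam
  set I := QZ (-((s.sup Int.natAbs : ℕ) : ℤ), 2 ^ M) with hI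
  have hsI : s ⊆ I := by
    intro x hx
    have h1 : x.natAbs ≤ s.sup Int.natAbs := Finset.le_sup (f := Int.natAbs) hx
    rw [hI, mem_QZ]
    dsimp only
    omega
  have hfI : ∀ x, x ∉ I → f x = 0 := fun x hx => hf x (fun h => hx (hsI h))
  have hFI : ∑ x ∈ I, ‖f x‖ = F := by
    rw [hF]
    symm
    apply Finset.sum_subset hsI
    intro x _ hx
    rw [hf x hx, norm_zero]
  obtain ⟨J, hJ1, hJ2, hJ3⟩ := cz_decomp (fun x => ‖f x‖) (fun _ => norm_nonneg _) lam M
    (-((s.sup Int.natAbs : ℕ) : ℤ)) (by rw [← hI, hFI]; exact hM2)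
  rw [← hI] at hJ1 hJ3
  have hF0 : 0 ≤ F := Finset.sum_nonneg (fun _ _ => norm_nonneg _)
  -- total mass of the selected intervals
  have hmass : ∑ j ∈ J, ∑ x ∈ QZ j, ‖f x‖ ≤ F := by
    rw [← Finset.sum_biUnion, ← hFI]
    · apply Finset.sum_le_sum_of_subset_of_nonneg
      · exact Finset.biUnion_subset.2 (fun j hj => (hJ1 j hj).2.1)
      · exact fun _ _ _ => norm_nonneg _
    · intro j hj k hk hjk
      exact Finset.disjoint_left.2 (fun x hxj hxk => hjk (hJ2 j hj k hk x hxj hxk))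
  have hL0 : ∀ j ∈ J, (0 : ℝ) < j.2 := fun j hj => by exact_mod_cast (hJ1 j hj).1
  have hlen : lam * ∑ j ∈ J, (j.2 : ℝ) ≤ F := by
    rw [Finset.mul_sum]
    exact (Finset.sum_le_sum (fun j hj => (hJ1 j hj).2.2.1.le)).trans hmass
  -- the decomposition
  let av : ℤ × ℕ → ℂ := fun j => (j.2 : ℂ)⁻¹ * ∑ x ∈ QZ j, f x
  let b : ℤ × ℕ → ℤ → ℂ := fun j x => if x ∈ QZ j then f x - av j else 0
  let g : ℤ → ℂ := fun x => f x - ∑ j ∈ J, b j x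
  have hav : ∀ j ∈ J, (j.2 : ℝ) * ‖av j‖ ≤ ∑ x ∈ QZ j, ‖f x‖ := by
    intro j hj
    have h0 := hL0 j hj
    have e : (j.2 : ℝ) * ‖av j‖ = ‖∑ x ∈ QZ j, f x‖ := by
      simp only [av]
      rw [norm_mul, norm_inv, Complex.norm_natCast]
      field_simp
    rw [e]
    exact norm_sum_le _ _
  have hb0 : ∀ j, ∀ x, x ∉ QZ j → b j x = 0 := fun j x hx => if_neg hx
  have hb1 : ∀ j ∈ J, ∑ x ∈ QZ j, b j x = 0 := by
    intro j hj
    have h0 : (j.2 : ℂ) ≠ 0 := by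
      have := (hJ1 j hj).1
      exact_mod_cast this.ne'
    have e : ∑ x ∈ QZ j, b j x = ∑ x ∈ QZ j, (f x - av j) :=
      Finset.sum_congr rfl (fun x hx => if_pos hx)
    rw [e, Finset.sum_sub_distrib, Finset.sum_const, card_QZ, nsmul_eq_mul]
    simp only [av]
    field_simp
    simp
  have hbB : ∀ j ∈ J, ∑ x ∈ QZ j, ‖b j x‖ ≤ 2 * ∑ x ∈ QZ j, ‖f x‖ := by
    intro j hj
    calc ∑ x ∈ QZ j, ‖b j x‖ ≤ ∑ x ∈ QZ j, (‖f x‖ + ‖av j‖) := by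
          apply Finset.sum_le_sum
          intro x hx
          have e : b j x = f x - av j := if_pos hx
          rw [e]
          exact norm_sub_le _ _
      _ = ∑ x ∈ QZ j, ‖f x‖ + j.2 * ‖av j‖ := by
          rw [Finset.sum_add_distrib, Finset.sum_const, card_QZ, nsmul_eq_mul]
      _ ≤ _ := by linarith [hav j hj]
  have hgI : ∀ x, x ∉ I → g x = 0 := by
    intro x hx
    simp only [g]
    rw [hfI x hx, Finset.sum_eq_zero, sub_zero]
    intro j hj
    exact hb0 j x (fun h => hx ((hJ1 j hj).2.1 h))
  have hgle : ∀ x, ‖g x‖ ≤ 2 * lam := by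
    intro x
    by_cases hx : ∃ j ∈ J, x ∈ QZ j
    · obtain ⟨j, hj, hxj⟩ := hx
      have e : ∑ k ∈ J, b k x = b j x := by
        apply Finset.sum_eq_single_of_mem j hj
        intro k hk hkj
        exact hb0 k x (fun h => hkj (hJ2 k hk j hj x h hxj))
      have e2 : b j x = f x - av j := if_pos hxj
      have e3 : g x = av j := by
        simp only [g]
        rw [e, e2]
        ring
      rw [e3]
      have h1 := (hav j hj).trans (hJ1 j hj).2.2.2
      have h0 := hL0 j hj
      by_contra hcon
      push Not at hcon
      nlinarith
    · push Not at hx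
      have e : g x = f x := by
        simp only [g]
        rw [Finset.sum_eq_zero, sub_zero]
        exact fun j hj => hb0 j x (hx j hj)
      rw [e]
      by_cases hxI : x ∈ I
      · have := hJ3 x hxI hx
        linarith
      · rw [hfI x hxI, norm_zero]; positivity
  have hg1 : ∑ x ∈ I, ‖g x‖ ≤ 3 * F := by
    calc ∑ x ∈ I, ‖g x‖ ≤ ∑ x ∈ I, (‖f x‖ + ∑ j ∈ J, ‖b j x‖) := by
          apply Finset.sum_le_sum
          intro x _
          refine (norm_sub_le _ _).trans ?_
          gcongr
          exact norm_sum_le _ _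
      _ = F + ∑ j ∈ J, ∑ x ∈ I, ‖b j x‖ := by
          rw [Finset.sum_add_distrib, hFI, Finset.sum_comm]
      _ = F + ∑ j ∈ J, ∑ x ∈ QZ j, ‖b j x‖ := by
          congr 1
          apply Finset.sum_congr rfl
          intro j hj
          symm
          apply Finset.sum_subset (hJ1 j hj).2.1
          intro x _ hx
          rw [hb0 j x hx, norm_zero]
      _ ≤ F + ∑ j ∈ J, 2 * ∑ x ∈ QZ j, ‖f x‖ := by
          gcongr with j hj
          exact hbB j hj
      _ ≤ 3 * F := by
          rw [← Finset.mul_sum]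
          linarith
  have hg2 : ∑ x ∈ I, ‖g x‖ ^ 2 ≤ 6 * lam * F := by
    calc ∑ x ∈ I, ‖g x‖ ^ 2 ≤ ∑ x ∈ I, (2 * lam) * ‖g x‖ := by
          apply Finset.sum_le_sum
          intro x _
          rw [sq]
          gcongr
          exact hgle x
      _ ≤ _ := by
          rw [← Finset.mul_sum]
          nlinarith
  -- the exceptional set
  set E := J.biUnion (fun j => Finset.Ico (j.1 - (j.2 : ℤ)) (j.1 + (j.2 : ℤ))) with hE
  have hEcard : lam * (E.card : ℝ) ≤ 2 * F := by
    have h1 : E.card ≤ ∑ j ∈ J, 2 * j.2 := by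
      refine Finset.card_biUnion_le.trans (Finset.sum_le_sum ?_)
      intro j _
      rw [Int.card_Ico]
      omega
    have h2 : (E.card : ℝ) ≤ 2 * ∑ j ∈ J, (j.2 : ℝ) := by
      have : (E.card : ℝ) ≤ ((∑ j ∈ J, 2 * j.2 : ℕ) : ℝ) := by exact_mod_cast h1
      push_cast at this
      rwa [← Finset.mul_sum] at this
    nlinarith
  have hA' : ∀ j ∈ J, ∀ v ∈ A \ E, v < j.1 - j.2 ∨ j.1 + j.2 ≤ v := by
    intro j hj v hv
    rw [Finset.mem_sdiff] at hv
    by_contra hcon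
    apply hv.2
    rw [hE, Finset.mem_biUnion]
    refine ⟨j, hj, ?_⟩
    rw [Finset.mem_Ico]
    omega
  have hpt : ∀ v ∈ A \ E, lam ^ 2 ≤
      2 * ∑ i ∈ Finset.range N, ‖avgZ (n i) g v - avgZ (n (i + 1)) g v‖ ^ 2 +
      4 * ∑ j ∈ J, ∑ i ∈ Finset.range N,
        ‖avgZ (n i) (b j) v - avgZ (n (i + 1)) (b j) v‖ ^ 2 := by
    intro v hv
    refine (hA v (Finset.mem_sdiff.1 hv).1).le.trans ?_
    rw [Finset.sum_comm, Finset.mul_sum, Finset.mul_sum, ← Finset.sum_add_distrib]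
    apply Finset.sum_le_sum
    intro i _
    have hfd : ∀ m, avgZ m f v = avgZ m g v + ∑ j ∈ J, avgZ m (b j) v := by
      intro m
      rw [← avgZ_sum, ← avgZ_add]
      congr 1
      funext x
      simp only [g]
      ring
    have huniq : ∀ m : ℕ, ∀ j ∈ J, ∀ k ∈ J, avgZ m (b j) v ≠ 0 → avgZ m (b k) v ≠ 0 → j = k := by
      intro m j hj k hk h1 h2
      have hz : ∀ l ∈ J, avgZ m (b l) v ≠ 0 → v + (m : ℤ) ∈ QZ l := by
        intro l hl h
        by_contra hcon
        apply h
        apply avgZ_atom_zero l (b l) (hb0 l) (hb1 l hl) v _ m hcon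
        have := hA' l hl v hv
        rw [mem_QZ]
        omega
      exact hJ2 j hj k hk _ (hz j hj h1) (hz k hk h2)
    have h2 := two_piece J (fun j => avgZ (n i) (b j) v) (fun j => avgZ (n (i + 1)) (b j) v)
      (huniq _) (huniq _)
    rw [hfd, hfd, add_sub_add_comm]
    set X := avgZ (n i) g v - avgZ (n (i + 1)) g v
    set Y := ∑ j ∈ J, avgZ (n i) (b j) v - ∑ j ∈ J, avgZ (n (i + 1)) (b j) v
    have h3 := norm_add_le X Y
    have h4 : ‖X + Y‖ ^ 2 ≤ (‖X‖ + ‖Y‖) ^ 2 := by gcongr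
    nlinarith [sq_nonneg (‖X‖ - ‖Y‖)]
  have hsum := Finset.sum_le_sum hpt
  rw [Finset.sum_const, nsmul_eq_mul, Finset.sum_add_distrib, ← Finset.mul_sum, ← Finset.mul_sum]
    at hsum
  have hgood := l2_bound N n hn I g hgI (A \ E)
  have hbad : ∑ v ∈ A \ E, ∑ j ∈ J, ∑ i ∈ Finset.range N,
      ‖avgZ (n i) (b j) v - avgZ (n (i + 1)) (b j) v‖ ^ 2 ≤ 32 * lam * F := by
    rw [Finset.sum_comm]
    calc _ ≤ ∑ j ∈ J, 32 * lam * ∑ x ∈ QZ j, ‖f x‖ := by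
          apply Finset.sum_le_sum
          intro j hj
          refine (atom_total N n hn j (b j) (hb0 j) (hb1 j hj) (hJ1 j hj).1 (A \ E)
            (hA' j hj)).trans ?_
          have h1 := hbB j hj
          have h2 := (hJ1 j hj).2.2.2
          have h0 := hL0 j hj
          have h3 : 0 ≤ ∑ x ∈ QZ j, ‖b j x‖ := Finset.sum_nonneg (fun _ _ => norm_nonneg _)
          have h4 : 0 ≤ ∑ x ∈ QZ j, ‖f x‖ := Finset.sum_nonneg (fun _ _ => norm_nonneg _)
          rw [← div_eq_mul_inv, div_le_iff₀ h0]
          calc 4 * (∑ x ∈ QZ j, ‖b j x‖) ^ 2 ≤ 4 * (2 * ∑ x ∈ QZ j, ‖f x‖) ^ 2 := by gcongr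
            _ = 16 * (∑ x ∈ QZ j, ‖f x‖) * (∑ x ∈ QZ j, ‖f x‖) := by ring
            _ ≤ 16 * (∑ x ∈ QZ j, ‖f x‖) * (2 * lam * j.2) := by gcongr
            _ = _ := by ring
      _ ≤ _ := by
          rw [← Finset.mul_sum]
          gcongr
  have hfin : ((A \ E).card : ℝ) * lam ≤ 512 * F := by
    have h1 : ((A \ E).card : ℝ) * lam ^ 2 ≤ 512 * F * lam := by nlinarith
    by_contra hcon
    push Not at hcon
    nlinarith
  have hcard : (A.card : ℝ) ≤ (A \ E).card + E.card := by
    have : A.card ≤ (A \ E).card + E.card := by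
      have := Finset.le_card_sdiff E A
      omega
    exact_mod_cast this
  nlinarith

/-- Scalar-valued weak type `(1,1)` estimate for the square function of the one-sided
averaging operators on `ℤ` (scalar case of Theorem 1.6(i)): the number of points where
the square function exceeds `λ` is at most `C ‖f‖₁ / λ`. -/
theorem square_function_weak_type_one_one_Z :
    ∃ C : ℝ, 0 < C ∧
      ∀ (N : ℕ) (n : ℕ → ℕ), StrictMono n → (∀ i, 0 < n i) →
      ∀ f : ℤ → ℂ, Summable (fun v => ‖f v‖) →
      ∀ lam : ℝ, 0 < lam →
        (Measure.count : Measure ℤ)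
            {v : ℤ | lam < (∑ i ∈ Finset.range N,
                ‖avgZ (n i) f v - avgZ (n (i + 1)) f v‖ ^ 2 : ℝ) ^ (1 / 2 : ℝ)}
          ≤ ENNReal.ofReal (C * (∑' v : ℤ, ‖f v‖) / lam) := by
  classical
  refine ⟨1000, by norm_num, ?_⟩
  intro N n hn _ f hf lam hlam
  set S := {v : ℤ | lam < (∑ i ∈ Finset.range N,
                ‖avgZ (n i) f v - avgZ (n (i + 1)) f v‖ ^ 2 : ℝ) ^ (1 / 2 : ℝ)} with hS
  have key : ∀ A : Finset ℤ, (A : Set ℤ) ⊆ S →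
      (A.card : ℝ) ≤ 1000 * (∑' v : ℤ, ‖f v‖) / lam := by
    intro A hAS
    set s : Finset ℤ := A.biUnion (fun v => (Finset.range (n N + 1)).image
      (fun y : ℕ => v + (y : ℤ))) with hs
    let f' : ℤ → ℂ := fun x => if x ∈ s then f x else 0
    have hav : ∀ v ∈ A, ∀ i ≤ N, avgZ (n i) f' v = avgZ (n i) f v := by
      intro v hv i hi
      unfold avgZ
      congr 1
      apply Finset.sum_congr rfl
      intro y hy
      apply if_pos
      rw [hs, Finset.mem_biUnion]
      refine ⟨v, hv, Finset.mem_image.2 ⟨y, ?_, rfl⟩⟩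
      have := hn.monotone hi
      rw [Finset.mem_range] at hy ⊢
      omega
    have h1 := weak_fin N n hn s f' (fun x hx => if_neg hx) lam hlam A (by
      intro v hv
      have h2 : lam < _ := hAS hv
      rw [← Real.sqrt_eq_rpow, Real.lt_sqrt hlam.le] at h2
      refine h2.trans_le (le_of_eq ?_)
      apply Finset.sum_congr rfl
      intro i hi
      rw [Finset.mem_range] at hi
      rw [hav v hv i hi.le, hav v hv (i + 1) hi])
    have h3 : ∑ x ∈ s, ‖f' x‖ ≤ ∑' v : ℤ, ‖f v‖ := by
      have : ∑ x ∈ s, ‖f' x‖ = ∑ x ∈ s, ‖f x‖ :=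
        Finset.sum_congr rfl (fun x hx => by simp only [f']; rw [if_pos hx])
      rw [this]
      exact hf.sum_le_tsum s (fun _ _ => norm_nonneg _)
    rw [le_div_iff₀ hlam]
    linarith
  set K := 1000 * (∑' v : ℤ, ‖f v‖) / lam
  have hfin : S.Finite := by
    by_contra hinf
    obtain ⟨A, hA1, hA2⟩ := (Set.Infinite.exists_subset_card_eq hinf (⌊K⌋₊ + 1))
    have h1 := key A hA1
    rw [hA2] at h1
    have := Nat.lt_floor_add_one K
    push_cast at h1
    linarith
  rw [Measure.count_apply_finite S hfin]
  rw [← ENNReal.ofReal_natCast]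
  apply ENNReal.ofReal_le_ofReal
  apply key
  rw [hfin.coe_toFinset]
end

section
/- (Commutative case of Proposition 1.7, 1 < p < 2.) Let (X, μ) be a σ-finite measure space, 1 < p < 2, and let T : L^p(X, μ) → L^p(X, μ) be a linear isometry. Then for every N ∈ ℕ and every finite sequence x_1, …, x_N ∈ L^p(X, μ): ‖ ( ∑_{n=1}^{N} |T x_n|^2 )^{1/2} ‖_{L^p(X,μ)} ≤ ‖ ( ∑_{n=1}^{N} |x_n|^2 )^{1/2} ‖_{L^p(X,μ)}. If moreover T is positive (it maps μ-a.e. nonnegative functions to μ-a.e. nonnegative functions), then equality holds for all finite sequences, i.e. T extends to an isometry of L^p(X; ℓ^2). -/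
open MeasureTheory Finset ENNReal
open scoped ComplexOrder

namespace SqFn

open MeasureTheory Finset ENNReal

abbrev EN (N : ℕ) := EuclideanSpace ℂ (Fin N)

/-- Lebesgue measure on the unit ball. -/
noncomputable def nu (N : ℕ) : Measure (EN N) :=
  (Measure.addHaar : Measure (EN N)).restrict (Metric.ball 0 1)

instance (N : ℕ) : IsFiniteMeasure (nu N) := by
  unfold nu
  exact ⟨by rw [Measure.restrict_apply_univ]; exact measure_ball_lt_top⟩

lemma map_haar {N : ℕ} (U : EN N ≃ₗᵢ[ℂ] EN N) :
    Measure.map U (Measure.addHaar : Measure (EN N)) = Measure.addHaar := by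
  have h1 : (Measure.map U (Measure.addHaar : Measure (EN N))).IsAddHaarMeasure :=
    ContinuousLinearEquiv.isAddHaarMeasure_map (U.toContinuousLinearEquiv) _
  have h2 := Measure.isAddLeftInvariant_eq_smul (Measure.map U (Measure.addHaar : Measure (EN N)))
    Measure.addHaar
  set c := Measure.addHaarScalarFactor (Measure.map U (Measure.addHaar : Measure (EN N)))
    Measure.addHaar
  have h3 : Measure.map U (Measure.addHaar : Measure (EN N)) (Metric.ball 0 1)
      = Measure.addHaar (Metric.ball (0 : EN N) 1) := by
    rw [Measure.map_apply U.continuous.measurable measurableSet_ball]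
    congr 1
    ext x
    simp
  have hb0 : Measure.addHaar (Metric.ball (0 : EN N) 1) ≠ 0 :=
    (Metric.measure_ball_pos _ _ one_pos).ne'
  have hbt : Measure.addHaar (Metric.ball (0 : EN N) 1) ≠ ∞ := measure_ball_lt_top.ne
  rw [h2] at h3
  have hc : (c : ℝ≥0∞) = 1 := by
    have h4 : (c : ℝ≥0∞) * Measure.addHaar (Metric.ball (0 : EN N) 1)
      = 1 * Measure.addHaar (Metric.ball (0 : EN N) 1) := by
      simpa using h3
    exact (ENNReal.mul_left_inj hb0 hbt).1 h4
  rw [h2]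
  have : c = 1 := by exact_mod_cast hc
  rw [this, one_smul]

lemma map_nu {N : ℕ} (U : EN N ≃ₗᵢ[ℂ] EN N) : MeasurePreserving U (nu N) (nu N) := by
  have h : MeasurePreserving U (Measure.addHaar : Measure (EN N)) Measure.addHaar :=
    ⟨U.continuous.measurable, map_haar U⟩
  have := h.restrict_preimage (s := Metric.ball (0 : EN N) 1) measurableSet_ball
  have e : U ⁻¹' (Metric.ball (0 : EN N) 1) = Metric.ball 0 1 := by ext x; simp
  rw [e] at this
  exact this

/-- the constant -/
noncomputable def cst (N : ℕ) (q : ℝ) : ℝ≥0∞ := ∫⁻ g, ‖g (0 : Fin (N+1))‖ₑ ^ q ∂(nu (N+1))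

lemma cst_ne_top (N : ℕ) (q : ℝ) (hq : 0 < q) : cst N q ≠ ∞ := by
  have : cst N q ≤ ∫⁻ g, 1 ∂(nu (N+1)) := by
    unfold cst nu
    apply setLIntegral_mono measurable_const
    intro g hg
    have h1 : ‖g (0 : Fin (N+1))‖ ≤ 1 :=
      (PiLp.norm_apply_le g 0).trans (by simpa using (mem_ball_zero_iff.1 hg).le)
    have : ‖g (0 : Fin (N+1))‖ₑ ≤ 1 := by
      rw [← ofReal_norm]; exact ENNReal.ofReal_le_one.2 h1
    exact ENNReal.rpow_le_one this hq.le
  refine ne_top_of_le_ne_top ?_ this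
  simp

lemma cst_ne_zero (N : ℕ) (q : ℝ) (hq : 0 < q) : cst N q ≠ 0 := by
  intro h
  unfold cst at h
  have hcont : Continuous (fun g : EN (N+1) => ‖g (0 : Fin (N+1))‖ₑ ^ q) :=
    ENNReal.continuous_rpow_const.comp (by fun_prop)
  rw [lintegral_eq_zero_iff hcont.measurable] at h
  unfold nu at h
  have h2 := Measure.eqOn_open_of_ae_eq h Metric.isOpen_ball hcont.continuousOn
    continuousOn_const
  have h3 := h2 (x := EuclideanSpace.single (0 : Fin (N+1)) (1/2 : ℂ))
    (by rw [mem_ball_zero_iff, EuclideanSpace.norm_single]; norm_num)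
  simp [hq.not_gt, hq] at h3

lemma key (N : ℕ) (q : ℝ) (hq : 0 < q) (a : EN (N+1)) :
    ∫⁻ g, ‖inner ℂ a g‖ₑ ^ q ∂(nu (N+1)) = ‖a‖ₑ ^ q * cst N q := by
  by_cases ha : a = 0
  · subst ha; simp [hq]
  have hn : ‖a‖ ≠ 0 := norm_ne_zero_iff.2 ha
  obtain ⟨b, hb⟩ := Orthonormal.exists_orthonormalBasis_extension_of_card_eq (𝕜 := ℂ)
    (E := EN (N+1)) (ι := Fin (N+1)) (by simp) (v := fun _ => ((‖a‖ : ℂ)⁻¹) • a) (s := {0})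
    (by
      constructor
      · rintro ⟨i, hi⟩
        simp [norm_smul, hn]
      · rintro ⟨i, hi⟩ ⟨j, hj⟩ hij
        simp at hi hj
        exact absurd (Subtype.ext (hi.trans hj.symm)) hij)
  have hb0 := hb 0 rfl
  have ha' : a = (‖a‖ : ℂ) • b 0 := by
    rw [hb0, smul_smul, mul_inv_cancel₀ (by exact_mod_cast hn), one_smul]
  have hin : ∀ g, ‖inner ℂ a g‖ₑ ^ q = ‖a‖ₑ ^ q * ‖(b.repr g) 0‖ₑ ^ q := by
    intro g
    rw [← ENNReal.mul_rpow_of_nonneg _ _ hq.le, b.repr_apply_apply]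
    congr 1
    conv_lhs => rw [ha', inner_smul_left, enorm_mul]
    congr 1
    simp [← ofReal_norm]
  simp_rw [hin]
  have hcont : Continuous (fun g : EN (N+1) => ‖g (0 : Fin (N+1))‖ₑ ^ q) :=
    ENNReal.continuous_rpow_const.comp (by fun_prop)
  rw [lintegral_const_mul (f := fun g => ‖(b.repr g) 0‖ₑ ^ q) _ (hcont.comp b.repr.continuous).measurable]
  congr 1
  exact (map_nu b.repr).lintegral_comp hcont.measurable

variable {X : Type*} [MeasurableSpace X] {μ : Measure X}

lemma sq_integral [SigmaFinite μ] {p : ℝ≥0∞} (N : ℕ) (q : ℝ) (hq : 0 < q)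
    (x : ℕ → Lp ℂ p μ) :
    (∫⁻ ω, ‖(∑ m ∈ Finset.range (N+1), ‖(x m) ω‖ ^ 2 : ℝ) ^ (1 / 2 : ℝ)‖ₑ ^ q ∂μ) * cst N q
      = ∫⁻ g, ∫⁻ ω, ‖((∑ i : Fin (N+1), g i • x i : Lp ℂ p μ)) ω‖ₑ ^ q ∂μ ∂(nu (N+1)) := by
  have hm : ∀ n, Measurable (x n : X → ℂ) := fun n => (Lp.stronglyMeasurable (x n)).measurable
  have h1 : ∀ g : EN (N+1),
      ∫⁻ ω, ‖((∑ i : Fin (N+1), g i • x i : Lp ℂ p μ)) ω‖ₑ ^ q ∂μ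
        = ∫⁻ ω, ‖∑ i : Fin (N+1), g i * (x i) ω‖ₑ ^ q ∂μ := by
    intro g
    apply lintegral_congr_ae
    have h2 : ∀ᵐ ω ∂μ, ∀ i : Fin (N+1), (g i • x i : Lp ℂ p μ) ω = g i * (x i) ω := by
      rw [ae_all_iff]
      intro i
      filter_upwards [Lp.coeFn_smul (g i) (x i)] with ω hω
      rw [hω]; rfl
    filter_upwards [h2, Lp.coeFn_finsetSum Finset.univ (fun i : Fin (N+1) => g i • x i)]
      with ω h3 h4
    rw [h4]
    simp [Finset.sum_apply, h3]
  simp_rw [h1]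
  rw [lintegral_lintegral_swap]
  · have hM : Measurable fun ω => ‖(∑ m ∈ Finset.range (N+1), ‖(x m) ω‖ ^ 2 : ℝ) ^ (1 / 2 : ℝ)‖ₑ ^ q := by
      fun_prop
    rw [← lintegral_mul_const _ hM]
    apply lintegral_congr
    intro ω
    have hk := key N q hq (WithLp.toLp 2 (fun i : Fin (N+1) => (starRingEnd ℂ) ((x i) ω)))
    have e1 : ‖(WithLp.toLp 2 (fun i : Fin (N+1) => (starRingEnd ℂ) ((x i) ω)) : EN (N+1))‖ₑ
        = ‖(∑ m ∈ Finset.range (N+1), ‖(x m) ω‖ ^ 2 : ℝ) ^ (1 / 2 : ℝ)‖ₑ := by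
      rw [← ofReal_norm, ← ofReal_norm, EuclideanSpace.norm_eq, Finset.sum_range,
        ← Real.sqrt_eq_rpow, Real.norm_of_nonneg (Real.sqrt_nonneg _)]
      simp
    rw [e1] at hk
    rw [← hk]
    apply lintegral_congr
    intro g
    simp [PiLp.inner_apply]
  · apply Measurable.aemeasurable
    have : Measurable (fun z : EN (N+1) × X => ∑ i : Fin (N+1), z.1 i * (x i) z.2) := by
      refine Finset.measurable_sum _ fun i _ => Measurable.mul ?_ ((hm i).comp measurable_snd)
      have : Continuous fun z : EN (N+1) => z i := by fun_prop
      exact this.measurable.comp measurable_fst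
    exact (this.enorm).pow_const q

lemma eqn [SigmaFinite μ] {p : ℝ≥0∞} [Fact (1 ≤ p)] (hp : 1 < p) (hp' : p < 2)
    (T : Lp ℂ p μ →L[ℂ] Lp ℂ p μ) (hT : ∀ x : Lp ℂ p μ, ‖T x‖ = ‖x‖)
    (N : ℕ) (x : ℕ → Lp ℂ p μ) :
    eLpNorm (fun ω => (∑ m ∈ Finset.range N, ‖(T (x m)) ω‖ ^ 2 : ℝ) ^ (1 / 2 : ℝ)) p μ
      = eLpNorm (fun ω => (∑ m ∈ Finset.range N, ‖(x m) ω‖ ^ 2 : ℝ) ^ (1 / 2 : ℝ)) p μ := by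
  rcases N with _ | N
  · simp
  have hp0 : p ≠ 0 := (zero_lt_one.trans hp).ne'
  have hpt : p ≠ ∞ := (hp'.trans (by simp)).ne
  have hq : 0 < p.toReal := ENNReal.toReal_pos hp0 hpt
  rw [eLpNorm_eq_lintegral_rpow_enorm_toReal hp0 hpt,
    eLpNorm_eq_lintegral_rpow_enorm_toReal hp0 hpt]
  congr 1
  rw [← ENNReal.mul_left_inj (cst_ne_zero N _ hq) (cst_ne_top N _ hq),
    sq_integral N _ hq, sq_integral N _ hq x]
  apply lintegral_congr
  intro g
  have h1 : (∑ i : Fin (N+1), g i • T (x i)) = T (∑ i : Fin (N+1), g i • x i) := by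
    simp
  rw [h1]
  set y := ∑ i : Fin (N+1), g i • x i
  have h2 : eLpNorm (T y) p μ = eLpNorm y p μ := by
    rw [← Lp.enorm_def, ← Lp.enorm_def, ← ofReal_norm, ← ofReal_norm, hT]
  rw [eLpNorm_eq_lintegral_rpow_enorm_toReal hp0 hpt,
    eLpNorm_eq_lintegral_rpow_enorm_toReal hp0 hpt] at h2
  exact ENNReal.rpow_left_injective (by positivity) h2

end SqFn

/-- Commutative case of Proposition 1.7 for `1 < p < 2`: a linear isometry of `L^p`
extends to a contraction of the `ℓ²`-valued space `L^p(X; ℓ²)`, and to an isometry if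
it is moreover positive. -/
theorem isometry_extension_square_function_small_p
    {X : Type*} [MeasurableSpace X] (μ : Measure X) [SigmaFinite μ]
    (p : ℝ≥0∞) [Fact (1 ≤ p)] (hp : 1 < p) (hp' : p < 2)
    (T : Lp ℂ p μ →L[ℂ] Lp ℂ p μ) (hT : ∀ x : Lp ℂ p μ, ‖T x‖ = ‖x‖) :
    (∀ (N : ℕ) (x : ℕ → Lp ℂ p μ),
      eLpNorm (fun ω => (∑ m ∈ Finset.range N, ‖(T (x m)) ω‖ ^ 2 : ℝ) ^ (1 / 2 : ℝ)) p μ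
        ≤ eLpNorm (fun ω => (∑ m ∈ Finset.range N, ‖(x m) ω‖ ^ 2 : ℝ) ^ (1 / 2 : ℝ)) p μ)
    ∧
    (IsPositiveOp T →
      ∀ (N : ℕ) (x : ℕ → Lp ℂ p μ),
        eLpNorm (fun ω => (∑ m ∈ Finset.range N, ‖(T (x m)) ω‖ ^ 2 : ℝ) ^ (1 / 2 : ℝ)) p μ
          = eLpNorm (fun ω => (∑ m ∈ Finset.range N, ‖(x m) ω‖ ^ 2 : ℝ) ^ (1 / 2 : ℝ)) p μ) := by
  exact ⟨fun N x => (SqFn.eqn hp hp' T hT N x).le, fun _ N x => SqFn.eqn hp hp' T hT N x⟩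
end
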